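/- As n → ∞ along even integers, α(n) / ( 2^{C(n,n/2)} · exp[ C(n, n/2+1) · ( 2^{-n/2} + ((n² − 2n − 16)/32) · 2^{-n} ) ] ) tends to 1, where C(a,b) denotes the binomial coefficient and exp is the natural exponential. (Korshunov's asymptotic solution of Dedekind's problem, even case.) -/

import Mathlib

open Filter

/-- The number of antichains in the `n`-dimensional Boolean lattice. -/
noncomputable def alphaBool (n : ℕ) : ℕ :=
  Nat.card {A : Finset (Finset (Fin n)) // IsAntichain (· ⊆ ·) (A : Set (Finset (Fin n)))}

namespace Dedekind

open Finset

section HardCore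

variable {ι : Type*} [DecidableEq ι]

open Classical in
/-- The partition function of the hard-core model on `P` with conflict relation `R` and
weights `w`. -/
noncomputable def hardCore (R : ι → ι → Prop) (w : ι → ℝ) (P : Finset ι) : ℝ :=
  ∑ Γ ∈ P.powerset.filter fun Γ : Finset ι => (Γ : Set ι).Pairwise fun a b => ¬ R a b,
    ∏ a ∈ Γ, w a

variable {R : ι → ι → Prop} {w : ι → ℝ}

lemma hardCore_empty : hardCore R w ∅ = 1 := by
  classical
  simp [hardCore, Finset.filter_singleton]

open Classical in
lemma hardCore_insert (hR : ∀ a b, R a b → R b a) {b : ι} {P : Finset ι} (hb : b ∉ P) :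
    hardCore R w (insert b P) = hardCore R w P + w b * hardCore R w {c ∈ P | ¬ R b c} := by
  unfold hardCore
  rw [Finset.powerset_insert, Finset.filter_union, Finset.sum_union]
  · congr 1
    rw [Finset.mul_sum]
    symm
    refine Finset.sum_bij' (fun Γ _ => insert b Γ) (fun Γ _ => Γ.erase b) ?_ ?_ ?_ ?_ ?_
    · intro Γ hΓ
      simp only [mem_filter, mem_powerset, mem_image] at hΓ ⊢
      refine ⟨⟨Γ, fun c hc => (mem_filter.1 (hΓ.1 hc)).1, rfl⟩, ?_⟩
      rw [coe_insert, Set.pairwise_insert]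
      refine ⟨hΓ.2, fun c hc _ => ?_⟩
      have := (mem_filter.1 (hΓ.1 hc)).2
      exact ⟨this, fun h => this (hR _ _ h)⟩
    · intro Γ hΓ
      simp only [mem_filter, mem_powerset, mem_image] at hΓ ⊢
      obtain ⟨⟨Δ, hΔ, rfl⟩, hp⟩ := hΓ
      have hbΔ : b ∉ Δ := fun h => hb (hΔ h)
      rw [erase_insert hbΔ]
      rw [coe_insert, Set.pairwise_insert] at hp
      refine ⟨fun c hc => mem_filter.2 ⟨hΔ hc, ?_⟩, hp.1⟩
      exact (hp.2 c hc (fun h => hbΔ (h ▸ hc))).1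
    · intro Γ hΓ
      simp only [mem_filter, mem_powerset] at hΓ
      exact erase_insert fun h => hb (mem_filter.1 (hΓ.1 h)).1
    · intro Γ hΓ
      simp only [mem_filter, mem_powerset, mem_image] at hΓ
      obtain ⟨⟨Δ, hΔ, rfl⟩, hp⟩ := hΓ
      exact insert_erase (mem_insert_self _ _)
    · intro Γ hΓ
      simp only [mem_filter, mem_powerset] at hΓ
      rw [prod_insert fun h => hb (mem_filter.1 (hΓ.1 h)).1]
  · rw [Finset.disjoint_left]
    intro Γ h1 h2
    simp only [mem_filter, mem_powerset, mem_image] at h1 h2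
    obtain ⟨⟨Δ, hΔ, rfl⟩, hp⟩ := h2
    exact hb (h1.1 (mem_insert_self _ _))

lemma hardCore_mono (hw : ∀ a, 0 ≤ w a) {P Q : Finset ι} (h : P ⊆ Q) :
    hardCore R w P ≤ hardCore R w Q := by
  classical
  unfold hardCore
  refine Finset.sum_le_sum_of_subset_of_nonneg ?_ fun Γ _ _ => prod_nonneg fun a _ => hw a
  exact Finset.filter_subset_filter _ (Finset.powerset_mono.2 h)

lemma one_le_hardCore (hw : ∀ a, 0 ≤ w a) (P : Finset ι) : 1 ≤ hardCore R w P := by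
  rw [← hardCore_empty (R := R) (w := w)]
  exact hardCore_mono hw (empty_subset _)

lemma hardCore_insert_le (hR : ∀ a b, R a b → R b a) (hw : ∀ a, 0 ≤ w a) (b : ι) (P : Finset ι) :
    hardCore R w (insert b P) ≤ hardCore R w P + w b * hardCore R w P := by
  classical
  by_cases hb : b ∈ P
  · rw [insert_eq_of_mem hb]
    have := one_le_hardCore (R := R) hw P
    nlinarith [hw b]
  · rw [hardCore_insert hR hb]
    have := hardCore_mono (R := R) hw (filter_subset (fun c => ¬ R b c) P)
    nlinarith [hw b]

lemma hardCore_union_le (hR : ∀ a b, R a b → R b a) (hw : ∀ a, 0 ≤ w a) (P Q : Finset ι) :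
    hardCore R w (P ∪ Q) ≤ hardCore R w P * Real.exp (∑ b ∈ Q, w b) := by
  induction Q using Finset.induction_on with
  | empty => simp
  | insert b Q hb ih =>
    rw [union_insert, sum_insert hb, Real.exp_add]
    have h1 := hardCore_insert_le hR hw b (P ∪ Q)
    have h2 := Real.add_one_le_exp (w b)
    have h3 := one_le_hardCore (R := R) hw (P ∪ Q)
    calc _ ≤ (w b + 1) * hardCore R w (P ∪ Q) := by linarith
      _ ≤ Real.exp (w b) * (hardCore R w P * Real.exp (∑ b ∈ Q, w b)) := by gcongr
      _ = _ := by ring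

lemma hardCore_le_exp (hR : ∀ a b, R a b → R b a) (hw : ∀ a, 0 ≤ w a) (P : Finset ι) :
    hardCore R w P ≤ Real.exp (∑ b ∈ P, w b) := by
  simpa [hardCore_empty] using hardCore_union_le hR hw ∅ P

lemma hardCore_union_sub_le (hR : ∀ a b, R a b → R b a) (hw : ∀ a, 0 ≤ w a) (P N : Finset ι) :
    hardCore R w (P ∪ N) - hardCore R w P ≤ (∑ c ∈ N, w c) * hardCore R w (P ∪ N) := by
  induction N using Finset.induction_on with
  | empty => simp
  | insert c N hc ih =>
    rw [union_insert, sum_insert hc]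
    have h1 := hardCore_insert_le hR hw c (P ∪ N)
    have h2 := hardCore_mono (R := R) hw (subset_insert c (P ∪ N))
    have h3 : 0 ≤ ∑ c ∈ N, w c := sum_nonneg fun a _ => hw a
    nlinarith [hw c]

open Classical in
lemma hardCore_filter_ge (hR : ∀ a b, R a b → R b a) (hw : ∀ a, 0 ≤ w a) (b : ι) (P : Finset ι) :
    (1 - ∑ c ∈ P with R b c, w c) * hardCore R w P ≤ hardCore R w {c ∈ P | ¬ R b c} := by
  have h := hardCore_union_sub_le (R := R) hR hw {c ∈ P | ¬ R b c} {c ∈ P | R b c}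
  rw [union_comm, filter_union_filter_not_eq] at h
  linarith

open Classical in
lemma hardCore_union_ge (hR : ∀ a b, R a b → R b a) (hw : ∀ a, 0 ≤ w a) {δ : ℝ}
    (P N : Finset ι) (hδ1 : δ ≤ 1) (hdis : Disjoint P N)
    (hδ : ∀ b ∈ N, ∑ c ∈ P ∪ N with R b c, w c ≤ δ) :
    hardCore R w P * (1 + (1 - δ) * ∑ c ∈ N, w c) ≤ hardCore R w (P ∪ N) := by
  induction N using Finset.induction_on with
  | empty => simp
  | insert b N hb ih =>
    rw [disjoint_insert_right] at hdis
    have hsub : P ∪ N ⊆ P ∪ insert b N := union_subset_union_right (subset_insert _ _)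
    have ih' := ih hdis.2 fun c hc => le_trans
      (sum_le_sum_of_subset_of_nonneg (filter_subset_filter _ hsub) fun a _ _ => hw a)
      (hδ c (mem_insert_of_mem hc))
    have hbn : b ∉ P ∪ N := by simp [hb, hdis.1]
    rw [union_insert, hardCore_insert hR hbn, sum_insert hb]
    have h1 := hardCore_filter_ge hR hw b (P ∪ N)
    have h2 : ∑ c ∈ P ∪ N with R b c, w c ≤ δ := le_trans
      (sum_le_sum_of_subset_of_nonneg (filter_subset_filter _ hsub) fun a _ _ => hw a)
      (hδ b (mem_insert_self _ _))
    have h3 := hardCore_mono (R := R) hw (subset_union_left (s₁ := P) (s₂ := N))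
    have h4 := one_le_hardCore (R := R) hw P
    have h5 : (1 - δ) * hardCore R w P ≤ hardCore R w {c ∈ P ∪ N | ¬ R b c} := by
      refine le_trans ?_ h1
      exact mul_le_mul (by linarith) h3 (by linarith) (by linarith)
    nlinarith [hw b, mul_le_mul_of_nonneg_left h5 (hw b)]

lemma exp_sub_sq_le_one_add {x : ℝ} (hx : 0 ≤ x) :
    Real.exp (x - x ^ 2) ≤ 1 + x := by
  have h1 := Real.add_one_le_exp (-(x - x ^ 2))
  rw [Real.exp_neg] at h1
  have hp := Real.exp_pos (x - x ^ 2)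
  have h2 : (1 - (x - x ^ 2)) * Real.exp (x - x ^ 2) ≤ 1 := by
    calc _ ≤ (Real.exp (x - x ^ 2))⁻¹ * Real.exp (x - x ^ 2) := by
          gcongr; linarith
      _ = 1 := inv_mul_cancel₀ hp.ne'
  have h3 : 1 ≤ (1 + x) * (1 - (x - x ^ 2)) := by nlinarith [pow_nonneg hx 3]
  have h4 : 0 < 1 - (x - x ^ 2) := by nlinarith
  nlinarith

open Classical in
/-- Adding polymers whose total conflict weight is small multiplies the partition function by
almost `exp` of their total weight. -/
lemma hardCore_union_ge_exp (hR : ∀ a b, R a b → R b a) (hw : ∀ a, 0 ≤ w a) {ε : ℝ}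
    (hε0 : 0 ≤ ε) (hε : ε ≤ 1)
    (P Q : Finset ι) (hdis : Disjoint P Q) (hw1 : ∀ b ∈ Q, w b ≤ ε)
    (h : ∀ b ∈ Q, ∑ c ∈ P ∪ Q with R b c, w c ≤ ε) :
    hardCore R w P * Real.exp ((1 - 2 * ε) * ∑ b ∈ Q, w b) ≤ hardCore R w (P ∪ Q) := by
  induction Q using Finset.induction_on with
  | empty => simp
  | insert b Q hb ih =>
    rw [disjoint_insert_right] at hdis
    have hsub : P ∪ Q ⊆ P ∪ insert b Q := union_subset_union_right (subset_insert _ _)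
    have ih' := ih hdis.2 (fun c hc => hw1 c (mem_insert_of_mem hc)) fun c hc => le_trans
      (sum_le_sum_of_subset_of_nonneg (filter_subset_filter _ hsub) fun a _ _ => hw a)
      (h c (mem_insert_of_mem hc))
    have hbn : b ∉ P ∪ Q := by simp [hb, hdis.1]
    rw [union_insert, hardCore_insert hR hbn, sum_insert hb]
    have h1 := hardCore_filter_ge hR hw b (P ∪ Q)
    have h2 : ∑ c ∈ P ∪ Q with R b c, w c ≤ ε := le_trans
      (sum_le_sum_of_subset_of_nonneg (filter_subset_filter _ hsub) fun a _ _ => hw a)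
      (h b (mem_insert_self _ _))
    have h4 := one_le_hardCore (R := R) hw (P ∪ Q)
    have h5 : (1 - ε) * hardCore R w (P ∪ Q) ≤ hardCore R w {c ∈ P ∪ Q | ¬ R b c} := by
      refine le_trans ?_ h1
      gcongr
    have hb1 := hw1 b (mem_insert_self _ _)
    have hb0 := hw b
    have h6 : Real.exp ((1 - 2 * ε) * w b) ≤ 1 + w b * (1 - ε) := by
      have hx0 : 0 ≤ w b * (1 - ε) := mul_nonneg hb0 (by linarith)
      have hx1 : w b * (1 - ε) ≤ ε := by nlinarith
      refine le_trans (Real.exp_le_exp.2 ?_) (exp_sub_sq_le_one_add hx0)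
      nlinarith [mul_nonneg hb0 hε0, mul_nonneg hx0 (sub_nonneg.2 hx1)]
    rw [mul_add, Real.exp_add]
    calc _ = Real.exp ((1 - 2 * ε) * w b) *
          (hardCore R w P * Real.exp ((1 - 2 * ε) * ∑ b ∈ Q, w b)) := by ring
      _ ≤ (1 + w b * (1 - ε)) * hardCore R w (P ∪ Q) :=
          mul_le_mul h6 ih' (by have := one_le_hardCore (R := R) hw P; positivity)
            (by nlinarith)
      _ ≤ _ := by nlinarith [mul_le_mul_of_nonneg_left h5 hb0]

open Classical in
/-- The number of ordered conflicting pairs in `P`. -/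
noncomputable def conflicts (R : ι → ι → Prop) (P : Finset ι) : ℕ :=
  ∑ a ∈ P, #{b ∈ P | R a b}

open Classical in
lemma conflicts_insert (hR : ∀ a b, R a b → R b a) (hirr : ∀ a, ¬ R a a) {b : ι} {P : Finset ι}
    (hb : b ∉ P) : conflicts R (insert b P) = conflicts R P + 2 * #{c ∈ P | R b c} := by
  unfold conflicts
  rw [sum_insert hb, filter_insert, if_neg (hirr b)]
  have : ∀ a ∈ P, #{c ∈ insert b P | R a c} = #{c ∈ P | R a c} + if R b a then 1 else 0 := by
    intro a ha
    rw [filter_insert]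
    by_cases h : R b a
    · rw [if_pos (hR _ _ h), if_pos h, card_insert_of_notMem]
      simp [hb]
    · rw [if_neg (fun h' => h (hR _ _ h')), if_neg h, add_zero]
  rw [sum_congr rfl this, sum_add_distrib, ← card_filter]
  ring

open Classical in
lemma hardCore_ge_exp_of_const (hR : ∀ a b, R a b → R b a) (hirr : ∀ a, ¬ R a a) {l : ℝ}
    (hl : 0 ≤ l) {Δ : ℝ} (hΔ : l * Δ ≤ 1) (P : Finset ι)
    (hdeg : ∀ b ∈ P, (#{c ∈ P | R b c} : ℝ) ≤ Δ) :
    Real.exp (l * #P - l ^ 2 * (conflicts R P / 2) - #P * l ^ 2) ≤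
      hardCore R (fun _ => l) P := by
  induction P using Finset.induction_on with
  | empty => simp [conflicts, hardCore_empty]
  | insert b P hb ih =>
    have hsub := subset_insert b P
    have ih' := ih fun c hc => le_trans (Nat.cast_le.2 (card_le_card
      (filter_subset_filter _ hsub))) (hdeg c (mem_insert_of_mem hc))
    have hd : (#{c ∈ P | R b c} : ℝ) ≤ Δ := le_trans (Nat.cast_le.2 (card_le_card
      (filter_subset_filter _ hsub))) (hdeg b (mem_insert_self _ _))
    have hw : ∀ a : ι, 0 ≤ (fun _ : ι => l) a := fun _ => hl
    rw [hardCore_insert hR hb, conflicts_insert hR hirr hb, card_insert_of_notMem hb]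
    have h1 := hardCore_filter_ge hR hw b P
    simp only [sum_const, nsmul_eq_mul] at h1
    set d : ℝ := (#{c ∈ P | R b c} : ℝ) with hddef
    have hd0 : 0 ≤ d := by positivity
    have h4 := one_le_hardCore (R := R) hw P
    have hld : l * d ≤ 1 := le_trans (by gcongr) hΔ
    have h6 : Real.exp (l - l ^ 2 * d - l ^ 2) ≤ 1 + l * (1 - d * l) := by
      have hx0 : 0 ≤ l * (1 - d * l) := mul_nonneg hl (by linarith)
      have hx1 : l * (1 - d * l) ≤ l := by nlinarith [mul_nonneg hl (mul_nonneg hd0 hl)]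
      refine le_trans (Real.exp_le_exp.2 ?_) (exp_sub_sq_le_one_add hx0)
      nlinarith
    push_cast
    rw [show l * (#P + 1) - l ^ 2 * ((conflicts R P + 2 * d) / 2) - (#P + 1) * l ^ 2 =
      (l - l ^ 2 * d - l ^ 2) + (l * #P - l ^ 2 * (conflicts R P / 2) - #P * l ^ 2) by ring,
      Real.exp_add]
    calc _ ≤ (1 + l * (1 - d * l)) * hardCore R (fun _ => l) P := by
          gcongr
          nlinarith
      _ ≤ _ := by nlinarith [mul_le_mul_of_nonneg_left h1 hl]

open Classical in
lemma hardCore_le_exp_of_const (hR : ∀ a b, R a b → R b a) (hirr : ∀ a, ¬ R a a) {l : ℝ}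
    (hl : 0 ≤ l) {Δ : ℝ} (hΔ : l * Δ ≤ 1) (P : Finset ι)
    (hdeg : ∀ b ∈ P, (#{c ∈ P | R b c} : ℝ) ≤ Δ) :
    hardCore R (fun _ => l) P ≤
      Real.exp (l * #P - l ^ 2 * (conflicts R P / 2) + #P * (2 * l ^ 3 * Δ ^ 2)) := by
  induction P using Finset.induction_on with
  | empty => simp [conflicts, hardCore_empty]
  | insert b P hb ih =>
    have hsub := subset_insert b P
    have hdeg' : ∀ c ∈ P, (#{a ∈ P | R c a} : ℝ) ≤ Δ := fun c hc =>
      le_trans (Nat.cast_le.2 (card_le_card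
      (filter_subset_filter _ hsub))) (hdeg c (mem_insert_of_mem hc))
    have ih' := ih hdeg'
    have hd : (#{c ∈ P | R b c} : ℝ) ≤ Δ := le_trans (Nat.cast_le.2 (card_le_card
      (filter_subset_filter _ hsub))) (hdeg b (mem_insert_self _ _))
    have hw : ∀ a : ι, 0 ≤ (fun _ : ι => l) a := fun _ => hl
    have hge := hardCore_union_ge (R := R) hR hw (δ := l * Δ) {c ∈ P | ¬ R b c} {c ∈ P | R b c}
      hΔ (disjoint_filter_filter_not _ _ _).symm (by
        intro c hc
        rw [union_comm, filter_union_filter_not_eq, sum_const, nsmul_eq_mul, mul_comm]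
        have := hdeg' c (mem_filter.1 hc).1
        gcongr)
    rw [union_comm, filter_union_filter_not_eq, sum_const, nsmul_eq_mul] at hge
    rw [hardCore_insert hR hb, conflicts_insert hR hirr hb, card_insert_of_notMem hb]
    set d : ℝ := (#{c ∈ P | R b c} : ℝ) with hddef
    set Z := hardCore R (fun _ => l) P
    set Y := hardCore R (fun _ => l) {c ∈ P | ¬ R b c}
    have hd0 : 0 ≤ d := by positivity
    have hΔ0 : 0 ≤ Δ := hd0.trans hd
    have hZ : 1 ≤ Z := one_le_hardCore (R := R) hw P
    have hY : 1 ≤ Y := one_le_hardCore (R := R) hw _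
    have hld : d * l ≤ 1 := by nlinarith
    have hdl0 : 0 ≤ d * l := by positivity
    have hYZ : Y ≤ (1 - d * l + 2 * l ^ 2 * Δ ^ 2) * Z := by
      have key : 1 ≤ (1 - d * l + 2 * l ^ 2 * Δ ^ 2) * (1 + (1 - l * Δ) * (d * l)) := by
        have h1 : d * l ≤ l * Δ := by nlinarith
        have h2 : 0 ≤ (1 - l * Δ) * (d * l) := mul_nonneg (by linarith) hdl0
        have h3 : 2 * l ^ 2 * Δ ^ 2 = 2 * (l * Δ) ^ 2 := by ring
        rw [h3]
        have h4 : 0 ≤ (l * Δ) ^ 2 * ((1 - l * Δ) * (d * l)) := by positivity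
        nlinarith [mul_nonneg hdl0 (sub_nonneg.2 h1), mul_nonneg hdl0 hdl0,
          mul_nonneg (hdl0.trans h1) (hdl0.trans h1),
          mul_nonneg (hdl0.trans h1) (mul_nonneg hdl0 hdl0),
          mul_nonneg (hdl0.trans h1) (sub_nonneg.2 h1)]
      have hc0 : 0 ≤ 1 - d * l + 2 * l ^ 2 * Δ ^ 2 := by
        have : 0 ≤ 2 * l ^ 2 * Δ ^ 2 := by positivity
        linarith
      calc Y = 1 * Y := (one_mul _).symm
        _ ≤ (1 - d * l + 2 * l ^ 2 * Δ ^ 2) * (1 + (1 - l * Δ) * (d * l)) * Y := by gcongr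
        _ = (1 - d * l + 2 * l ^ 2 * Δ ^ 2) * (Y * (1 + (1 - l * Δ) * (d * l))) := by ring
        _ ≤ _ := by gcongr
    have h6 := Real.add_one_le_exp (l * (1 - d * l + 2 * l ^ 2 * Δ ^ 2))
    push_cast
    rw [show l * (#P + 1) - l ^ 2 * ((conflicts R P + 2 * d) / 2) +
        (#P + 1) * (2 * l ^ 3 * Δ ^ 2) =
      l * (1 - d * l + 2 * l ^ 2 * Δ ^ 2) +
        (l * #P - l ^ 2 * (conflicts R P / 2) + #P * (2 * l ^ 3 * Δ ^ 2)) by ring,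
      Real.exp_add]
    calc Z + l * Y ≤ (l * (1 - d * l + 2 * l ^ 2 * Δ ^ 2) + 1) * Z := by
          nlinarith [mul_le_mul_of_nonneg_left hYZ hl]
      _ ≤ _ := by gcongr

end HardCore

section Linked

variable {V : Type*} [DecidableEq V]

/-- A nonempty finite set is linked if every cut of it is crossed by `R`. -/
def Linked (R : V → V → Prop) (W : Finset V) : Prop :=
  W.Nonempty ∧ ∀ P ⊆ W, P.Nonempty → P ≠ W → ∃ a ∈ P, ∃ b ∈ W \ P, R a b

/-- The vertex sets of the walks of length `L` from `v`, steps being taken in `nb`. -/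
def walkSets (nb : V → Finset V) : ℕ → V → Finset (Finset V)
  | 0, v => {{v}}
  | L + 1, v => (nb v).biUnion fun b => (walkSets nb L b).image (insert v)

lemma card_walkSets_le {nb : V → Finset V} {Δ : ℕ} (h : ∀ v, #(nb v) ≤ Δ) (L : ℕ) (v : V) :
    #(walkSets nb L v) ≤ Δ ^ L := by
  induction L generalizing v with
  | zero => simp [walkSets]
  | succ L ih =>
    rw [walkSets, pow_succ']
    refine card_biUnion_le.trans ?_
    calc _ ≤ ∑ b ∈ nb v, Δ ^ L := sum_le_sum fun b _ => card_image_le.trans (ih b)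
      _ = #(nb v) * Δ ^ L := by rw [sum_const, smul_eq_mul]
      _ ≤ _ := Nat.mul_le_mul_right _ (h v)

lemma mem_of_mem_walkSets {nb : V → Finset V} {L : ℕ} {v : V} {W : Finset V}
    (h : W ∈ walkSets nb L v) : v ∈ W := by
  cases L with
  | zero => rw [walkSets, mem_singleton] at h; simp [h]
  | succ L =>
    simp only [walkSets, mem_biUnion, mem_image] at h
    obtain ⟨b, _, W', _, rfl⟩ := h
    exact mem_insert_self _ _

lemma insert_mem_walkSets {nb : V → Finset V} {L : ℕ} {v x y : V} {W : Finset V}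
    (h : W ∈ walkSets nb L v) (hx : x ∈ W) (hxy : y ∈ nb x) (hyx : x ∈ nb y) :
    insert y W ∈ walkSets nb (L + 2) v := by
  induction L generalizing v W with
  | zero =>
    rw [walkSets, mem_singleton] at h
    subst h
    rw [mem_singleton] at hx
    subst hx
    simp only [walkSets, mem_biUnion, mem_image]
    exact ⟨y, hxy, {y, x}, ⟨x, hyx, {x}, by simp, rfl⟩, by ext; simp⟩
  | succ L ih =>
    have h' := h
    simp only [walkSets, mem_biUnion, mem_image] at h
    obtain ⟨b, hb, W', hW', rfl⟩ := h
    by_cases hxv : x = v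
    · subst hxv
      rw [walkSets, mem_biUnion]
      refine ⟨y, hxy, mem_image.2 ⟨insert y (insert x W'), ?_, ?_⟩⟩
      · rw [walkSets, mem_biUnion]
        exact ⟨x, hyx, mem_image.2 ⟨insert x W', h', rfl⟩⟩
      · ext; simp
    · have hxW : x ∈ W' := (mem_insert.1 hx).resolve_left hxv
      rw [walkSets, mem_biUnion]
      exact ⟨b, hb, mem_image.2 ⟨insert y W', ih hW' hxW, by rw [insert_comm]⟩⟩

lemma Linked.mem_walkSets {R : V → V → Prop} {nb : V → Finset V}
    (hnb : ∀ a b, R a b → b ∈ nb a ∧ a ∈ nb b) {W : Finset V} (hW : Linked R W) {v : V}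
    (hv : v ∈ W) : W ∈ walkSets nb (2 * (#W - 1)) v := by
  have key : ∀ j, j < #W → ∃ P ⊆ W, #P = j + 1 ∧ P ∈ walkSets nb (2 * j) v := by
    intro j
    induction j with
    | zero => intro _; exact ⟨{v}, by simpa using hv, by simp, by simp [walkSets]⟩
    | succ j ih =>
      intro hj
      obtain ⟨P, hPW, hPc, hP⟩ := ih (by omega)
      obtain ⟨a, ha, b, hb, hab⟩ := hW.2 P hPW ⟨v, mem_of_mem_walkSets hP⟩
        (by rintro rfl; omega)
      rw [Finset.mem_sdiff] at hb
      refine ⟨insert b P, insert_subset hb.1 hPW, by rw [card_insert_of_notMem hb.2, hPc], ?_⟩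
      exact insert_mem_walkSets hP ha (hnb _ _ hab).1 (hnb _ _ hab).2
  have hpos : 0 < #W := card_pos.2 ⟨v, hv⟩
  obtain ⟨P, hPW, hPc, hP⟩ := key (#W - 1) (by omega)
  rwa [eq_of_subset_of_card_le hPW (by omega)] at hP

/-- The number of linked sets of given size through a given vertex. -/
lemma card_linked_le {R : V → V → Prop} {nb : V → Finset V} {Δ : ℕ}
    (hnb : ∀ a b, R a b → b ∈ nb a ∧ a ∈ nb b) (hΔ : ∀ v, #(nb v) ≤ Δ) (v : V) (s : ℕ)
    (𝓕 : Finset (Finset V)) (h : ∀ W ∈ 𝓕, Linked R W ∧ #W = s ∧ v ∈ W) :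
    #𝓕 ≤ Δ ^ (2 * (s - 1)) := by
  refine le_trans (card_le_card fun W hW => ?_) (card_walkSets_le hΔ (2 * (s - 1)) v)
  obtain ⟨h1, rfl, h3⟩ := h W hW
  exact h1.mem_walkSets hnb h3

/-- Linkedness is inherited by any set that is close to a linked set and vice versa. -/
lemma Linked.transfer {R R' : V → V → Prop} {near : V → V → Prop} {D W : Finset V}
    (hD : Linked R D) (hDW : ∀ x ∈ D, ∃ y ∈ W, near x y) (hWD : ∀ y ∈ W, ∃ x ∈ D, near y x)
    (h2' : ∀ x y z, near y x → near x z → R' y z)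
    (h3 : ∀ x y x' y', R x x' → near x y → near x' y' → R' y y')
    (hsymm : ∀ x y, R' x y → R' y x) :
    Linked R' W := by
  classical
  obtain ⟨x0, hx0⟩ := hD.1
  obtain ⟨y0, hy0, -⟩ := hDW x0 hx0
  refine ⟨⟨y0, hy0⟩, fun P hP hPne hPW => ?_⟩
  by_contra hcon
  push Not at hcon
  obtain ⟨p, hp⟩ := hPne
  obtain ⟨q, hqW, hqP⟩ : ∃ q ∈ W, q ∉ P := by
    by_contra h
    push Not at h
    exact hPW (subset_antisymm hP h)
  have hq : q ∈ W \ P := Finset.mem_sdiff.2 ⟨hqW, hqP⟩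
  let PD := {x ∈ D | ∃ y ∈ P, near x y}
  obtain ⟨xp, hxp, hpx⟩ := hWD p (hP hp)
  have hxpP : xp ∈ PD := by
    obtain ⟨y, hy, hxy⟩ := hDW xp hxp
    by_cases hyP : y ∈ P
    · exact mem_filter.2 ⟨hxp, y, hyP, hxy⟩
    · exact (hcon p hp y (Finset.mem_sdiff.2 ⟨hy, hyP⟩) (h2' xp p y hpx hxy)).elim
  obtain ⟨xq, hxq, hqx⟩ := hWD q hqW
  have hxqP : xq ∉ PD := by
    intro h
    obtain ⟨y, hy, hxy⟩ := (mem_filter.1 h).2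
    exact hcon y hy q hq (hsymm _ _ (h2' xq q y hqx hxy))
  obtain ⟨a, ha, b, hb, hab⟩ := hD.2 PD (filter_subset _ _) ⟨xp, hxpP⟩
    (fun h => hxqP (h ▸ hxq))
  rw [Finset.mem_sdiff] at hb
  obtain ⟨y, hy, hay⟩ := (mem_filter.1 ha).2
  obtain ⟨z, hz, hbz⟩ := hDW b hb.1
  have hzP : z ∉ P := fun h => hb.2 (mem_filter.2 ⟨hb.1, z, h, hbz⟩)
  exact hcon y hy z (Finset.mem_sdiff.2 ⟨hz, hzP⟩) (h3 a y b z hab hay hbz)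

/-- `c` is a connected component of `γ`. -/
def IsComp (R : V → V → Prop) (γ c : Finset V) : Prop :=
  c ⊆ γ ∧ Linked R c ∧ ∀ a ∈ c, ∀ b ∈ γ \ c, ¬ R a b

lemma exists_isComp {R : V → V → Prop} (hR : ∀ a b, R a b → R b a) {γ : Finset V} {a : V}
    (ha : a ∈ γ) : ∃ c, IsComp R γ c ∧ a ∈ c := by
  classical
  let 𝓢 := {c ∈ γ.powerset | a ∈ c ∧ ∀ x ∈ c, ∀ y ∈ γ \ c, ¬ R x y}
  have hne : 𝓢.Nonempty := ⟨γ, by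
    simpa [𝓢, ha] using fun x _ y hy hy' => absurd hy hy'⟩
  obtain ⟨c, hc, hmin⟩ := exists_min_image 𝓢 card hne
  simp only [𝓢, mem_filter, mem_powerset] at hc hmin
  obtain ⟨hcγ, hac, hiso⟩ := hc
  refine ⟨c, ⟨hcγ, ⟨⟨a, hac⟩, fun P hP hPne hPc => ?_⟩, hiso⟩, hac⟩
  by_contra hcon
  push Not at hcon
  by_cases haP : a ∈ P
  · have := hmin P ⟨hP.trans hcγ, haP, fun x hx y hy => ?_⟩
    · exact hPc (eq_of_subset_of_card_le hP this)
    · rw [Finset.mem_sdiff] at hy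
      by_cases hyc : y ∈ c
      · exact hcon x hx y (Finset.mem_sdiff.2 ⟨hyc, hy.2⟩)
      · exact hiso x (hP hx) y (Finset.mem_sdiff.2 ⟨hy.1, hyc⟩)
  · have := hmin (c \ P) ⟨sdiff_subset.trans hcγ, Finset.mem_sdiff.2 ⟨hac, haP⟩, fun x hx y hy => ?_⟩
    · have h1 := card_sdiff_add_card_eq_card hP
      have h2 := card_pos.2 hPne
      omega
    · rw [Finset.mem_sdiff] at hx hy
      by_cases hyc : y ∈ c
      · have hyP : y ∈ P := by
          by_contra h
          exact hy.2 (Finset.mem_sdiff.2 ⟨hyc, h⟩)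
        exact fun h => hcon y hyP x (Finset.mem_sdiff.2 hx) (hR _ _ h)
      · exact hiso x hx.1 y (Finset.mem_sdiff.2 ⟨hy.1, hyc⟩)

lemma IsComp.subset_of_inter {R : V → V → Prop} {γ c c' : Finset V} (h : IsComp R γ c)
    (h' : IsComp R γ c') {a : V} (ha : a ∈ c) (ha' : a ∈ c') : c ⊆ c' := by
  by_contra hcon
  obtain ⟨x, hx, y, hy, hxy⟩ := h.2.1.2 (c ∩ c') inter_subset_left ⟨a, mem_inter.2 ⟨ha, ha'⟩⟩
    (fun h => hcon (inter_eq_left.1 h))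
  rw [mem_inter] at hx
  rw [Finset.mem_sdiff, mem_inter] at hy
  exact h'.2.2 x hx.2 y (Finset.mem_sdiff.2 ⟨h.1 hy.1, fun h => hy.2 ⟨hy.1, h⟩⟩) hxy

lemma IsComp.eq_of_inter {R : V → V → Prop} {γ c c' : Finset V} (h : IsComp R γ c)
    (h' : IsComp R γ c') {a : V} (ha : a ∈ c) (ha' : a ∈ c') : c = c' :=
  subset_antisymm (h.subset_of_inter h' ha ha') (h'.subset_of_inter h ha' ha)

open Classical in
/-- The connected components of `γ`. -/
noncomputable def comps (R : V → V → Prop) (γ : Finset V) : Finset (Finset V) :=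
  {c ∈ γ.powerset | IsComp R γ c}

lemma mem_comps {R : V → V → Prop} {γ c : Finset V} : c ∈ comps R γ ↔ IsComp R γ c := by
  classical
  simp only [comps, mem_filter, mem_powerset, and_iff_right_iff_imp]
  exact fun h => h.1

lemma biUnion_comps {R : V → V → Prop} (hR : ∀ a b, R a b → R b a) (γ : Finset V) :
    (comps R γ).biUnion id = γ := by
  ext a
  simp only [mem_biUnion, id, mem_comps]
  constructor
  · rintro ⟨c, hc, ha⟩
    exact hc.1 ha
  · intro ha
    exact exists_isComp hR ha

end Linked

section Polymers

variable {V β : Type*} [DecidableEq V] [DecidableEq β]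

/-- Two sites touch if their supports meet. -/
def Touch (σ : V → Finset β) (a b : V) : Prop := ¬ Disjoint (σ a) (σ b)

/-- Two distinct polymers conflict if their supports meet. -/
def Conflict (σ : V → Finset β) (c d : Finset V) : Prop :=
  c ≠ d ∧ ¬ Disjoint (c.biUnion σ) (d.biUnion σ)

/-- The weight `2 ^ (-|σ(c)|)` of a polymer. -/
noncomputable def polyWeight (σ : V → Finset β) (c : Finset V) : ℝ := (1 / 2) ^ #(c.biUnion σ)

variable {σ : V → Finset β}

lemma touch_symm (a b : V) (h : Touch σ a b) : Touch σ b a := fun h' => h h'.symm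

lemma conflict_symm (a b : Finset V) (h : Conflict σ a b) : Conflict σ b a :=
  ⟨h.1.symm, fun h' => h.2 h'.symm⟩

lemma conflict_irrefl (a : Finset V) : ¬ Conflict σ a a := fun h => h.1 rfl

lemma polyWeight_nonneg (c : Finset V) : 0 ≤ polyWeight σ c := by unfold polyWeight; positivity

lemma prod_polyWeight {Γ : Finset (Finset V)}
    (h : (Γ : Set (Finset V)).Pairwise fun a b => ¬ Conflict σ a b) :
    ∏ c ∈ Γ, polyWeight σ c = polyWeight σ (Γ.biUnion id) := by
  unfold polyWeight
  rw [prod_pow_eq_pow_sum, biUnion_biUnion, card_biUnion]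
  · rfl
  · intro c hc d hd hcd
    have := h hc hd hcd
    unfold Conflict at this
    push Not at this
    exact this hcd

lemma comps_pairwise (γ : Finset V) :
    (comps (Touch σ) γ : Set (Finset V)).Pairwise fun a b => ¬ Conflict σ a b := by
  intro c hc d hd hcd
  rw [mem_coe, mem_comps] at hc hd
  rintro ⟨-, h⟩
  rw [disjoint_biUnion_left] at h
  push Not at h
  obtain ⟨a, ha, h⟩ := h
  rw [disjoint_biUnion_right] at h
  push Not at h
  obtain ⟨b, hb, h⟩ := h
  refine hc.2.2 a ha b (Finset.mem_sdiff.2 ⟨hd.1 hb, fun hbc => hcd ?_⟩) h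
  exact hc.eq_of_inter hd hbc hb

lemma comps_biUnion {Γ : Finset (Finset V)} (hlink : ∀ c ∈ Γ, Linked (Touch σ) c)
    (h : (Γ : Set (Finset V)).Pairwise fun a b => ¬ Conflict σ a b) :
    comps (Touch σ) (Γ.biUnion id) = Γ := by
  have h1 : ∀ c ∈ Γ, IsComp (Touch σ) (Γ.biUnion id) c := by
    intro c hc
    refine ⟨subset_biUnion_of_mem id hc, hlink c hc, fun a ha b hb hab => ?_⟩
    rw [Finset.mem_sdiff, mem_biUnion] at hb
    obtain ⟨⟨d, hd, hbd⟩, hbc⟩ := hb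
    have hcd : c ≠ d := fun h => hbc (h ▸ hbd)
    refine h hc hd hcd ⟨hcd, fun hdis => hab ?_⟩
    exact hdis.mono (subset_biUnion_of_mem σ ha) (subset_biUnion_of_mem σ hbd)
  ext c
  rw [mem_comps]
  refine ⟨fun hc => ?_, h1 c⟩
  obtain ⟨a, ha⟩ := hc.2.1.1
  obtain ⟨d, hd, had⟩ := mem_biUnion.1 (hc.1 ha)
  rwa [hc.eq_of_inter (h1 d hd) ha had]

lemma sum_polyWeight_le_hardCore (𝒜 P : Finset (Finset V))
    (h : ∀ γ ∈ 𝒜, comps (Touch σ) γ ⊆ P) :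
    ∑ γ ∈ 𝒜, polyWeight σ γ ≤ hardCore (Conflict σ) (polyWeight σ) P := by
  classical
  unfold hardCore
  have hinj : Set.InjOn (comps (Touch σ)) (𝒜 : Set (Finset V)) := by
    intro γ _ γ' _ hγ
    rw [← biUnion_comps (R := Touch σ) touch_symm γ, ← biUnion_comps (R := Touch σ) touch_symm γ',
      hγ]
  calc ∑ γ ∈ 𝒜, polyWeight σ γ
      = ∑ γ ∈ 𝒜, ∏ c ∈ comps (Touch σ) γ, polyWeight σ c := by
        refine sum_congr rfl fun γ _ => ?_
        rw [prod_polyWeight (comps_pairwise γ), biUnion_comps touch_symm]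
    _ = ∑ Γ ∈ 𝒜.image (comps (Touch σ)), ∏ c ∈ Γ, polyWeight σ c := by
        rw [sum_image hinj]
    _ ≤ _ := by
        refine sum_le_sum_of_subset_of_nonneg ?_ fun Γ _ _ =>
          prod_nonneg fun c _ => polyWeight_nonneg c
        intro Γ hΓ
        obtain ⟨γ, hγ, rfl⟩ := mem_image.1 hΓ
        exact mem_filter.2 ⟨mem_powerset.2 (h γ hγ), comps_pairwise γ⟩

lemma hardCore_le_sum_polyWeight (𝒜 P : Finset (Finset V)) (hlink : ∀ c ∈ P, Linked (Touch σ) c)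
    (h : ∀ Γ ⊆ P, (Γ : Set (Finset V)).Pairwise (fun a b => ¬ Conflict σ a b) →
      Γ.biUnion id ∈ 𝒜) :
    hardCore (Conflict σ) (polyWeight σ) P ≤ ∑ γ ∈ 𝒜, polyWeight σ γ := by
  classical
  unfold hardCore
  set 𝓖 := P.powerset.filter fun Γ : Finset (Finset V) =>
    (Γ : Set (Finset V)).Pairwise fun a b => ¬ Conflict σ a b with h𝓖
  have hmem : ∀ Γ ∈ 𝓖, Γ ⊆ P ∧ (Γ : Set (Finset V)).Pairwise fun a b => ¬ Conflict σ a b := by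
    intro Γ hΓ
    rw [h𝓖, mem_filter, mem_powerset] at hΓ
    exact hΓ
  have hinj : Set.InjOn (fun Γ : Finset (Finset V) => Γ.biUnion id)
      (𝓖 : Set (Finset (Finset V))) := by
    intro Γ hΓ Γ' hΓ' hu
    have h1 := hmem Γ hΓ
    have h2 := hmem Γ' hΓ'
    rw [← comps_biUnion (fun c hc => hlink c (h1.1 hc)) h1.2,
      ← comps_biUnion (fun c hc => hlink c (h2.1 hc)) h2.2]
    simp only at hu
    rw [hu]
  calc _ = ∑ Γ ∈ 𝓖, polyWeight σ (Γ.biUnion id) :=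
        sum_congr rfl fun Γ hΓ => prod_polyWeight (hmem Γ hΓ).2
    _ = ∑ γ ∈ 𝓖.image (fun Γ => Γ.biUnion id), polyWeight σ γ := by rw [sum_image hinj]
    _ ≤ _ := by
        refine sum_le_sum_of_subset_of_nonneg ?_ fun γ _ _ => polyWeight_nonneg γ
        intro γ hγ
        obtain ⟨Γ, hΓ, rfl⟩ := mem_image.1 hγ
        exact h Γ (hmem Γ hΓ).1 (hmem Γ hΓ).2

end Polymers

section Container

variable {V : Type*} [DecidableEq V]

/-- A biregular bipartite graph without 4-cycles, with parts `X`, `Y`, neighbourhoods `N` of the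
elements of `X` and `M` of the elements of `Y`. -/
structure Biregular (X Y : Finset V) (N M : V → Finset V) (r u : ℕ) : Prop where
  N_subset : ∀ x ∈ X, N x ⊆ Y
  M_subset : ∀ y ∈ Y, M y ⊆ X
  mem_iff : ∀ x ∈ X, ∀ y ∈ Y, y ∈ N x ↔ x ∈ M y
  card_N : ∀ x ∈ X, #(N x) = r
  card_M : ∀ y ∈ Y, #(M y) = u
  codeg : ∀ x ∈ X, ∀ x' ∈ X, x ≠ x' → #(N x ∩ N x') ≤ 1

lemma exists_greedy (A B : Finset V) (f : V → Finset V) {τ : ℕ} (hτ : 0 < τ) :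
    ∃ T ⊆ A, τ * #T ≤ #(T.biUnion f \ B) ∧ ∀ z ∈ A, #(f z \ (B ∪ T.biUnion f)) < τ := by
  obtain ⟨T, hT, hmax⟩ := exists_max_image {T ∈ A.powerset | τ * #T ≤ #(T.biUnion f \ B)} card
    ⟨∅, by simp⟩
  simp only [mem_filter, mem_powerset] at hT hmax
  refine ⟨T, hT.1, hT.2, fun z hz => ?_⟩
  by_contra hcon
  push Not at hcon
  have hzT : z ∉ T := by
    intro h
    have : f z \ (B ∪ T.biUnion f) = ∅ :=
      sdiff_eq_empty_iff_subset.2 ((subset_biUnion_of_mem f h).trans subset_union_right)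
    rw [this, card_empty] at hcon
    omega
  have h1 := hmax (insert z T) ⟨insert_subset hz hT.1, ?_⟩
  · rw [card_insert_of_notMem hzT] at h1
    omega
  · rw [card_insert_of_notMem hzT, biUnion_insert]
    have h2 : (f z ∪ T.biUnion f) \ B = (f z \ (B ∪ T.biUnion f)) ∪ (T.biUnion f \ B) := by
      ext a
      simp only [Finset.mem_sdiff, mem_union]
      tauto
    rw [h2, card_union_of_disjoint]
    · have := hT.2
      rw [mul_add]
      omega
    · rw [disjoint_left]
      intro a ha hb
      rw [Finset.mem_sdiff, mem_union] at ha
      exact ha.2 (Or.inr (Finset.mem_sdiff.1 hb).1)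

namespace Biregular

variable {X Y : Finset V} {N M : V → Finset V} {r u : ℕ}

lemma sum_card (h : Biregular X Y N M r u) {A B : Finset V} (hA : A ⊆ Y) (hB : B ⊆ X) :
    ∑ y ∈ A, #(M y ∩ B) = ∑ x ∈ B, #(N x ∩ A) := by
  have := sum_card_bipartiteAbove_eq_sum_card_bipartiteBelow (s := A) (t := B)
    (fun y x => x ∈ M y)
  convert this using 3 with y hy x hx
  · ext x
    simp [bipartiteAbove, and_comm]
  · ext y
    simp only [bipartiteBelow, mem_inter, mem_filter]
    constructor
    · rintro ⟨h1, h2⟩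
      exact ⟨h2, (h.mem_iff x (hB hx) y (hA h2)).1 h1⟩
    · rintro ⟨h1, h2⟩
      exact ⟨(h.mem_iff x (hB hx) y (hA h1)).2 h2, h1⟩

/-- The elements of `X` all of whose neighbours are in `G`. -/
def _root_.Dedekind.inner (X : Finset V) (N : V → Finset V) (G : Finset V) : Finset V :=
  {x ∈ X | N x ⊆ G}

lemma mem_inner {G : Finset V} {x : V} : x ∈ inner X N G ↔ x ∈ X ∧ N x ⊆ G := by
  simp [inner]

lemma sum_sdiff_add (h : Biregular X Y N M r u) {G : Finset V} (hG : G ⊆ Y) :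
    ∑ y ∈ G, #(M y \ inner X N G) + r * #(inner X N G) = u * #G := by
  have hC : inner X N G ⊆ X := filter_subset _ _
  have h1 := h.sum_card hG hC
  have h2 : ∑ x ∈ inner X N G, #(N x ∩ G) = r * #(inner X N G) := by
    rw [mul_comm, ← smul_eq_mul, ← sum_const]
    refine sum_congr rfl fun x hx => ?_
    rw [mem_inner] at hx
    rw [inter_eq_left.2 hx.2, h.card_N x hx.1]
  rw [← h2, ← h1, ← sum_add_distrib, mul_comm, ← smul_eq_mul, ← sum_const]
  refine sum_congr rfl fun y hy => ?_
  rw [card_sdiff_add_card_inter, h.card_M y (hG hy)]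

lemma sum_sdiff_le (h : Biregular X Y N M r u) {G : Finset V} (hG : G ⊆ Y) {t : ℕ} (hur : u ≤ r)
    (ht : #(inner X N G) + t = #G) : ∑ y ∈ G, #(M y \ inner X N G) ≤ u * t := by
  have h1 := h.sum_sdiff_add hG
  have h2 := Nat.mul_le_mul_right #(inner X N G) hur
  rw [← ht] at h1
  linarith [mul_add u #(inner X N G) t]

lemma card_le_mul (h : Biregular X Y N M r u) {G : Finset V} (hG : G ⊆ Y) {t : ℕ} (hur : u + 1 ≤ r)
    (ht : #(inner X N G) + t = #G) : #G ≤ r * t := by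
  have h1 := h.sum_sdiff_add hG
  have h2 := Nat.mul_le_mul_right #G hur
  have h3 : r * #G = r * #(inner X N G) + r * t := by rw [← ht]; ring
  have h4 := Nat.zero_le (∑ y ∈ G, #(M y \ inner X N G))
  linarith [add_mul u 1 #G]

/-- Second neighbourhoods within a set of centres are large. -/
lemma card_second (h : Biregular X Y N M r u) {B : Finset V} {z : V} (hz : z ∈ Y) :
    #(M z ∩ B) * (r - 1) ≤ #((M z ∩ B).biUnion N) := by
  have hX : ∀ x ∈ M z ∩ B, x ∈ X := fun x hx => h.M_subset z hz (mem_inter.1 hx).1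
  have hzN : ∀ x ∈ M z ∩ B, z ∈ N x := fun x hx =>
    (h.mem_iff x (hX x hx) z hz).2 (mem_inter.1 hx).1
  calc #(M z ∩ B) * (r - 1) = #((M z ∩ B).biUnion fun x => (N x).erase z) := by
        rw [card_biUnion]
        · rw [← smul_eq_mul, ← sum_const]
          refine sum_congr rfl fun x hx => ?_
          rw [card_erase_of_mem (hzN x hx), h.card_N x (hX x hx)]
        · intro x hx x' hx' hne
          rw [Function.onFun, disjoint_left]
          intro y hy hy'
          rw [mem_erase] at hy hy'
          have h1 := h.codeg x (hX x hx) x' (hX x' hx') hne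
          rw [card_le_one] at h1
          exact hy.1 (h1 y (mem_inter.2 ⟨hy.2, hy'.2⟩) z
            (mem_inter.2 ⟨hzN x hx, hzN x' hx'⟩))
    _ ≤ _ := card_le_card (biUnion_mono fun x _ => erase_subset _ _)

/-- Few elements of `G` have many neighbours outside the inner set. -/
lemma card_filter_le (h : Biregular X Y N M r u) {G : Finset V} (hG : G ⊆ Y) {t : ℕ} (hur : u ≤ r)
    (ht : #(inner X N G) + t = #G) (hu : 0 < u) {k : ℕ} {A : Finset V} (hA : A ⊆ G)
    (hAk : ∀ y ∈ A, u ≤ k * #(M y \ inner X N G)) : #A ≤ k * t := by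
  have h1 := h.sum_sdiff_le hG hur ht
  have h2 : ∑ y ∈ A, u ≤ ∑ y ∈ A, k * #(M y \ inner X N G) := sum_le_sum hAk
  have h3 : ∑ y ∈ A, #(M y \ inner X N G) ≤ ∑ y ∈ G, #(M y \ inner X N G) :=
    sum_le_sum_of_subset hA
  rw [sum_const, smul_eq_mul, ← mul_sum] at h2
  have h4 : #A * u ≤ k * t * u := by nlinarith [Nat.mul_le_mul_left k (h3.trans h1)]
  exact Nat.le_of_mul_le_mul_right h4 hu

/-- A coarse approximation of `G` from inside, by means of few seeds. -/
lemma exists_coarse (h : Biregular X Y N M r u) {G : Finset V} (hG : G ⊆ Y) {t p : ℕ}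
    (hur : u + 1 ≤ r) (hu : 0 < u) (ht : #(inner X N G) + t = #G) (hp : 2 ≤ p) (hr1 : p ^ 10 ≤ r)
    (hr2 : r ≤ 2 * p ^ 10) :
    ∃ T O : Finset V, T ⊆ G ∧ (∀ x ∈ O, ∃ y ∈ T, x ∈ M y) ∧ (T.biUnion M) \ O ⊆ inner X N G ∧
      #(G \ ((T.biUnion M) \ O).biUnion N) ≤ 18 * p ^ 6 * t ∧
      p ^ 6 * #T ≤ 2 * t ∧ p ^ 2 * #O ≤ 4 * t := by
  set C := inner X N G with hC
  have hCX : C ⊆ X := filter_subset _ _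
  have hp0 : 0 < p := by omega
  have hgt := h.card_le_mul hG hur ht
  by_cases hur2 : 2 * u < r
  · refine ⟨∅, ∅, by simp, by simp, by simp, ?_, by simp, by simp⟩
    have h1 := h.sum_sdiff_add hG
    have h2 : 2 * #C ≤ #G := by
      have h3 : r * #C ≤ u * #G := by rw [← h1]; exact Nat.le_add_left _ _
      by_contra hcon
      push Not at hcon
      have h4 : u * #G ≤ u * (2 * #C) := Nat.mul_le_mul_left _ hcon.le
      have h5 : 0 < #C := by omega
      nlinarith
    have h6 : 1 ≤ p ^ 6 := Nat.one_le_pow _ _ hp0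
    simp only [biUnion_empty, sdiff_empty]
    nlinarith
  · push Not at hur2
    set G' := {y ∈ G | p ^ 6 * #(M y \ C) ≤ u} with hG'
    set f : V → Finset V := fun z => (M z ∩ C).biUnion N with hf
    have hfG : ∀ z, f z ⊆ G := by
      intro z y hy
      simp only [hf, mem_biUnion] at hy
      obtain ⟨x, hx, hy⟩ := hy
      exact (mem_inner.1 (mem_inter.1 hx).2).2 hy
    obtain ⟨T, hTG', hTc, hT⟩ := exists_greedy G' ∅ f (τ := p ^ 16) (by positivity)
    rw [sdiff_empty] at hTc
    simp only [empty_union] at hT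
    have hTG : T ⊆ G := hTG'.trans (filter_subset _ _)
    set O := T.biUnion fun y => M y \ C with hO
    have hMO : (T.biUnion M) \ O = T.biUnion fun y => M y ∩ C := by
      ext x
      simp only [hO, Finset.mem_sdiff, mem_biUnion, mem_inter]
      constructor
      · rintro ⟨⟨y, hy, hx⟩, h2⟩
        refine ⟨y, hy, hx, ?_⟩
        by_contra hcon
        exact h2 ⟨y, hy, hx, hcon⟩
      · rintro ⟨y, hy, hx, hxC⟩
        exact ⟨⟨y, hy, hx⟩, fun ⟨_, _, _, h3⟩ => h3 hxC⟩
    have hF : ((T.biUnion M) \ O).biUnion N = T.biUnion f := by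
      rw [hMO, biUnion_biUnion]
    have hTg : p ^ 16 * #T ≤ #G :=
      hTc.trans (card_le_card (biUnion_subset.2 fun z _ => hfG z))
    have hT6 : p ^ 6 * #T ≤ 2 * t := by
      have h1 : p ^ 10 * (p ^ 6 * #T) ≤ p ^ 10 * (2 * t) := by
        calc p ^ 10 * (p ^ 6 * #T) = p ^ 16 * #T := by ring
          _ ≤ r * t := hTg.trans hgt
          _ ≤ 2 * p ^ 10 * t := Nat.mul_le_mul_right _ hr2
          _ = _ := by ring
      exact Nat.le_of_mul_le_mul_left h1 (by positivity)
    refine ⟨T, O, hTG, ?_, ?_, ?_, hT6, ?_⟩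
    · intro x hx
      obtain ⟨y, hy, hx⟩ := mem_biUnion.1 hx
      exact ⟨y, hy, (Finset.mem_sdiff.1 hx).1⟩
    · rw [hMO, biUnion_subset]
      exact fun y _ => inter_subset_right
    · rw [hF]
      set U := G \ T.biUnion f with hU
      set U1 := {y ∈ U | u ≤ 2 * #(M y \ C)} with hU1
      set U2 := {y ∈ U | ¬ u ≤ 2 * #(M y \ C)} with hU2
      have hUG : U ⊆ G := sdiff_subset
      have hUU : #U = #U1 + #U2 := (card_filter_add_card_filter_not _).symm
      have hU1c : #U1 ≤ 2 * t := h.card_filter_le hG (by omega) ht hu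
        ((filter_subset _ _).trans hUG) fun y hy => (mem_filter.1 hy).2
      have hG'c : #(G \ G') ≤ p ^ 6 * t := by
        refine h.card_filter_le hG (by omega) ht hu sdiff_subset fun y hy => ?_
        simp only [hG', Finset.mem_sdiff, mem_filter] at hy
        by_contra hcon
        exact hy.2 ⟨hy.1, (not_le.1 hcon).le⟩
      have hU2G : U2 ⊆ G := (filter_subset _ _).trans hUG
      -- double counting of pairs at distance two through `C`
      have hsym : ∀ y ∈ G, ∀ z ∈ G, z ∈ f y ↔ y ∈ f z := by
        have : ∀ y ∈ G, ∀ z ∈ G, z ∈ f y → y ∈ f z := by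
          intro y hy z hz hzy
          simp only [hf, mem_biUnion, mem_inter] at hzy ⊢
          obtain ⟨x, ⟨hxy, hxC⟩, hzx⟩ := hzy
          exact ⟨x, ⟨(h.mem_iff x (hCX hxC) z (hG hz)).1 hzx, hxC⟩,
            (h.mem_iff x (hCX hxC) y (hG hy)).2 hxy⟩
        exact fun y hy z hz => ⟨this y hy z hz, this z hz y hy⟩
      have hdc : ∑ y ∈ U2, #(f y) = ∑ z ∈ G, #(f z ∩ U2) := by
        have := sum_card_bipartiteAbove_eq_sum_card_bipartiteBelow (s := U2) (t := G)
          (fun y z => z ∈ f y)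
        convert this using 3 with y hy z hz
        · ext z
          simp only [bipartiteAbove, mem_filter]
          exact ⟨fun h => ⟨hfG y h, h⟩, fun h => h.2⟩
        · ext y
          simp only [bipartiteBelow, mem_filter, mem_inter]
          constructor
          · rintro ⟨h1, h2⟩
            exact ⟨h2, (hsym y (hU2G h2) z hz).2 h1⟩
          · rintro ⟨h1, h2⟩
            exact ⟨(hsym y (hU2G h1) z hz).1 h2, h1⟩
      have hlow : ∀ y ∈ U2, r ^ 2 ≤ 8 * #(f y) := by
        intro y hy
        have hyG := hU2G hy
        have h1 := h.card_second (B := C) (hG hyG)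
        have h2 : ¬ u ≤ 2 * #(M y \ C) := (mem_filter.1 hy).2
        have h3 := card_sdiff_add_card_inter (M y) C
        rw [h.card_M y (hG hyG)] at h3
        have h4 : u ≤ 2 * #(M y ∩ C) := by omega
        have h5 : r ≤ 2 * (r - 1) := by
          have : 1024 ≤ p ^ 10 := le_trans (by norm_num) (Nat.pow_le_pow_left hp 10)
          omega
        calc r ^ 2 = r * r := sq r
          _ ≤ (4 * #(M y ∩ C)) * (2 * (r - 1)) := Nat.mul_le_mul (by omega) h5
          _ = 8 * (#(M y ∩ C) * (r - 1)) := by ring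
          _ ≤ _ := Nat.mul_le_mul_left _ h1
      have hup : ∀ z ∈ G', #(f z ∩ U2) ≤ p ^ 16 := by
        intro z hz
        refine le_trans (card_le_card ?_) (hT z hz).le
        intro y hy
        rw [mem_inter] at hy
        exact Finset.mem_sdiff.2 ⟨hy.1, (Finset.mem_sdiff.1 (mem_filter.1 hy.2).1).2⟩
      have hup' : ∀ z ∈ G \ G', #(f z ∩ U2) ≤ r ^ 2 := by
        intro z hz
        have hzY := hG (Finset.mem_sdiff.1 hz).1
        refine (card_le_card inter_subset_left).trans (card_biUnion_le.trans ?_)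
        calc ∑ x ∈ M z ∩ C, #(N x) = ∑ x ∈ M z ∩ C, r :=
              sum_congr rfl fun x hx => h.card_N x (hCX (mem_inter.1 hx).2)
          _ = #(M z ∩ C) * r := by rw [sum_const, smul_eq_mul]
          _ ≤ u * r := Nat.mul_le_mul_right _
              ((card_le_card inter_subset_left).trans (h.card_M z hzY).le)
          _ ≤ r ^ 2 := by rw [sq]; exact Nat.mul_le_mul_right _ (by omega)
      have htot : #U2 * r ^ 2 ≤ 8 * (#G * p ^ 16 + p ^ 6 * t * r ^ 2) := by
        calc #U2 * r ^ 2 = ∑ y ∈ U2, r ^ 2 := by rw [sum_const, smul_eq_mul]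
          _ ≤ ∑ y ∈ U2, 8 * #(f y) := sum_le_sum hlow
          _ = 8 * ∑ z ∈ G, #(f z ∩ U2) := by rw [← mul_sum, hdc]
          _ = 8 * (∑ z ∈ G \ G', #(f z ∩ U2) + ∑ z ∈ G', #(f z ∩ U2)) := by
              rw [sum_sdiff (filter_subset _ _)]
          _ ≤ 8 * (∑ z ∈ G \ G', r ^ 2 + ∑ z ∈ G', p ^ 16) :=
              Nat.mul_le_mul_left _ (add_le_add (sum_le_sum hup') (sum_le_sum hup))
          _ = 8 * (#(G \ G') * r ^ 2 + #G' * p ^ 16) := by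
              simp only [sum_const, smul_eq_mul]
          _ ≤ 8 * (p ^ 6 * t * r ^ 2 + #G * p ^ 16) := Nat.mul_le_mul_left _
              (add_le_add (Nat.mul_le_mul_right _ hG'c)
                (Nat.mul_le_mul_right _ (card_le_card (filter_subset _ _))))
          _ = _ := by ring
      have hU2c : #U2 ≤ 16 * p ^ 6 * t := by
        have h1 : #G * p ^ 16 ≤ p ^ 6 * t * r ^ 2 := by
          calc #G * p ^ 16 ≤ r * t * p ^ 16 := Nat.mul_le_mul_right _ hgt
            _ = p ^ 6 * t * r * p ^ 10 := by ring
            _ ≤ p ^ 6 * t * r * r := Nat.mul_le_mul_left _ hr1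
            _ = _ := by ring
        have h2 : #U2 * r ^ 2 ≤ (16 * p ^ 6 * t) * r ^ 2 := by
          calc _ ≤ _ := htot
            _ ≤ 8 * (p ^ 6 * t * r ^ 2 + p ^ 6 * t * r ^ 2) :=
                Nat.mul_le_mul_left _ (Nat.add_le_add_right h1 _)
            _ = _ := by ring
        exact Nat.le_of_mul_le_mul_right h2 (pow_pos (by omega) 2)
      have h6 : t ≤ p ^ 6 * t := Nat.le_mul_of_pos_left _ (by positivity)
      calc #U ≤ 2 * t + 16 * p ^ 6 * t := by omega
        _ ≤ _ := by linarith
    · have h1 : p ^ 6 * #O ≤ r * #T := by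
        calc p ^ 6 * #O ≤ p ^ 6 * ∑ y ∈ T, #(M y \ C) :=
              Nat.mul_le_mul_left _ card_biUnion_le
          _ = ∑ y ∈ T, p ^ 6 * #(M y \ C) := mul_sum _ _ _
          _ ≤ ∑ y ∈ T, r := sum_le_sum fun y hy =>
              (mem_filter.1 (hTG' hy)).2.trans (by omega)
          _ = _ := by rw [sum_const, smul_eq_mul, mul_comm]
      have h2 : p ^ 10 * (p ^ 2 * #O) ≤ p ^ 10 * (4 * t) := by
        calc p ^ 10 * (p ^ 2 * #O) = p ^ 6 * (p ^ 6 * #O) := by ring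
          _ ≤ p ^ 6 * (r * #T) := Nat.mul_le_mul_left _ h1
          _ = r * (p ^ 6 * #T) := by ring
          _ ≤ (2 * p ^ 10) * (2 * t) := Nat.mul_le_mul hr2 hT6
          _ = _ := by ring
      exact Nat.le_of_mul_le_mul_left h2 (by positivity)

end Biregular
end Container

section Container

variable {V : Type*} [DecidableEq V]

/-- The inner approximation of the neighbourhood determined by the seeds `T`, `O`, `A`. -/
def seedCover (N M : V → Finset V) (T O A : Finset V) : Finset V :=
  ((T.biUnion M) \ O).biUnion N ∪ A.biUnion N

/-- The outer approximation determined by the seeds `T`, `O`, `A`, `B`. -/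
def seedContainer (X : Finset V) (N M : V → Finset V) (q : ℕ) (T O A B : Finset V) : Finset V :=
  {x ∈ X | #(N x \ seedCover N M T O A) < q} \ B.biUnion M

/-- The improved inner approximation determined by the seeds `T`, `O`, `A`, `B`. -/
def seedInner (X Y : Finset V) (N M : V → Finset V) (q : ℕ) (T O A B : Finset V) : Finset V :=
  seedCover N M T O A ∪ {y ∈ Y | q ≤ #(M y ∩ seedContainer X N M q T O A B)}

/-- All containers that can be built from seeds in `W`. -/
def containers (X Y : Finset V) (N M : V → Finset V) (q : ℕ) (W : Finset V) :
    Finset (Finset V) :=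
  (W.powerset ×ˢ W.powerset ×ˢ W.powerset ×ˢ W.powerset ×ˢ W.powerset).image
      (fun s => seedContainer X N M q s.1 s.2.1 s.2.2.1 s.2.2.2.1) ∪
    (W.powerset ×ˢ W.powerset ×ˢ W.powerset ×ˢ W.powerset ×ˢ W.powerset).image
      (fun s => inner X N (seedInner X Y N M q s.1 s.2.1 s.2.2.1 s.2.2.2.1 ∪ s.2.2.2.2))

lemma card_containers_le (X Y : Finset V) (N M : V → Finset V) (q : ℕ) (W : Finset V) :
    #(containers X Y N M q W) ≤ 2 * 32 ^ #W := by
  refine (card_union_le _ _).trans ?_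
  rw [two_mul]
  refine add_le_add (card_image_le.trans ?_) (card_image_le.trans ?_) <;>
  · simp only [card_product, card_powerset]
    rw [show (32 : ℕ) = 2 ^ 5 by norm_num, ← pow_mul, ← pow_add, ← pow_add, ← pow_add, ← pow_add]
    exact Nat.pow_le_pow_right (by norm_num) (by omega)

namespace Biregular

variable {X Y : Finset V} {N M : V → Finset V} {r u : ℕ}

set_option maxHeartbeats 1000000 in
/-- Every set `D` has a container built from few seeds close to `D`. -/
lemma exists_container (h : Biregular X Y N M r u) {d : V → V → ℕ}
    (hdsymm : ∀ a b, d a b = d b a) (hdtri : ∀ a b c, d a c ≤ d a b + d b c)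
    (hdN : ∀ x ∈ X, ∀ y ∈ N x, d x y ≤ 1) {t p K : ℕ} (hur : u + 1 ≤ r) (hu : 0 < u)
    (hp : 16 ≤ p) (hr1 : p ^ 10 ≤ r) (hr2 : r ≤ 2 * p ^ 10) (hK : 104 * K ≤ p)
    {D : Finset V} (hDX : D ⊆ X) (ht : #(inner X N (D.biUnion N)) + t = #(D.biUnion N)) :
    ∃ W, ∃ S ∈ containers X Y N M (p ^ 8) W, (∀ w ∈ W, ∃ x ∈ D, d w x ≤ 3) ∧
      (∀ x ∈ D, ∃ w ∈ W, d x w ≤ 3) ∧ D ⊆ S ∧ S ⊆ X ∧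
      2 * p * (K * #W + #S) + t ≤ 2 * p * #(D.biUnion N) := by
  set G := D.biUnion N with hGdef
  have hG : G ⊆ Y := biUnion_subset.2 fun x hx => h.N_subset x (hDX hx)
  set C := inner X N G with hC
  have hCX : C ⊆ X := filter_subset _ _
  have hDC : D ⊆ C := fun x hx => mem_inner.2 ⟨hDX hx, subset_biUnion_of_mem N hx⟩
  have hp0 : 0 < p := by omega
  have hq : p ^ 8 * 4 ≤ r := by
    calc p ^ 8 * 4 ≤ p ^ 8 * p ^ 2 := Nat.mul_le_mul_left _ (by nlinarith)
      _ = p ^ 10 := by ring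
      _ ≤ r := hr1
  have hq0 : 0 < p ^ 8 := by positivity
  have hgt := h.card_le_mul hG hur ht
  obtain ⟨T, O, hTG, hOT, hTO, hunc, hTc, hOc⟩ :=
    h.exists_coarse hG hur hu ht (by omega) hr1 hr2
  set F1 := ((T.biUnion M) \ O).biUnion N with hF1
  have hF1G : F1 ⊆ G := biUnion_subset.2 fun x hx => (mem_inner.1 (hTO hx)).2
  obtain ⟨A, hAC, hAc, hA⟩ := exists_greedy C F1 N hq0
  have hANG : A.biUnion N ⊆ G := biUnion_subset.2 fun x hx => (mem_inner.1 (hAC hx)).2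
  set F2 := seedCover N M T O A with hF2
  have hF2def : F2 = F1 ∪ A.biUnion N := rfl
  have hF2G : F2 ⊆ G := union_subset hF1G hANG
  have hAc' : p ^ 2 * #A ≤ 18 * t := by
    have h1 : p ^ 8 * #A ≤ 18 * p ^ 6 * t :=
      hAc.trans ((card_le_card (sdiff_subset_sdiff hANG subset_rfl)).trans hunc)
    have h2 : p ^ 6 * (p ^ 2 * #A) ≤ p ^ 6 * (18 * t) := by
      calc _ = p ^ 8 * #A := by ring
        _ ≤ _ := h1
        _ = _ := by ring
    exact Nat.le_of_mul_le_mul_left h2 (by positivity)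
  set S2 := {x ∈ X | #(N x \ F2) < p ^ 8} with hS2
  have hCS2 : C ⊆ S2 := fun x hx => mem_filter.2 ⟨hCX hx, hA x hx⟩
  have hS2F : ∀ x ∈ S2, r < #(N x ∩ F2) + p ^ 8 := by
    intro x hx
    have h1 := (mem_filter.1 hx)
    have h2 := card_sdiff_add_card_inter (N x) F2
    rw [h.card_N x h1.1] at h2
    omega
  have hS2c : #(S2 \ C) ≤ 2 * t := by
    have h1 : ∑ y ∈ G, #(M y ∩ (S2 \ C)) = ∑ x ∈ S2 \ C, #(N x ∩ G) :=
      h.sum_card hG (sdiff_subset.trans (filter_subset _ _))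
    have h2 : ∑ y ∈ G, #(M y ∩ (S2 \ C)) ≤ ∑ y ∈ G, #(M y \ C) :=
      sum_le_sum fun y _ => card_le_card fun x hx => by
        simp only [mem_inter, Finset.mem_sdiff] at hx ⊢
        exact ⟨hx.1, hx.2.2⟩
    have h3 := h.sum_sdiff_le hG (by omega) ht
    have h4 : ∑ x ∈ S2 \ C, r ≤ ∑ x ∈ S2 \ C, 2 * #(N x ∩ G) := by
      refine sum_le_sum fun x hx => ?_
      have h5 := hS2F x (Finset.mem_sdiff.1 hx).1
      have h6 : #(N x ∩ F2) ≤ #(N x ∩ G) :=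
        card_le_card (inter_subset_inter subset_rfl hF2G)
      omega
    rw [sum_const, smul_eq_mul, ← mul_sum, ← h1] at h4
    have h7 : #(S2 \ C) * r ≤ 2 * t * r := by
      calc _ ≤ _ := h4
        _ ≤ 2 * (u * t) := Nat.mul_le_mul_left _ (h2.trans h3)
        _ ≤ 2 * (r * t) := Nat.mul_le_mul_left _ (Nat.mul_le_mul_right _ (by omega))
        _ = _ := by ring
    exact Nat.le_of_mul_le_mul_right h7 (by omega)
  obtain ⟨B, hBY, hBc, hB⟩ :=
    exists_greedy {y ∈ Y \ G | (M y ∩ S2).Nonempty} C (fun y => M y ∩ S2) hq0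
  have hMC : ∀ y ∈ Y \ G, Disjoint (M y) C := by
    intro y hy
    rw [Finset.mem_sdiff] at hy
    rw [disjoint_left]
    intro x hx hxC
    exact hy.2 ((mem_inner.1 hxC).2 ((h.mem_iff x (hCX hxC) y hy.1).2 hx))
  have hBc' : p ^ 2 * #B ≤ 2 * t := by
    have h1 : B.biUnion (fun y => M y ∩ S2) \ C ⊆ S2 \ C :=
      sdiff_subset_sdiff (biUnion_subset.2 fun y _ => inter_subset_right) subset_rfl
    calc p ^ 2 * #B ≤ p ^ 8 * #B :=
          Nat.mul_le_mul_right _ (Nat.pow_le_pow_right hp0 (by norm_num))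
      _ ≤ _ := hBc.trans ((card_le_card h1).trans hS2c)
  set S := seedContainer X N M (p ^ 8) T O A B with hS
  have hSdef : S = S2 \ B.biUnion M := rfl
  have hSS2 : S ⊆ S2 := sdiff_subset
  have hSX : S ⊆ X := hSS2.trans (filter_subset _ _)
  have hCS : C ⊆ S := by
    intro x hx
    refine Finset.mem_sdiff.2 ⟨hCS2 hx, fun hxB => ?_⟩
    obtain ⟨y, hy, hxy⟩ := mem_biUnion.1 hxB
    exact disjoint_left.1 (hMC y (mem_filter.1 (hBY hy)).1) hxy hx
  have hSY : ∀ y ∈ Y \ G, #(M y ∩ S) < p ^ 8 := by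
    intro y hy
    by_cases hne : (M y ∩ S2).Nonempty
    · refine lt_of_le_of_lt (card_le_card fun x hx => ?_) (hB y (mem_filter.2 ⟨hy, hne⟩))
      rw [mem_inter, hSdef, Finset.mem_sdiff] at hx
      refine Finset.mem_sdiff.2 ⟨mem_inter.2 ⟨hx.1, hx.2.1⟩, fun hxu => ?_⟩
      rcases mem_union.1 hxu with hxC | hxB
      · exact disjoint_left.1 (hMC y hy) hx.1 hxC
      · obtain ⟨z, hz, hxz⟩ := mem_biUnion.1 hxB
        exact hx.2.2 (mem_biUnion.2 ⟨z, hz, (mem_inter.1 hxz).1⟩)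
    · rw [not_nonempty_iff_eq_empty] at hne
      have : M y ∩ S = ∅ := by
        rw [← subset_empty, ← hne]
        exact inter_subset_inter subset_rfl hSS2
      rw [this, card_empty]
      exact hq0
  set F := seedInner X Y N M (p ^ 8) T O A B with hF
  have hFdef : F = F2 ∪ {y ∈ Y | p ^ 8 ≤ #(M y ∩ S)} := rfl
  have hFG : F ⊆ G := by
    refine union_subset hF2G fun y hy => ?_
    rw [mem_filter] at hy
    by_contra hyG
    exact absurd hy.2 (not_le.2 (hSY y (Finset.mem_sdiff.2 ⟨hy.1, hyG⟩)))
  have hGF : ∀ y ∈ G \ F, #(M y ∩ S) ≤ p ^ 8 := by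
    intro y hy
    rw [Finset.mem_sdiff] at hy
    by_contra hcon
    push Not at hcon
    exact hy.2 (mem_union_right _ (mem_filter.2 ⟨hG hy.1, hcon.le⟩))
  have hGFc : #(G \ F) ≤ 2 * t := by
    by_cases hur2 : 2 * u < r
    · have h1 := h.sum_sdiff_add hG
      have h2 : 2 * #C ≤ #G := by
        have h3 : r * #C ≤ u * #G := by rw [← h1]; exact Nat.le_add_left _ _
        by_contra hcon
        push Not at hcon
        have h4 : u * #G ≤ u * (2 * #C) := Nat.mul_le_mul_left _ hcon.le
        have h5 : 0 < #C := by omega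
        nlinarith
      have := card_le_card (sdiff_subset (s := G) (t := F))
      omega
    · refine h.card_filter_le hG (by omega) ht hu sdiff_subset fun y hy => ?_
      have h1 := hGF y hy
      have h2 : #(M y ∩ C) ≤ #(M y ∩ S) := card_le_card (inter_subset_inter subset_rfl hCS)
      have h3 := card_sdiff_add_card_inter (M y) C
      rw [h.card_M y (hG (Finset.mem_sdiff.1 hy).1)] at h3
      change u ≤ 2 * #(M y \ C)
      omega
  have hSc : p ^ 2 * #S ≤ p ^ 2 * #F + 4 * t := by
    have hFY : F ⊆ Y := hFG.trans hG
    have h1 : ∑ x ∈ S, #(N x) = ∑ x ∈ S, #(N x ∩ F) + ∑ x ∈ S, #(N x ∩ (Y \ F)) := by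
      rw [← sum_add_distrib]
      refine sum_congr rfl fun x hx => ?_
      rw [← card_union_of_disjoint, ← inter_union_distrib_left, union_sdiff_of_subset hFY,
        inter_eq_left.2 (h.N_subset x (hSX hx))]
      exact (disjoint_sdiff).mono inter_subset_right inter_subset_right
    have h2 : ∑ x ∈ S, #(N x) = #S * r := by
      rw [sum_congr rfl fun x hx => h.card_N x (hSX hx), sum_const, smul_eq_mul]
    have h3 : ∑ x ∈ S, #(N x ∩ F) ≤ #F * r := by
      rw [← h.sum_card hFY hSX, ← smul_eq_mul, ← sum_const]
      refine sum_le_sum fun y hy => ?_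
      have := (card_le_card (inter_subset_left (s₁ := M y) (s₂ := S))).trans
        (h.card_M y (hFY hy)).le
      omega
    have h4 : ∑ x ∈ S, #(N x ∩ (Y \ F)) ≤ ∑ x ∈ S, #(N x ∩ (G \ F)) +
        ∑ x ∈ S, #(N x ∩ (Y \ G)) := by
      rw [← sum_add_distrib]
      refine sum_le_sum fun x _ => le_trans (card_le_card fun y hy => ?_) (card_union_le _ _)
      simp only [mem_inter, mem_union, Finset.mem_sdiff] at hy ⊢
      tauto
    have h5 : ∑ x ∈ S, #(N x ∩ (G \ F)) ≤ #(G \ F) * p ^ 8 := by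
      rw [← h.sum_card (sdiff_subset.trans hG) hSX, ← smul_eq_mul, ← sum_const]
      exact sum_le_sum hGF
    have h6 : ∑ x ∈ S, #(N x ∩ (Y \ G)) ≤ #(S2 \ C) * p ^ 8 := by
      calc ∑ x ∈ S, #(N x ∩ (Y \ G)) = ∑ x ∈ S \ C, #(N x ∩ (Y \ G)) := by
            refine (sum_subset sdiff_subset fun x hxS hx => ?_).symm
            have hxC : x ∈ C := by
              by_contra hcon
              exact hx (Finset.mem_sdiff.2 ⟨hxS, hcon⟩)
            rw [card_eq_zero, ← disjoint_iff_inter_eq_empty]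
            exact disjoint_sdiff.mono_left (mem_inner.1 hxC).2
        _ ≤ ∑ x ∈ S \ C, p ^ 8 := by
            refine sum_le_sum fun x hx => ?_
            have hx2 := (mem_filter.1 (hSS2 (Finset.mem_sdiff.1 hx).1)).2
            refine le_trans (card_le_card fun y hy => ?_) hx2.le
            rw [mem_inter, Finset.mem_sdiff] at hy
            exact Finset.mem_sdiff.2 ⟨hy.1, fun hyF => hy.2.2 (hF2G hyF)⟩
        _ = #(S \ C) * p ^ 8 := by rw [sum_const, smul_eq_mul]
        _ ≤ _ := Nat.mul_le_mul_right _ (card_le_card (sdiff_subset_sdiff hSS2 subset_rfl))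
    have h7 : #S * r ≤ #F * r + 4 * t * p ^ 8 := by
      rw [← h2, h1]
      have h8 := Nat.mul_le_mul_right (p ^ 8) hGFc
      have h9 := Nat.mul_le_mul_right (p ^ 8) hS2c
      linarith
    by_contra hcon
    push Not at hcon
    have h10 : 4 * t * p ^ 8 < (#S - #F) * r := by
      have h11 : #F < #S := by
        by_contra h12
        have := Nat.mul_le_mul_left (p ^ 2) (not_lt.1 h12)
        omega
      have h13 : 4 * t < p ^ 2 * (#S - #F) := by
        rw [Nat.mul_sub]
        omega
      calc 4 * t * p ^ 8 < p ^ 2 * (#S - #F) * p ^ 8 := Nat.mul_lt_mul_of_pos_right h13 hq0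
        _ = (#S - #F) * p ^ 10 := by ring
        _ ≤ _ := Nat.mul_le_mul_left _ hr1
    rw [Nat.sub_mul] at h10
    omega
  -- the seeds are close to `D`
  have hdM : ∀ y ∈ Y, ∀ x ∈ M y, d y x ≤ 1 := fun y hy x hx => by
    rw [hdsymm]
    have hxX := h.M_subset y hy hx
    exact hdN x hxX y ((h.mem_iff x hxX y hy).2 hx)
  have hnG : ∀ y ∈ G, ∃ x ∈ D, d y x ≤ 1 := fun y hy => by
    obtain ⟨x, hx, hyx⟩ := mem_biUnion.1 hy
    exact ⟨x, hx, by rw [hdsymm]; exact hdN x (hDX hx) y hyx⟩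
  have hn2 : ∀ x ∈ S2, ∃ x' ∈ D, d x x' ≤ 2 := fun x hx => by
    have h1 := hS2F x hx
    obtain ⟨y, hy⟩ : (N x ∩ F2).Nonempty := card_pos.1 (by omega)
    rw [mem_inter] at hy
    obtain ⟨x', hx', hyx'⟩ := hnG y (hF2G hy.2)
    refine ⟨x', hx', (hdtri x y x').trans ?_⟩
    have := hdN x (mem_filter.1 hx).1 y hy.1
    omega
  have hnT : ∀ w ∈ T, ∃ x ∈ D, d w x ≤ 3 := fun w hw => by
    obtain ⟨x, hx, h1⟩ := hnG w (hTG hw)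
    exact ⟨x, hx, by omega⟩
  have hnO : ∀ w ∈ O, ∃ x ∈ D, d w x ≤ 3 := fun w hw => by
    obtain ⟨y, hy, hwy⟩ := hOT w hw
    obtain ⟨x, hx, h1⟩ := hnG y (hTG hy)
    have h2 := hdM y (hG (hTG hy)) w hwy
    rw [hdsymm] at h2
    have := hdtri w y x
    exact ⟨x, hx, by omega⟩
  have hnA : ∀ w ∈ A, ∃ x ∈ D, d w x ≤ 3 := fun w hw => by
    obtain ⟨x, hx, h1⟩ := hn2 w (hCS2 (hAC hw))
    exact ⟨x, hx, by omega⟩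
  have hnB : ∀ w ∈ B, ∃ x ∈ D, d w x ≤ 3 := fun w hw => by
    have hw' := mem_filter.1 (hBY hw)
    obtain ⟨x, hx⟩ := hw'.2
    rw [mem_inter] at hx
    obtain ⟨x', hx', h1⟩ := hn2 x hx.2
    have h2 := hdM w (Finset.mem_sdiff.1 hw'.1).1 x hx.1
    have := hdtri w x x'
    exact ⟨x', hx', by omega⟩
  have hnE : ∀ w ∈ G \ F, ∃ x ∈ D, d w x ≤ 3 := fun w hw => by
    obtain ⟨x, hx, h1⟩ := hnG w (Finset.mem_sdiff.1 hw).1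
    exact ⟨x, hx, by omega⟩
  have hnD : ∀ x ∈ D, ∃ w ∈ T ∪ A, d x w ≤ 3 := fun x hx => by
    have h1 := hS2F x (hCS2 (hDC hx))
    obtain ⟨y, hy⟩ : (N x ∩ F2).Nonempty := card_pos.1 (by omega)
    rw [mem_inter] at hy
    have h2 := hdN x (hDX hx) y hy.1
    rcases mem_union.1 hy.2 with hy1 | hy1
    · obtain ⟨x', hx', hyx'⟩ := mem_biUnion.1 hy1
      obtain ⟨z, hz, hxz⟩ := mem_biUnion.1 (Finset.mem_sdiff.1 hx').1
      have hzY := hG (hTG hz)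
      have h3 := hdN x' (h.M_subset z hzY hxz) y hyx'
      have h4 := hdM z hzY x' hxz
      rw [hdsymm] at h3 h4
      have h5 := hdtri x y x'
      have h6 := hdtri x x' z
      exact ⟨z, mem_union_left _ hz, by omega⟩
    · obtain ⟨x', hx', hyx'⟩ := mem_biUnion.1 hy1
      have h3 := hdN x' (hCX (hAC hx')) y hyx'
      rw [hdsymm] at h3
      have h5 := hdtri x y x'
      exact ⟨x', mem_union_right _ hx', by omega⟩
  set W := T ∪ O ∪ A ∪ B with hW
  have hWc : p ^ 2 * #W ≤ 26 * t := by
    have h1 : #W ≤ #T + #O + #A + #B :=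
      (card_union_le _ _).trans (Nat.add_le_add_right ((card_union_le _ _).trans
        (Nat.add_le_add_right (card_union_le _ _) _)) _)
    have h2 : p ^ 2 * #T ≤ 2 * t :=
      (Nat.mul_le_mul_right _ (Nat.pow_le_pow_right hp0 (by norm_num))).trans hTc
    calc p ^ 2 * #W ≤ p ^ 2 * (#T + #O + #A + #B) := Nat.mul_le_mul_left _ h1
      _ = p ^ 2 * #T + p ^ 2 * #O + p ^ 2 * #A + p ^ 2 * #B := by ring
      _ ≤ _ := by omega
  have hTW : T ⊆ W := fun x hx => by simp [hW, hx]
  have hOW : O ⊆ W := fun x hx => by simp [hW, hx]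
  have hAW : A ⊆ W := fun x hx => by simp [hW, hx]
  have hBW : B ⊆ W := fun x hx => by simp [hW, hx]
  have hnW : ∀ w ∈ W, ∃ x ∈ D, d w x ≤ 3 := by
    intro w hw
    simp only [hW, mem_union] at hw
    rcases hw with ((hw | hw) | hw) | hw
    exacts [hnT w hw, hnO w hw, hnA w hw, hnB w hw]
  have hcG : #(G \ F) + #F = #G := card_sdiff_add_card_eq_card hFG
  by_cases hcase : p * #(G \ F) ≤ t
  · refine ⟨W ∪ (G \ F), C, ?_, ?_, ?_, hDC, hCX, ?_⟩
    · refine mem_union_right _ (mem_image.2 ⟨(T, O, A, B, G \ F), ?_, ?_⟩)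
      · simp only [mem_product, mem_powerset]
        exact ⟨hTW.trans subset_union_left, hOW.trans subset_union_left,
          hAW.trans subset_union_left, hBW.trans subset_union_left, subset_union_right⟩
      · change inner X N (F ∪ (G \ F)) = C
        rw [union_sdiff_of_subset hFG]
    · intro w hw
      rcases mem_union.1 hw with hw | hw
      exacts [hnW w hw, hnE w hw]
    · intro x hx
      obtain ⟨w, hw, h1⟩ := hnD x hx
      exact ⟨w, mem_union_left _ (union_subset hTW hAW hw), h1⟩
    · have h1 := card_union_le W (G \ F)
      have h2 : p * #(W ∪ (G \ F)) ≤ 3 * t := by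
        have h3 : p * #W ≤ 2 * t := by
          have h4 : 16 * (p * #W) ≤ p ^ 2 * #W := by
            rw [sq, mul_assoc]
            exact Nat.mul_le_mul_right _ hp
          omega
        have := Nat.mul_le_mul_left p h1
        rw [mul_add] at this
        omega
      have h5 : p * (K * #(W ∪ (G \ F))) * 104 ≤ 3 * t * p := by
        calc _ = p * #(W ∪ (G \ F)) * (104 * K) := by ring
          _ ≤ 3 * t * p := Nat.mul_le_mul h2 hK
      have h6 : t * 16 ≤ t * p := Nat.mul_le_mul_left _ hp
      have h7 := Nat.mul_le_mul_right t hp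
      rw [← ht]
      linarith
  · push Not at hcase
    refine ⟨W, S, ?_, hnW, ?_, hDC.trans hCS, hSX, ?_⟩
    · refine mem_union_left _ (mem_image.2 ⟨(T, O, A, B, ∅), ?_, rfl⟩)
      simp only [mem_product, mem_powerset]
      exact ⟨hTW, hOW, hAW, hBW, empty_subset _⟩
    · intro x hx
      obtain ⟨w, hw, h1⟩ := hnD x hx
      exact ⟨w, union_subset hTW hAW hw, h1⟩
    · have h1 : 104 * (p * (K * #W)) ≤ 26 * t := by
        calc 104 * (p * (K * #W)) = 104 * K * (p * #W) := by ring
          _ ≤ p * (p * #W) := Nat.mul_le_mul_right _ hK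
          _ = p ^ 2 * #W := by ring
          _ ≤ _ := hWc
      have h2 : p * #S * p ≤ (p * #F) * p + 4 * t := by linarith [hSc, sq p]
      have h3 : p * #S * 4 ≤ p * #F * 4 + t := by
        by_contra hcon
        push Not at hcon
        have h3' : (p * #F * 4 + t + 1) * p ≤ p * #S * 4 * p := Nat.mul_le_mul_right p hcon
        have h3'' := Nat.mul_le_mul_left t hp
        linarith
      have h4 : p * #G = p * #(G \ F) + p * #F := by rw [← hcG]; ring
      linarith

end Biregular
end Container

section LinkedSums

variable {V : Type*} [DecidableEq V]

lemma Linked.mono {R R' : V → V → Prop} {W : Finset V} (h : Linked R W)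
    (hR : ∀ a ∈ W, ∀ b ∈ W, R a b → R' a b) : Linked R' W := by
  refine ⟨h.1, fun P hP hne hPW => ?_⟩
  obtain ⟨a, ha, b, hb, hab⟩ := h.2 P hP hne hPW
  exact ⟨a, ha, b, hb, hR a (hP ha) b (Finset.mem_sdiff.1 hb).1 hab⟩

/-- A geometric bound for the sum over the linked sets through a given vertex. -/
lemma sum_linked_le {R : V → V → Prop} {nb : V → Finset V} {Δ : ℕ}
    (hnb : ∀ a b, R a b → b ∈ nb a ∧ a ∈ nb b) (hΔ : ∀ v, #(nb v) ≤ Δ) (v : V)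
    (𝓕 : Finset (Finset V)) (h : ∀ W ∈ 𝓕, Linked R W ∧ v ∈ W) {x : ℝ} (hx : 0 ≤ x)
    (hxΔ : 2 * (Δ : ℝ) ^ 2 * x ≤ 1) : ∑ W ∈ 𝓕, x ^ #W ≤ 2 * x := by
  have hmaps : ∀ W ∈ 𝓕, #W - 1 ∈ range (𝓕.sup card + 1) := by
    intro W hW
    have := le_sup (f := card) hW
    rw [mem_range]
    omega
  rw [← sum_fiberwise_of_maps_to hmaps]
  have hfib : ∀ s, ∑ W ∈ 𝓕 with #W - 1 = s, x ^ #W ≤ x * (1 / 2) ^ s := by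
    intro s
    have hsz : ∀ W ∈ 𝓕.filter (fun W => #W - 1 = s), Linked R W ∧ #W = s + 1 ∧ v ∈ W := by
      intro W hW
      rw [mem_filter] at hW
      have h1 := h W hW.1
      have h2 : 0 < #W := card_pos.2 ⟨v, h1.2⟩
      exact ⟨h1.1, by omega, h1.2⟩
    have hcard := card_linked_le hnb hΔ v (s + 1) _ hsz
    calc ∑ W ∈ 𝓕 with #W - 1 = s, x ^ #W = ∑ W ∈ 𝓕 with #W - 1 = s, x ^ (s + 1) :=
          sum_congr rfl fun W hW => by rw [(hsz W hW).2.1]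
      _ = (#(𝓕.filter fun W => #W - 1 = s) : ℝ) * x ^ (s + 1) := by rw [sum_const, nsmul_eq_mul]
      _ ≤ ((Δ : ℝ) ^ (2 * s)) * x ^ (s + 1) := by
          refine mul_le_mul_of_nonneg_right ?_ (by positivity)
          exact_mod_cast hcard
      _ = x * ((Δ : ℝ) ^ 2 * x) ^ s := by rw [mul_pow, pow_succ, ← pow_mul]; ring
      _ ≤ _ := by
          refine mul_le_mul_of_nonneg_left ?_ hx
          exact pow_le_pow_left₀ (by positivity) (by linarith) s
  calc _ ≤ ∑ s ∈ range (𝓕.sup card + 1), x * (1 / 2) ^ s := sum_le_sum fun s _ => hfib s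
    _ = x * ∑ s ∈ range (𝓕.sup card + 1), (1 / 2 : ℝ) ^ s := by rw [mul_sum]
    _ ≤ x * 2 := mul_le_mul_of_nonneg_left (sum_geometric_two_le _) hx
    _ = _ := by ring

end LinkedSums

section Lattice

variable {n : ℕ}

/-- The `r`-element subsets. -/
abbrev layer (n r : ℕ) : Finset (Finset (Fin n)) := powersetCard r univ

/-- The distance in the Hasse diagram. -/
def hdist (a b : Finset (Fin n)) : ℕ := #(symmDiff a b)

lemma hdist_symm (a b : Finset (Fin n)) : hdist a b = hdist b a := by
  unfold hdist; rw [symmDiff_comm]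

lemma hdist_triangle (a b c : Finset (Fin n)) : hdist a c ≤ hdist a b + hdist b c :=
  (card_le_card (symmDiff_triangle a b c)).trans (card_union_le _ _)

lemma hdist_of_subset {a b : Finset (Fin n)} (h : b ⊆ a) : hdist a b = #a - #b := by
  unfold hdist
  rw [symmDiff_def, sup_eq_union, sdiff_eq_empty_iff_subset.2 h, union_empty,
    card_sdiff_of_subset h]

lemma card_filter_card_le (n j : ℕ) : #{s : Finset (Fin n) | #s ≤ j} ≤ (n + 1) ^ j := by
  induction j with
  | zero =>
    simp only [Nat.le_zero, card_eq_zero, pow_zero]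
    exact (card_le_card (t := {∅}) (fun s hs => by simpa using hs)).trans (by simp)
  | succ j ih =>
    calc #{s : Finset (Fin n) | #s ≤ j + 1}
        ≤ #(((univ : Finset (Option (Fin n))) ×ˢ
          (univ.filter fun s : Finset (Fin n) => #s ≤ j)).image
          (fun q => q.1.elim q.2 (fun a => insert a q.2))) := by
          refine card_le_card fun s hs => ?_
          simp only [mem_filter, mem_univ, true_and] at hs
          rw [mem_image]
          rcases s.eq_empty_or_nonempty with rfl | ⟨a, ha⟩
          · exact ⟨(none, ∅), by simp, rfl⟩
          · refine ⟨(some a, s.erase a), ?_, ?_⟩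
            · simp only [mem_product, mem_univ, mem_filter, true_and, card_erase_of_mem ha]
              omega
            · simp [insert_erase ha]
      _ ≤ (n + 1) * #{s : Finset (Fin n) | #s ≤ j} := by
          refine card_image_le.trans ?_
          rw [card_product]
          simp
      _ ≤ _ := by rw [pow_succ']; exact Nat.mul_le_mul_left _ ih

/-- Balls in the Hasse diagram. -/
def hball (j : ℕ) (a : Finset (Fin n)) : Finset (Finset (Fin n)) := {b | hdist a b ≤ j}

lemma mem_hball {j : ℕ} {a b : Finset (Fin n)} : b ∈ hball j a ↔ hdist a b ≤ j := by simp [hball]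

lemma card_hball_le (j : ℕ) (a : Finset (Fin n)) : #(hball j a) ≤ (n + 1) ^ j := by
  refine le_trans ?_ (card_filter_card_le n j)
  refine card_le_card_of_injOn (fun b => symmDiff a b) (fun b hb => ?_) ?_
  · rw [mem_coe, mem_hball] at hb
    simpa [hdist] using hb
  · intro b _ c _ h
    exact symmDiff_right_injective a h

lemma biregular_layer (n k : ℕ) :
    Biregular (layer n (k + 1)) (layer n k) (fun x => powersetCard k x)
      (fun y => {x ∈ layer n (k + 1) | y ⊆ x}) (k + 1) (n - k) where
  N_subset x _ := powersetCard_mono (subset_univ _)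
  M_subset y _ := filter_subset _ _
  mem_iff x hx y hy := by
    rw [mem_powersetCard] at hy
    simp [mem_powersetCard.1 hx, hy.2, mem_powersetCard]
  card_N x hx := by
    rw [card_powersetCard, (mem_powersetCard.1 hx).2, Nat.choose_succ_self_right]
  card_M y hy := by
    have hy2 := (mem_powersetCard.1 hy).2
    have : ({x ∈ layer n (k + 1) | y ⊆ x} : Finset (Finset (Fin n))) =
        yᶜ.image (fun a => insert a y) := by
      ext x
      simp only [mem_filter, mem_powersetCard, subset_univ, true_and, mem_image, mem_compl]
      constructor
      · rintro ⟨hx, hyx⟩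
        obtain ⟨a, ha, h⟩ := (covBy_iff_exists_insert (s := y) (t := x)).1
          ((covBy_iff_card_sdiff_eq_one).2 ⟨hyx, by rw [card_sdiff_of_subset hyx]; omega⟩)
        exact ⟨a, ha, h⟩
      · rintro ⟨a, ha, rfl⟩
        exact ⟨by rw [card_insert_of_notMem ha, hy2], subset_insert _ _⟩
    rw [this, card_image_of_injOn, card_compl, Fintype.card_fin, hy2]
    intro a ha b hb h
    simp only [coe_compl, Set.mem_compl_iff, mem_coe] at ha hb
    have : a ∈ insert b y := by rw [← show insert a y = insert b y from h]; exact mem_insert_self _ _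
    exact (mem_insert.1 this).resolve_right ha
  codeg x hx x' hx' hne := by
    rw [mem_powersetCard] at hx hx'
    have h1 : #(x ∩ x') ≤ k := by
      by_contra hcon
      push Not at hcon
      have h2 : x ∩ x' = x := eq_of_subset_of_card_le inter_subset_left (by omega)
      have h3 : x ∩ x' = x' := eq_of_subset_of_card_le inter_subset_right (by omega)
      exact hne (h2.symm.trans h3)
    rw [card_le_one]
    intro y hy z hz
    simp only [mem_inter, mem_powersetCard] at hy hz
    have h2 : y = x ∩ x' := eq_of_subset_of_card_le (subset_inter hy.1.1 hy.2.1) (by omega)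
    have h3 : z = x ∩ x' := eq_of_subset_of_card_le (subset_inter hz.1.1 hz.2.1) (by omega)
    rw [h2, h3]

lemma biUnion_powersetCard_eq_shadow {k : ℕ} {D : Finset (Finset (Fin n))}
    (hD : D ⊆ layer n (k + 1)) : D.biUnion (powersetCard k) = shadow D := by
  ext y
  simp only [mem_biUnion, mem_powersetCard, mem_shadow_iff_exists_mem_card_add_one]
  constructor
  · rintro ⟨x, hx, hyx, hy⟩
    exact ⟨x, hx, hyx, by rw [(mem_powersetCard.1 (hD hx)).2, hy]⟩
  · rintro ⟨x, hx, hyx, hy⟩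
    rw [(mem_powersetCard.1 (hD hx)).2] at hy
    exact ⟨x, hx, hyx, by omega⟩

/-- Elements of a layer with a common lower cover are at distance at most two. -/
lemma hdist_le_two_of_touch {k : ℕ} {x x' : Finset (Fin n)} (hx : x ∈ layer n (k + 1))
    (hx' : x' ∈ layer n (k + 1)) (h : Touch (powersetCard k) x x') : hdist x x' ≤ 2 := by
  unfold Touch at h
  rw [not_disjoint_iff] at h
  obtain ⟨y, hy, hy'⟩ := h
  rw [mem_powersetCard] at hx hx' hy hy'
  have h1 := hdist_triangle x y x'
  rw [hdist_of_subset hy.1, hdist_symm y x', hdist_of_subset hy'.1] at h1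
  omega

end Lattice

section Shadows

variable {n : ℕ}

lemma exists_isInitSeg (n r : ℕ) {j : ℕ} (hj : j ≤ n.choose r) :
    ∃ 𝒞 : Finset (Finset (Fin n)), Colex.IsInitSeg 𝒞 r ∧ #𝒞 = j := by
  induction j with
  | zero => exact ⟨∅, by simp, by simp⟩
  | succ j ih =>
    obtain ⟨𝒞, h𝒞, hcard⟩ := ih (by omega)
    have hsub : 𝒞 ⊆ layer n r := fun s hs => mem_powersetCard.2 ⟨subset_univ _, h𝒞.1 hs⟩
    have hne : (layer n r \ 𝒞).Nonempty := by
      rw [← card_pos, card_sdiff_of_subset hsub]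
      simp only [card_powersetCard, card_univ, Fintype.card_fin]
      omega
    obtain ⟨s, hs, hmin⟩ := exists_min_image (layer n r \ 𝒞) toColex hne
    rw [Finset.mem_sdiff, mem_powersetCard] at hs
    refine ⟨insert s 𝒞, ⟨?_, ?_⟩, by rw [card_insert_of_notMem hs.2, hcard]⟩
    · intro a ha
      rw [mem_coe, mem_insert] at ha
      rcases ha with rfl | ha
      · exact hs.1.2
      · exact h𝒞.1 ha
    · intro a b ha hb
      rw [mem_insert] at ha ⊢
      right
      rcases ha with rfl | ha
      · by_contra hcon
        exact absurd hb.1 (not_lt.2 (hmin b (Finset.mem_sdiff.2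
          ⟨mem_powersetCard.2 ⟨subset_univ _, hb.2⟩, hcon⟩)))
      · exact h𝒞.2 ha hb

lemma isInitSeg_powersetCard (k r : ℕ) :
    Colex.IsInitSeg (powersetCard r ({a : Fin n | (a : ℕ) < k} : Finset (Fin n))) r := by
  refine ⟨fun s hs => (mem_powersetCard.1 hs).2, fun s t hs ht => ?_⟩
  rw [mem_powersetCard] at hs ⊢
  refine ⟨fun x hx => ?_, ht.2⟩
  have h1 : toColex (image Fin.val t) < toColex (image Fin.val s) := by
    rw [Colex.toColex_image_lt_toColex_image Fin.val_strictMono]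
    exact ht.1
  have h2 := Colex.forall_lt_mono (a := k) h1.le (fun b hb => by
    rw [mem_image] at hb
    obtain ⟨a, ha, rfl⟩ := hb
    simpa using hs.1 ha) x (mem_image.2 ⟨x, hx, rfl⟩)
  simpa using h2

lemma card_mul_le_shadow {k : ℕ} {R : Finset (Fin n)} {D : Finset (Finset (Fin n))}
    (hD : D ⊆ powersetCard (k + 1) R) : (k + 1) * #D ≤ (#R - k) * #(shadow D) := by
  rw [mul_comm, mul_comm (#R - k)]
  refine card_mul_le_card_mul (fun a b => b ⊆ a) (fun a ha => ?_) (fun b hb => ?_)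
  · have ha' := mem_powersetCard.1 (hD ha)
    calc k + 1 = #(powersetCard k a) := by rw [card_powersetCard, ha'.2]; simp
      _ ≤ _ := card_le_card fun y hy => by
        rw [mem_powersetCard] at hy
        rw [bipartiteAbove, mem_filter, mem_shadow_iff_exists_mem_card_add_one]
        exact ⟨⟨a, ha, hy.1, by omega⟩, hy.1⟩
  · rw [mem_shadow_iff_exists_mem_card_add_one] at hb
    obtain ⟨a, ha, hba, hcard⟩ := hb
    have ha' := mem_powersetCard.1 (hD ha)
    have hbR : b ⊆ R := hba.trans ha'.1
    calc _ ≤ #((R \ b).image fun x => insert x b) := card_le_card fun y hy => by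
          rw [bipartiteBelow, mem_filter] at hy
          have hy' := mem_powersetCard.1 (hD hy.1)
          obtain ⟨x, hx, h⟩ := (covBy_iff_exists_insert (s := b) (t := y)).1
            ((covBy_iff_card_sdiff_eq_one).2 ⟨hy.2, by rw [card_sdiff_of_subset hy.2]; omega⟩)
          rw [mem_image]
          exact ⟨x, Finset.mem_sdiff.2 ⟨hy'.1 (h ▸ mem_insert_self _ _), hx⟩, h⟩
      _ ≤ #(R \ b) := card_image_le
      _ = #R - k := by rw [card_sdiff_of_subset hbR]; omega

/-- Families with a small shadow expand. -/
lemma shadow_dichotomy {k : ℕ} {D : Finset (Finset (Fin n))} (hD : D ⊆ layer n (k + 1)) :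
    (k + 1) * #D ≤ 4 * #(shadow D) ∨ (k + 1) ^ 4 ≤ 24 * #(shadow D) := by
  have hsized : (D : Set (Finset (Fin n))).Sized (k + 1) := fun s hs =>
    (mem_powersetCard.1 (hD hs)).2
  by_cases hn : k + 4 ≤ n
  · by_cases hcard : #D ≤ (k + 4).choose (k + 1)
    · left
      have hDn : #D ≤ n.choose (k + 1) := by
        simpa using card_le_card hD
      obtain ⟨𝒞, h𝒞, h𝒞card⟩ := exists_isInitSeg n (k + 1) hDn
      have hkk := kruskal_katona hsized h𝒞card.le h𝒞
      set R : Finset (Fin n) := {a : Fin n | (a : ℕ) < k + 4} with hRdef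
      have hR : #R = k + 4 := by
        have : R = attachFin (range (k + 4)) (fun m hm => by rw [mem_range] at hm; omega) := by
          ext a; simp [hRdef]
        rw [this, card_attachFin, card_range]
      have hsub : 𝒞 ⊆ powersetCard (k + 1) R := by
        rcases h𝒞.total (isInitSeg_powersetCard (k + 4) (k + 1)) with h | h
        · exact h
        · refine (eq_of_subset_of_card_le h ?_).symm.subset
          rw [card_powersetCard, hR]
          omega
      have := card_mul_le_shadow hsub
      rw [hR, h𝒞card, show k + 4 - k = 4 by omega] at this
      exact this.trans (Nat.mul_le_mul_left _ hkk)
    · right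
      have h1 := kruskal_katona_lovasz_form (i := 1) (r := k + 1) (k := k + 4) (by omega)
        (by omega) hn hsized (by omega)
      simp only [Function.iterate_one, Nat.add_sub_cancel] at h1
      refine le_trans ?_ (Nat.mul_le_mul_left 24 h1)
      have h2 : (k + 4).choose k = (k + 4).choose 4 := by
        rw [← Nat.choose_symm_of_eq_add (show k + 4 = 4 + k by omega)]
      have h3 := Nat.ascFactorial_eq_factorial_mul_choose k 4
      rw [h2, show (24 : ℕ) = Nat.factorial 4 by rfl, ← h3]
      exact Nat.pow_succ_le_ascFactorial _ _
  · left
    have := card_mul_le_shadow (R := univ) hD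
    rw [card_univ, Fintype.card_fin] at this
    exact this.trans (Nat.mul_le_mul_right _ (by omega))

lemma three_mul_le_shadow {k : ℕ} {D : Finset (Finset (Fin n))} (hD : D ⊆ layer n (k + 1))
    (h3 : 3 ≤ #D) : 3 * (k + 1) ≤ #(shadow D) + 3 := by
  obtain ⟨T, hT, hTcard⟩ := exists_subset_card_eq h3
  obtain ⟨x, y, z, hxy, hxz, hyz, rfl⟩ := card_eq_three.1 hTcard
  have hx := hD (hT (show x ∈ ({x, y, z} : Finset _) by simp))
  have hy := hD (hT (show y ∈ ({x, y, z} : Finset _) by simp))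
  have hz := hD (hT (show z ∈ ({x, y, z} : Finset _) by simp))
  have hb := biregular_layer n k
  have hsub : (powersetCard k x ∪ powersetCard k y) ∪ powersetCard k z ⊆ shadow D := by
    rw [← biUnion_powersetCard_eq_shadow hD]
    refine union_subset (union_subset ?_ ?_) ?_ <;>
    · refine subset_biUnion_of_mem (powersetCard k) (hT ?_)
      simp
  have h1 := card_le_card hsub
  have h2 := card_union_add_card_inter (powersetCard k x ∪ powersetCard k y) (powersetCard k z)
  have h3 := card_union_add_card_inter (powersetCard k x) (powersetCard k y)
  rw [union_inter_distrib_right] at h2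
  have h4 := card_union_le (powersetCard k x ∩ powersetCard k z)
    (powersetCard k y ∩ powersetCard k z)
  have := hb.codeg x hx y hy hxy
  have := hb.codeg x hx z hz hxz
  have := hb.codeg y hy z hz hyz
  have := hb.card_N x hx
  have := hb.card_N y hy
  have := hb.card_N z hz
  omega

end Shadows

section Falling

variable {n : ℕ}

lemma exists_crossing_of_powersetCard {k : ℕ} {A : Finset (Fin n)} {P : Finset (Finset (Fin n))}
    {x x' : Finset (Fin n)} (hx : x ∈ powersetCard (k + 1) A) (hxP : x ∈ P)
    (hx' : x' ∈ powersetCard (k + 1) A) (hx'P : x' ∉ P) :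
    ∃ a ∈ powersetCard (k + 1) A, ∃ b ∈ powersetCard (k + 1) A, a ∈ P ∧ b ∉ P ∧
      Touch (powersetCard k) a b := by
  obtain ⟨a, ha, hmin⟩ := exists_min_image {a ∈ powersetCard (k + 1) A | a ∈ P}
    (fun a => #(a \ x')) ⟨x, mem_filter.2 ⟨hx, hxP⟩⟩
  rw [mem_filter, mem_powersetCard] at ha
  rw [mem_powersetCard] at hx'
  have hne : a ≠ x' := fun h => hx'P (h ▸ ha.2)
  obtain ⟨i, hi⟩ : (a \ x').Nonempty := sdiff_nonempty.2 fun h =>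
    hne (eq_of_subset_of_card_le h (by omega))
  obtain ⟨j, hj⟩ : (x' \ a).Nonempty := sdiff_nonempty.2 fun h =>
    hne (eq_of_subset_of_card_le h (by omega)).symm
  rw [Finset.mem_sdiff] at hi hj
  have hjn : j ∉ a.erase i := fun h => hj.2 (mem_of_mem_erase h)
  have hcard : #(a.erase i) = k := by rw [card_erase_of_mem hi.1, ha.1.2]; rfl
  have hb : insert j (a.erase i) ∈ powersetCard (k + 1) A := by
    rw [mem_powersetCard]
    refine ⟨insert_subset (hx'.1 hj.1) ((erase_subset _ _).trans ha.1.1), ?_⟩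
    rw [card_insert_of_notMem hjn, hcard]
  refine ⟨a, mem_powersetCard.2 ha.1, insert j (a.erase i), hb, ha.2, fun hbP => ?_, ?_⟩
  · have h1 := hmin _ (mem_filter.2 ⟨hb, hbP⟩)
    refine absurd h1 (not_le.2 (card_lt_card ?_))
    rw [ssubset_iff_of_subset]
    · exact ⟨i, Finset.mem_sdiff.2 hi, fun h => by
        rw [Finset.mem_sdiff, mem_insert] at h
        rcases h.1 with h | h
        · exact h.symm ▸ hi.2 <| hj.1
        · exact notMem_erase _ _ h⟩
    · intro y hy
      rw [Finset.mem_sdiff, mem_insert] at hy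
      rw [Finset.mem_sdiff]
      refine ⟨?_, hy.2⟩
      rcases hy.1 with h | h
      · exact absurd (h ▸ hj.1) hy.2
      · exact mem_of_mem_erase h
  · unfold Touch
    rw [not_disjoint_iff]
    exact ⟨a.erase i, mem_powersetCard.2 ⟨erase_subset _ _, hcard⟩,
      mem_powersetCard.2 ⟨subset_insert _ _, hcard⟩⟩

lemma Linked.falling {k : ℕ} {c : Finset (Finset (Fin n))} (hc : Linked (Touch (powersetCard k)) c)
    (hk : ∀ A ∈ c, k + 1 ≤ #A) : Linked (Touch (powersetCard k)) (falling (k + 1) c) := by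
  have hmem : ∀ A ∈ c, powersetCard (k + 1) A ⊆ Finset.falling (k + 1) c := fun A hA x hx =>
    mem_falling.2 ⟨⟨A, hA, (mem_powersetCard.1 hx).1⟩, (mem_powersetCard.1 hx).2⟩
  have hex : ∀ A ∈ c, ∀ y ⊆ A, #y ≤ k + 1 → ∃ x ∈ powersetCard (k + 1) A, y ⊆ x := by
    intro A hA y hy hcard
    obtain ⟨x, h1, h2, h3⟩ := exists_subsuperset_card_eq hy hcard (hk A hA)
    exact ⟨x, mem_powersetCard.2 ⟨h2, h3⟩, h1⟩
  refine ⟨?_, fun P hP hne hPD => ?_⟩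
  · obtain ⟨A, hA⟩ := hc.1
    obtain ⟨x, hx, -⟩ := hex A hA ∅ (empty_subset _) (by simp)
    exact ⟨x, hmem A hA hx⟩
  by_cases hcross : ∃ A ∈ c, ∃ x ∈ powersetCard (k + 1) A, ∃ x' ∈ powersetCard (k + 1) A,
      x ∈ P ∧ x' ∉ P
  · obtain ⟨A, hA, x, hx, x', hx', hxP, hx'P⟩ := hcross
    obtain ⟨a, ha, b, hb, haP, hbP, hab⟩ := exists_crossing_of_powersetCard hx hxP hx' hx'P
    exact ⟨a, haP, b, Finset.mem_sdiff.2 ⟨hmem A hA hb, hbP⟩, hab⟩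
  push Not at hcross
  obtain ⟨x, hx⟩ := hne
  obtain ⟨⟨A, hA, hxA⟩, hxcard⟩ := mem_falling.1 (hP hx)
  obtain ⟨z, hz, hzP⟩ := exists_of_ssubset (hP.ssubset_of_ne hPD)
  obtain ⟨⟨B, hB, hzB⟩, hzcard⟩ := mem_falling.1 hz
  obtain ⟨A', hA', B', hB', hAB⟩ := hc.2 {A ∈ c | powersetCard (k + 1) A ⊆ P} (filter_subset _ _)
    ⟨A, mem_filter.2 ⟨hA, fun x' hx' =>
      hcross A hA x (mem_powersetCard.2 ⟨hxA, hxcard⟩) x' hx' hx⟩⟩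
    (fun h => by
      rw [filter_eq_self] at h
      exact hzP (h B hB (mem_powersetCard.2 ⟨hzB, hzcard⟩)))
  rw [mem_filter] at hA'
  rw [Finset.mem_sdiff, mem_filter] at hB'
  unfold Touch at hAB
  rw [not_disjoint_iff] at hAB
  obtain ⟨y, hyA, hyB⟩ := hAB
  rw [mem_powersetCard] at hyA hyB
  obtain ⟨a, ha, hya⟩ := hex A' hA'.1 y hyA.1 (by omega)
  obtain ⟨b, hb, hyb⟩ := hex B' hB'.1 y hyB.1 (by omega)
  refine ⟨a, hA'.2 ha, b, Finset.mem_sdiff.2 ⟨hmem B' hB'.1 hb, fun hbP => hB'.2 ⟨hB'.1, ?_⟩⟩, ?_⟩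
  · exact fun x' hx' => hcross B' hB'.1 b hb x' hx' hbP
  · unfold Touch
    rw [not_disjoint_iff]
    exact ⟨y, mem_powersetCard.2 ⟨hya, hyA.2⟩, mem_powersetCard.2 ⟨hyb, hyA.2⟩⟩

lemma falling_subset_layer (r : ℕ) (c : Finset (Finset (Fin n))) :
    Finset.falling r c ⊆ layer n r := fun _ hx =>
  mem_powersetCard.2 ⟨subset_univ _, (mem_falling.1 hx).2⟩

lemma biUnion_powersetCard_eq_falling (k : ℕ) (c : Finset (Finset (Fin n))) :
    c.biUnion (powersetCard k) = Finset.falling k c := by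
  ext x
  simp only [mem_biUnion, mem_powersetCard, mem_falling]
  tauto

lemma biUnion_powersetCard_eq_shadow_falling {k : ℕ} {c : Finset (Finset (Fin n))}
    (hk : ∀ A ∈ c, k + 1 ≤ #A) :
    c.biUnion (powersetCard k) = shadow (Finset.falling (k + 1) c) := by
  rw [biUnion_powersetCard_eq_falling, ← slice_union_shadow_falling_succ, union_eq_right]
  intro x hx
  rw [mem_slice] at hx
  have := hk x hx.1
  omega

end Falling

lemma sum_biUnion_le_of_nonneg {ι α : Type*} [DecidableEq α] {T : Finset ι} {S : ι → Finset α}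
    {f : α → ℝ} (hf : ∀ i ∈ T.biUnion S, 0 ≤ f i) :
    ∑ a ∈ T.biUnion S, f a ≤ ∑ i ∈ T, ∑ a ∈ S i, f a := by
  classical
  induction T using Finset.induction_on with
  | empty => simp
  | insert i T hi ih =>
    rw [biUnion_insert] at hf ⊢
    rw [sum_insert hi]
    have h1 := ih fun a ha => hf a (mem_union_right _ ha)
    have h2 : 0 ≤ ∑ a ∈ S i ∩ T.biUnion S, f a :=
      sum_nonneg fun a ha => hf a (mem_union_left _ (mem_inter.1 ha).1)
    have h3 := sum_union_inter (s₁ := S i) (s₂ := T.biUnion S) (f := f)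
    linarith

section Counting

variable {n : ℕ}

open Classical in
/-- The antichains all of whose members have at least `r` elements. -/
noncomputable def antichainsFrom (n r : ℕ) : Finset (Finset (Finset (Fin n))) :=
  {γ | IsAntichain (· ⊆ ·) (γ : Set (Finset (Fin n))) ∧ ∀ A ∈ γ, r ≤ #A}

lemma mem_antichainsFrom {r : ℕ} {γ : Finset (Finset (Fin n))} : γ ∈ antichainsFrom n r ↔
    IsAntichain (· ⊆ ·) (γ : Set (Finset (Fin n))) ∧ ∀ A ∈ γ, r ≤ #A := by
  simp [antichainsFrom]

/-- The antichains from level `r` on whose members have all their `r`-subsets in `F`. -/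
noncomputable def antichainsIn (r : ℕ) (F : Finset (Finset (Fin n))) :
    Finset (Finset (Finset (Fin n))) :=
  {γ ∈ antichainsFrom n r | falling r γ ⊆ F}

open Classical in
/-- The connected antichains above level `k`. -/
noncomputable def polymers (n k : ℕ) : Finset (Finset (Finset (Fin n))) :=
  {c ∈ antichainsFrom n (k + 1) | Linked (Touch (powersetCard k)) c}

lemma mem_polymers {k : ℕ} {c : Finset (Finset (Fin n))} : c ∈ polymers n k ↔
    c ∈ antichainsFrom n (k + 1) ∧ Linked (Touch (powersetCard k)) c := by
  simp [polymers]

lemma polyWeight_of_mem_polymers {k : ℕ} {c : Finset (Finset (Fin n))} (hc : c ∈ polymers n k) :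
    polyWeight (powersetCard k) c = (1 / 2) ^ #(shadow (falling (k + 1) c)) := by
  rw [mem_polymers, mem_antichainsFrom] at hc
  rw [polyWeight, biUnion_powersetCard_eq_shadow_falling hc.1.2]

lemma linked_falling_of_mem_polymers {k : ℕ} {c : Finset (Finset (Fin n))}
    (hc : c ∈ polymers n k) : Linked (Touch (powersetCard k)) (falling (k + 1) c) := by
  rw [mem_polymers, mem_antichainsFrom] at hc
  exact hc.2.falling hc.1.2

lemma sum_polyWeight_le_sum_falling {k : ℕ} {b : ℝ}
    (H : ∀ F ⊆ layer n (k + 1), (#(antichainsIn (k + 1) F) : ℝ) ≤ b ^ #F)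
    {Q : Finset (Finset (Finset (Fin n)))} (hQ : Q ⊆ polymers n k) :
    ∑ c ∈ Q, polyWeight (powersetCard k) c ≤
      ∑ D ∈ Q.image (falling (k + 1)), b ^ #D * (1 / 2) ^ #(shadow D) := by
  rw [← sum_fiberwise_of_maps_to (fun c hc => mem_image_of_mem (falling (k + 1)) hc)]
  refine sum_le_sum fun D hD => ?_
  calc _ = ∑ c ∈ Q with falling (k + 1) c = D, (1 / 2 : ℝ) ^ #(shadow D) :=
        sum_congr rfl fun c hc => by
          rw [mem_filter] at hc
          rw [polyWeight_of_mem_polymers (hQ hc.1), hc.2]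
    _ = (#{c ∈ Q | falling (k + 1) c = D} : ℝ) * (1 / 2 : ℝ) ^ #(shadow D) := by
        rw [sum_const, nsmul_eq_mul]
    _ ≤ _ := by
        refine mul_le_mul_of_nonneg_right ?_ (by positivity)
        obtain ⟨c, -, rfl⟩ := mem_image.1 hD
        refine le_trans ?_ (H _ (falling_subset_layer _ c))
        refine Nat.cast_le.2 (card_le_card fun c' hc' => ?_)
        rw [mem_filter] at hc'
        rw [antichainsIn, mem_filter]
        exact ⟨(mem_polymers.1 (hQ hc'.1)).1, hc'.2.subset⟩

/-- The sum over the connected families containing one of the members of `T`. -/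
lemma sum_linked_falling_le {k : ℕ} {x : ℝ} (hx : 0 ≤ x)
    (hxn : 2 * ((((n + 1) ^ 2 : ℕ) : ℝ)) ^ 2 * x ≤ 1) (T : Finset (Finset (Fin n)))
    (𝓕 : Finset (Finset (Finset (Fin n))))
    (h : ∀ D ∈ 𝓕, D ⊆ layer n (k + 1) ∧ Linked (Touch (powersetCard k)) D ∧ ∃ v ∈ T, v ∈ D) :
    ∑ D ∈ 𝓕, x ^ #D ≤ #T * (2 * x) := by
  have hsub : 𝓕 ⊆ T.biUnion fun v => {D ∈ 𝓕 | v ∈ D} := fun D hD => by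
    obtain ⟨v, hv, hvD⟩ := (h D hD).2.2
    exact mem_biUnion.2 ⟨v, hv, mem_filter.2 ⟨hD, hvD⟩⟩
  calc _ ≤ ∑ D ∈ T.biUnion fun v => {D ∈ 𝓕 | v ∈ D}, x ^ #D :=
        sum_le_sum_of_subset_of_nonneg hsub fun _ _ _ => by positivity
    _ ≤ ∑ v ∈ T, ∑ D ∈ 𝓕 with v ∈ D, x ^ #D := sum_biUnion_le_of_nonneg fun _ _ => by positivity
    _ ≤ ∑ v ∈ T, 2 * x := sum_le_sum fun v _ => by
        refine sum_linked_le (R := fun a b => hdist a b ≤ 2) (nb := hball 2)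
          (fun a b hab => ⟨mem_hball.2 hab, mem_hball.2 (hdist_symm a b ▸ hab)⟩)
          (fun a => card_hball_le 2 a) v _ (fun D hD => ?_) hx hxn
        rw [mem_filter] at hD
        obtain ⟨h1, h2, -⟩ := h D hD.1
        exact ⟨h2.mono fun a ha b hb => hdist_le_two_of_touch (h1 ha) (h1 hb), hD.2⟩
    _ = _ := by rw [sum_const, nsmul_eq_mul]

end Counting

section Large

variable {n : ℕ}

lemma sum_linked_univ_le {j : ℕ} {x : ℝ} (hx : 0 ≤ x)
    (hxn : 2 * ((((n + 1) ^ j : ℕ) : ℝ)) ^ 2 * x ≤ 1) (𝓕 : Finset (Finset (Finset (Fin n))))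
    (h : ∀ W ∈ 𝓕, Linked (fun a b => hdist a b ≤ j) W) :
    ∑ W ∈ 𝓕, x ^ #W ≤ 2 ^ n * (2 * x) := by
  have hsub : 𝓕 ⊆ (univ : Finset (Finset (Fin n))).biUnion fun v => {W ∈ 𝓕 | v ∈ W} := by
    intro W hW
    obtain ⟨v, hv⟩ := (h W hW).1
    exact mem_biUnion.2 ⟨v, mem_univ _, mem_filter.2 ⟨hW, hv⟩⟩
  calc _ ≤ ∑ W ∈ (univ : Finset (Finset (Fin n))).biUnion fun v => {W ∈ 𝓕 | v ∈ W}, x ^ #W :=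
        sum_le_sum_of_subset_of_nonneg hsub fun _ _ _ => by positivity
    _ ≤ ∑ v : Finset (Fin n), ∑ W ∈ 𝓕 with v ∈ W, x ^ #W :=
        sum_biUnion_le_of_nonneg fun _ _ => by positivity
    _ ≤ ∑ v : Finset (Fin n), 2 * x := sum_le_sum fun v _ =>
        sum_linked_le (nb := hball j)
          (fun a b hab => ⟨mem_hball.2 hab, mem_hball.2 (hdist_symm a b ▸ hab)⟩)
          (fun a => card_hball_le j a) v _
          (fun W hW => ⟨h W (mem_filter.1 hW).1, (mem_filter.1 hW).2⟩) hx hxn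
    _ = _ := by simp

/-- Connected antichains whose shadow has `g` elements and deficiency `t` are rare. -/
lemma card_polymers_le {k p K g t : ℕ} {κ : ℝ} (hκ : 0 ≤ κ) (hkn : k < n) (hnk : n ≤ 2 * k)
    (hp : 16 ≤ p) (hr1 : p ^ 10 ≤ k + 1) (hr2 : k + 1 ≤ 2 * p ^ 10) (hK : 104 * K ≤ p)
    (hK2 : 64 * (n + 1) ^ 16 ≤ 2 ^ K)
    (H : ∀ F ⊆ layer n (k + 1), (#(antichainsIn (k + 1) F) : ℝ) ≤ (2 * Real.exp κ) ^ #F)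
    {Q : Finset (Finset (Finset (Fin n)))} (hQ : Q ⊆ polymers n k)
    (hg : ∀ c ∈ Q, #(shadow (falling (k + 1) c)) = g)
    (ht : ∀ c ∈ Q, #(inner (layer n (k + 1)) (powersetCard k) (shadow (falling (k + 1) c))) + t =
      g) :
    (#Q : ℝ) ≤ 2 ^ (n + 1) * Real.exp (κ * g) * (1 / 2) ^ (t / (2 * p)) * 2 ^ g := by
  classical
  set N : Finset (Fin n) → Finset (Finset (Fin n)) := fun x => powersetCard k x with hN
  set M : Finset (Fin n) → Finset (Finset (Fin n)) := fun y => {x ∈ layer n (k + 1) | y ⊆ x}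
    with hM
  set τ := t / (2 * p) with hτ
  set 𝓦 : Finset (Finset (Finset (Fin n))) := {W | Linked (fun a b => hdist a b ≤ 8) W} with h𝓦
  set 𝓢 : Finset (Finset (Fin n)) → Finset (Finset (Finset (Fin n))) := fun W =>
    {S ∈ containers (layer n (k + 1)) (layer n k) N M (p ^ 8) W |
      S ⊆ layer n (k + 1) ∧ K * #W + #S + τ ≤ g} with h𝓢
  have hsub : Q ⊆ 𝓦.biUnion fun W => (𝓢 W).biUnion (antichainsIn (k + 1)) := by
    intro c hc
    have hD := falling_subset_layer (k + 1) c
    have hDN : (falling (k + 1) c).biUnion N = shadow (falling (k + 1) c) :=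
      biUnion_powersetCard_eq_shadow hD
    obtain ⟨W, S, hS, hWD, hDW, hDS, hSX, hle⟩ := (biregular_layer n k).exists_container
      (d := hdist) (t := t) (p := p) (K := K) hdist_symm hdist_triangle
      (fun x hx y hy => by
        rw [mem_powersetCard] at hx hy
        rw [hdist_of_subset hy.1]
        omega) (by omega) (by omega) hp hr1 hr2 hK hD
      (by rw [hDN, hg c hc]; exact ht c hc)
    have hlink : Linked (fun a b => hdist a b ≤ 8) W := by
      have h1 : Linked (fun a b => hdist a b ≤ 2) (falling (k + 1) c) :=
        (linked_falling_of_mem_polymers (hQ hc)).mono fun a ha b hb =>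
          hdist_le_two_of_touch (hD ha) (hD hb)
      refine h1.transfer (near := fun a b => hdist a b ≤ 3) hDW hWD (fun x y z h h' => ?_)
        (fun x y x' y' h h' h'' => ?_) (fun x y h => hdist_symm x y ▸ h)
      · have := hdist_triangle y x z
        omega
      · have h1 := hdist_triangle y x y'
        have h2 := hdist_triangle x x' y'
        rw [hdist_symm y x] at h1
        omega
    rw [mem_biUnion]
    refine ⟨W, mem_filter.2 ⟨mem_univ _, hlink⟩, mem_biUnion.2 ⟨S, mem_filter.2 ⟨hS, hSX, ?_⟩, ?_⟩⟩
    · rw [hDN, hg c hc] at hle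
      have h1 : 2 * p * τ ≤ t := Nat.mul_div_le t (2 * p)
      have h2 : 2 * p * (K * #W + #S + τ) ≤ 2 * p * g := by rw [mul_add]; omega
      exact Nat.le_of_mul_le_mul_left h2 (by omega)
    · rw [antichainsIn, mem_filter]
      exact ⟨(mem_polymers.1 (hQ hc)).1, hDS⟩
  set B : ℝ := Real.exp (κ * g) * (1 / 2) ^ τ * 2 ^ g with hB
  have hB0 : 0 ≤ B := by positivity
  have hexp : 1 ≤ Real.exp κ := Real.one_le_exp hκ
  have hS : ∀ W, ∀ S ∈ 𝓢 W, (#(antichainsIn (k + 1) S) : ℝ) ≤ B * ((1 / 2) ^ K) ^ #W := by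
    intro W S hS
    rw [h𝓢, mem_filter] at hS
    obtain ⟨-, hSX, hle⟩ := hS
    refine (H S hSX).trans ?_
    rw [mul_pow, ← Real.exp_nat_mul]
    have h1 : Real.exp (#S * κ) ≤ Real.exp (κ * g) := by
      rw [Real.exp_le_exp, mul_comm]
      refine mul_le_mul_of_nonneg_left ?_ hκ
      exact_mod_cast ((Nat.le_add_left _ _).trans (Nat.le_add_right _ _)).trans hle
    have h2 : (2 : ℝ) ^ #S ≤ (1 / 2) ^ τ * 2 ^ g * ((1 / 2) ^ K) ^ #W := by
      have h3 : (2 : ℝ) ^ (K * #W + #S + τ) ≤ 2 ^ g := pow_le_pow_right₀ (by norm_num) hle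
      have h4 : (2 : ℝ) ^ #S = (2 : ℝ) ^ (K * #W + #S + τ) * ((1 / 2) ^ τ * (1 / 2) ^ (K * #W)) := by
        rw [pow_add, pow_add, one_div, inv_pow, inv_pow]
        field_simp
      rw [h4, ← pow_mul]
      calc _ ≤ (2 : ℝ) ^ g * ((1 / 2) ^ τ * (1 / 2) ^ (K * #W)) :=
            mul_le_mul_of_nonneg_right h3 (by positivity)
        _ = _ := by ring
    calc _ ≤ ((1 / 2) ^ τ * 2 ^ g * ((1 / 2) ^ K) ^ #W) * Real.exp (κ * g) :=
          mul_le_mul h2 h1 (Real.exp_pos _).le (by positivity)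
      _ = _ := by rw [hB]; ring
  set x : ℝ := 32 * (1 / 2) ^ K with hx
  have hK2' : (64 : ℝ) * ((n : ℝ) + 1) ^ 16 ≤ 2 ^ K := by exact_mod_cast hK2
  have hxK : x * 2 ^ K = 32 := by
    rw [hx, mul_assoc, ← mul_pow]
    norm_num
  have hx0 : 0 ≤ x := by positivity
  have hx1 : 2 * ((((n + 1) ^ 8 : ℕ) : ℝ)) ^ 2 * x ≤ 1 := by
    push_cast
    rw [← pow_mul]
    have := mul_le_mul_of_nonneg_left hK2' hx0
    norm_num at this ⊢
    linarith
  have hx2 : 2 * x ≤ 1 := by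
    have h1 : (1 : ℝ) ≤ ((n : ℝ) + 1) ^ 16 := 
      one_le_pow₀ (by linarith [(Nat.cast_nonneg n : (0 : ℝ) ≤ n)])
    have h2 : (64 : ℝ) ≤ 2 ^ K := by linarith
    have := mul_le_mul_of_nonneg_left h2 hx0
    linarith
  have hcard : (#Q : ℝ) ≤ ∑ W ∈ 𝓦, ∑ S ∈ 𝓢 W, (#(antichainsIn (k + 1) S) : ℝ) := by
    have h1 := (card_le_card hsub).trans card_biUnion_le
    have h2 : #Q ≤ ∑ W ∈ 𝓦, ∑ S ∈ 𝓢 W, #(antichainsIn (k + 1) S) :=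
      h1.trans (sum_le_sum fun W _ => card_biUnion_le)
    exact_mod_cast h2
  calc (#Q : ℝ) ≤ _ := hcard
    _ ≤ ∑ W ∈ 𝓦, 2 * B * x ^ #W := sum_le_sum fun W _ => by
        calc _ ≤ ∑ S ∈ 𝓢 W, B * ((1 / 2) ^ K) ^ #W := sum_le_sum fun S h => hS W S h
          _ = (#(𝓢 W) : ℝ) * (B * ((1 / 2) ^ K) ^ #W) := by rw [sum_const, nsmul_eq_mul]
          _ ≤ (2 * 32 ^ #W) * (B * ((1 / 2) ^ K) ^ #W) := by
              refine mul_le_mul_of_nonneg_right ?_ (by positivity)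
              have : #(𝓢 W) ≤ 2 * 32 ^ #W := (card_le_card (filter_subset _ _)).trans
                (card_containers_le (layer n (k + 1)) (layer n k) N M (p ^ 8) W)
              exact_mod_cast this
          _ = _ := by rw [hx, mul_pow]; ring
    _ = 2 * B * ∑ W ∈ 𝓦, x ^ #W := by rw [mul_sum]
    _ ≤ 2 * B * (2 ^ n * (2 * x)) := by
        refine mul_le_mul_of_nonneg_left ?_ (by positivity)
        exact sum_linked_univ_le hx0 hx1 𝓦 fun W hW => (mem_filter.1 hW).2
    _ ≤ 2 * B * (2 ^ n * 1) := by gcongr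
    _ = _ := by rw [hB]; ring

lemma sum_large_le {k p K : ℕ} {κ δ : ℝ} (hκ : 0 ≤ κ) (hkn : k < n) (hnk : n ≤ 2 * k)
    (hp : 16 ≤ p) (hr1 : p ^ 10 ≤ k + 1) (hr2 : k + 1 ≤ 2 * p ^ 10) (hK : 104 * K ≤ p)
    (hK2 : 64 * (n + 1) ^ 16 ≤ 2 ^ K)
    (H : ∀ F ⊆ layer n (k + 1), (#(antichainsIn (k + 1) F) : ℝ) ≤ (2 * Real.exp κ) ^ #F)
    (hδ0 : 0 ≤ δ) (hδ : ∀ t : ℕ, (k + 1) ^ 3 ≤ 24 * t →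
      Real.exp (κ * ((k + 1 : ℕ) * t)) * (1 / 2) ^ (t / (2 * p)) ≤ δ) :
    ∑ c ∈ polymers n k with (k + 1) ^ 4 ≤ 24 * #(shadow (falling (k + 1) c)),
      polyWeight (powersetCard k) c ≤ 2 ^ (3 * n + 3) * δ := by
  have hb := biregular_layer n k
  have hin : ∀ G ⊆ layer n k, #(inner (layer n (k + 1)) (powersetCard k) G) ≤ #G := by
    intro G hG
    have h1 := hb.sum_sdiff_add hG
    have h2 : (k + 1) * #(inner (layer n (k + 1)) (powersetCard k) G) ≤ (k + 1) * #G := by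
      refine le_trans (le_trans (Nat.le_add_left _ _) h1.le) (Nat.mul_le_mul_right _ (by omega))
    exact Nat.le_of_mul_le_mul_left h2 (by omega)
  have hsh : ∀ c : Finset (Finset (Fin n)), shadow (falling (k + 1) c) ⊆ layer n k := by
    intro c
    rw [← biUnion_powersetCard_eq_shadow (falling_subset_layer (k + 1) c), biUnion_subset]
    exact fun x _ => powersetCard_mono (subset_univ x)
  set dfc : Finset (Finset (Fin n)) → ℕ := fun c => #(shadow (falling (k + 1) c)) -
    #(inner (layer n (k + 1)) (powersetCard k) (shadow (falling (k + 1) c))) with hdef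
  set Q := {c ∈ polymers n k | (k + 1) ^ 4 ≤ 24 * #(shadow (falling (k + 1) c))} with hQ
  have hmaps : ∀ c ∈ Q, (#(shadow (falling (k + 1) c)), dfc c) ∈
      range (2 ^ n + 1) ×ˢ range (2 ^ n + 1) := by
    intro c _
    have h1 : #(shadow (falling (k + 1) c)) ≤ 2 ^ n := by
      refine (card_le_univ _).trans ?_
      simp
    rw [mem_product, mem_range, mem_range]
    exact ⟨by simpa using Nat.lt_succ_of_le h1, by
      simpa [hdef] using Nat.lt_succ_of_le ((Nat.sub_le _ _).trans h1)⟩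
  rw [← sum_fiberwise_of_maps_to hmaps]
  have hfib : ∀ q ∈ range (2 ^ n + 1) ×ˢ range (2 ^ n + 1),
      ∑ c ∈ Q with (#(shadow (falling (k + 1) c)), dfc c) = q, polyWeight (powersetCard k) c ≤
        2 ^ (n + 1) * δ := by
    rintro ⟨g, t⟩ -
    set Q' := {c ∈ Q | (#(shadow (falling (k + 1) c)), dfc c) = (g, t)} with hQ'
    rcases Q'.eq_empty_or_nonempty with hemp | ⟨c₀, hc₀⟩
    · rw [hemp, sum_empty]
      positivity
    have hsub : Q' ⊆ polymers n k := (filter_subset _ _).trans (filter_subset _ _)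
    have hg : ∀ c ∈ Q', #(shadow (falling (k + 1) c)) = g := fun c hc => by
      have := (mem_filter.1 hc).2
      rw [Prod.mk.injEq] at this
      exact this.1
    have ht : ∀ c ∈ Q', #(inner (layer n (k + 1)) (powersetCard k)
        (shadow (falling (k + 1) c))) + t = g := fun c hc => by
      have h1 := (mem_filter.1 hc).2
      rw [Prod.mk.injEq] at h1
      have h2 := hin _ (hsh c)
      rw [← h1.2, hdef, ← h1.1]
      exact Nat.add_sub_of_le h2
    have hcard := card_polymers_le hκ hkn hnk hp hr1 hr2 hK hK2 H hsub hg ht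
    have hgt : g ≤ (k + 1) * t := by
      rw [← hg c₀ hc₀]
      exact hb.card_le_mul (hsh c₀) (by omega) ((ht c₀ hc₀).trans (hg c₀ hc₀).symm)
    have hg4 : (k + 1) ^ 4 ≤ 24 * g := by
      rw [← hg c₀ hc₀]
      exact (mem_filter.1 (mem_filter.1 hc₀).1).2
    have ht3 : (k + 1) ^ 3 ≤ 24 * t := by
      refine Nat.le_of_mul_le_mul_left (c := k + 1) ?_ (Nat.succ_pos k)
      calc _ = (k + 1) ^ 4 := by ring
        _ ≤ 24 * ((k + 1) * t) := hg4.trans (Nat.mul_le_mul_left _ hgt)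
        _ = _ := by ring
    have hle : Real.exp (κ * g) * (1 / 2) ^ (t / (2 * p)) ≤ δ := by
      refine le_trans ?_ (hδ t ht3)
      refine mul_le_mul_of_nonneg_right ?_ (by positivity)
      rw [Real.exp_le_exp]
      refine mul_le_mul_of_nonneg_left ?_ hκ
      exact_mod_cast hgt
    calc ∑ c ∈ Q', polyWeight (powersetCard k) c = ∑ c ∈ Q', (1 / 2 : ℝ) ^ g :=
          sum_congr rfl fun c hc => by rw [polyWeight_of_mem_polymers (hsub hc), hg c hc]
      _ = (#Q' : ℝ) * (1 / 2) ^ g := by rw [sum_const, nsmul_eq_mul]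
      _ ≤ (2 ^ (n + 1) * Real.exp (κ * g) * (1 / 2) ^ (t / (2 * p)) * 2 ^ g) * (1 / 2) ^ g :=
          mul_le_mul_of_nonneg_right hcard (by positivity)
      _ = 2 ^ (n + 1) * (Real.exp (κ * g) * (1 / 2) ^ (t / (2 * p))) := by
          rw [one_div, inv_pow, inv_pow]
          field_simp
      _ ≤ _ := mul_le_mul_of_nonneg_left hle (by positivity)
  refine (sum_le_sum hfib).trans ?_
  rw [sum_const, nsmul_eq_mul, card_product, card_range]
  have h2 : ((2 ^ n + 1 : ℕ) : ℝ) ≤ 2 ^ (n + 1) := by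
    push_cast
    rw [pow_succ]
    have : (1 : ℝ) ≤ 2 ^ n := one_le_pow₀ (by norm_num)
    linarith
  calc _ ≤ (2 ^ (n + 1) * 2 ^ (n + 1)) * (2 ^ (n + 1) * δ) := by
        rw [Nat.cast_mul]
        gcongr
    _ = _ := by ring

end Large

section Induction

variable {n : ℕ}

/-- The polymers with a large shadow. -/
noncomputable def largePolymers (n k : ℕ) : Finset (Finset (Finset (Fin n))) :=
  {c ∈ polymers n k | (k + 1) ^ 4 ≤ 24 * #(shadow (falling (k + 1) c))}

lemma div_four_mul_le {k : ℕ} {c : Finset (Finset (Fin n))} (hc : c ∈ polymers n k)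
    (hcL : c ∉ largePolymers n k) :
    (k + 1) * #(falling (k + 1) c) ≤ 4 * #(shadow (falling (k + 1) c)) :=
  (shadow_dichotomy (falling_subset_layer _ _)).resolve_right
    fun h => hcL (mem_filter.2 ⟨hc, h⟩)

lemma sum_through_le {k : ℕ} {b L : ℝ} (hb4 : b ≤ 4) (hb0 : 0 ≤ b)
    (H : ∀ F ⊆ layer n (k + 1), (#(antichainsIn (k + 1) F) : ℝ) ≤ b ^ #F)
    (hx : 2 * ((((n + 1) ^ 2 : ℕ) : ℝ)) ^ 2 * (4 * (1 / 2) ^ ((k + 1) / 4)) ≤ 1)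
    (hL : ∑ c ∈ largePolymers n k, polyWeight (powersetCard k) c ≤ L)
    {v : Finset (Fin n)} (hv : v ∈ layer n k) :
    ∑ c ∈ polymers n k with v ∈ c.biUnion (powersetCard k), polyWeight (powersetCard k) c ≤
      n * (2 * (4 * (1 / 2) ^ ((k + 1) / 4))) + L := by
  set x : ℝ := 4 * (1 / 2) ^ ((k + 1) / 4) with hxdef
  set Q := {c ∈ polymers n k | v ∈ c.biUnion (powersetCard k)} with hQ
  set Q' := Q \ largePolymers n k with hQ'
  have hQsub : Q' ⊆ polymers n k := sdiff_subset.trans (filter_subset _ _)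
  have h1 : ∑ c ∈ Q', polyWeight (powersetCard k) c ≤ n * (2 * x) := by
    refine (sum_polyWeight_le_sum_falling H hQsub).trans ?_
    calc _ ≤ ∑ D ∈ Q'.image (falling (k + 1)), x ^ #D := sum_le_sum fun D hD => by
          obtain ⟨c, hc, rfl⟩ := mem_image.1 hD
          have h2 := div_four_mul_le (hQsub hc) (Finset.mem_sdiff.1 hc).2
          have h3 : (k + 1) / 4 * #(falling (k + 1) c) ≤ #(shadow (falling (k + 1) c)) := by
            have h4 : 4 * ((k + 1) / 4 * #(falling (k + 1) c)) ≤
                4 * #(shadow (falling (k + 1) c)) := by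
              refine le_trans ?_ h2
              rw [← mul_assoc]
              exact Nat.mul_le_mul_right _ (Nat.mul_div_le _ _)
            omega
          rw [hxdef, mul_pow, ← pow_mul]
          exact mul_le_mul (pow_le_pow_left₀ hb0 hb4 _)
            (pow_le_pow_of_le_one (by norm_num) (by norm_num) h3) (by positivity) (by positivity)
      _ ≤ #({y ∈ layer n (k + 1) | v ⊆ y} : Finset _) * (2 * x) := by
          refine sum_linked_falling_le (k := k) (by positivity) hx _ _ fun D hD => ?_
          obtain ⟨c, hc, rfl⟩ := mem_image.1 hD
          refine ⟨falling_subset_layer _ _, linked_falling_of_mem_polymers (hQsub hc), ?_⟩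
          have hcQ := mem_filter.1 (Finset.mem_sdiff.1 hc).1
          rw [mem_polymers, mem_antichainsFrom] at hcQ
          rw [biUnion_powersetCard_eq_shadow_falling hcQ.1.1.2,
            ← biUnion_powersetCard_eq_shadow (falling_subset_layer _ _), mem_biUnion] at hcQ
          obtain ⟨y, hy, hvy⟩ := hcQ.2
          exact ⟨y, mem_filter.2 ⟨falling_subset_layer _ _ hy, (mem_powersetCard.1 hvy).1⟩, hy⟩
      _ ≤ _ := by
          refine mul_le_mul_of_nonneg_right ?_ (by positivity)
          have := (biregular_layer n k).card_M v hv
          exact_mod_cast this.le.trans (Nat.sub_le n k)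
  have h2 : ∑ c ∈ Q ∩ largePolymers n k, polyWeight (powersetCard k) c ≤ L :=
    (sum_le_sum_of_subset_of_nonneg inter_subset_right fun _ _ _ => polyWeight_nonneg _).trans hL
  have h3 := sum_inter_add_sum_sdiff Q (largePolymers n k)
    (fun c => polyWeight (powersetCard k) c)
  linarith

lemma mem_polymers_of_mem_comps {k : ℕ} {γ c : Finset (Finset (Fin n))}
    (hγ : γ ∈ antichainsFrom n (k + 1)) (hc : c ∈ comps (Touch (powersetCard k)) γ) :
    c ∈ polymers n k := by
  rw [mem_comps] at hc
  rw [mem_antichainsFrom] at hγ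
  rw [mem_polymers, mem_antichainsFrom]
  exact ⟨⟨hγ.1.subset (by exact_mod_cast hc.1), fun A hA => hγ.2 A (hc.1 hA)⟩, hc.2.1⟩

lemma card_antichainsIn_le {k : ℕ} {θ : ℝ}
    (hθ : ∀ v ∈ layer n k, ∑ c ∈ polymers n k with v ∈ c.biUnion (powersetCard k),
      polyWeight (powersetCard k) c ≤ θ) {F : Finset (Finset (Fin n))} (hF : F ⊆ layer n k) :
    (#(antichainsIn k F) : ℝ) ≤ (2 * Real.exp θ) ^ #F := by
  classical
  set 𝒜 := {γ ∈ antichainsFrom n (k + 1) | γ.biUnion (powersetCard k) ⊆ F} with h𝒜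
  have hmaps : ∀ γ ∈ antichainsIn k F, (γ.filter fun A => k + 1 ≤ #A) ∈ 𝒜 := by
    intro γ hγ
    rw [antichainsIn, mem_filter, mem_antichainsFrom] at hγ
    rw [h𝒜, mem_filter, mem_antichainsFrom]
    refine ⟨⟨hγ.1.1.subset (by exact_mod_cast filter_subset _ _), fun A hA => (mem_filter.1 hA).2⟩,
      ?_⟩
    refine (biUnion_subset_biUnion_of_subset_left _ (filter_subset _ _)).trans ?_
    rw [biUnion_powersetCard_eq_falling]
    exact hγ.2
  have hfib : ∀ γ' ∈ 𝒜, #{γ ∈ antichainsIn k F | γ.filter (fun A => k + 1 ≤ #A) = γ'} ≤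
      2 ^ (#F - #(γ'.biUnion (powersetCard k))) := by
    intro γ' hγ'
    rw [h𝒜, mem_filter] at hγ'
    rw [← card_sdiff_of_subset hγ'.2, ← card_powerset]
    refine card_le_card_of_injOn (fun γ => γ.filter fun A => #A = k) ?_ ?_
    · intro γ hγ
      rw [mem_coe, mem_filter, antichainsIn, mem_filter, mem_antichainsFrom] at hγ
      rw [mem_coe, mem_powerset]
      intro A hA
      rw [mem_filter] at hA
      rw [Finset.mem_sdiff]
      refine ⟨hγ.1.2 (mem_falling.2 ⟨⟨A, hA.1, Subset.rfl⟩, hA.2⟩), fun hcon => ?_⟩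
      rw [mem_biUnion] at hcon
      obtain ⟨B, hB, hAB⟩ := hcon
      rw [← hγ.2, mem_filter] at hB
      have hAB' := (mem_powersetCard.1 hAB).1
      have hne : A ≠ B := fun h => by rw [← h] at hB; omega
      exact hγ.1.1.1 hA.1 hB.1 hne hAB'
    · intro γ hγ γ₁ hγ₁ h
      rw [mem_coe, mem_filter, antichainsIn, mem_filter, mem_antichainsFrom] at hγ hγ₁
      ext A
      have e1 := congrArg (A ∈ ·) h
      have e2 := congrArg (A ∈ ·) (hγ.2.trans hγ₁.2.symm)
      simp only [mem_filter, eq_iff_iff] at e1 e2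
      have e3 := hγ.1.1.2 A
      have e4 := hγ₁.1.1.2 A
      constructor
      · intro hA
        rcases (e3 hA).eq_or_lt with h5 | h5
        · exact (e1.1 ⟨hA, h5.symm⟩).1
        · exact (e2.1 ⟨hA, h5⟩).1
      · intro hA
        rcases (e4 hA).eq_or_lt with h5 | h5
        · exact (e1.2 ⟨hA, h5.symm⟩).1
        · exact (e2.2 ⟨hA, h5⟩).1
  set P := {c ∈ polymers n k | c.biUnion (powersetCard k) ⊆ F} with hP
  have hsum : ∑ c ∈ P, polyWeight (powersetCard k) c ≤ #F * θ := by
    have hsub : P ⊆ F.biUnion fun v => {c ∈ polymers n k | v ∈ c.biUnion (powersetCard k)} := by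
      intro c hc
      rw [hP, mem_filter] at hc
      have hc' := hc.1
      rw [mem_polymers, mem_antichainsFrom] at hc'
      obtain ⟨A, hA⟩ := hc'.2.1
      obtain ⟨v, hv⟩ : (powersetCard k A).Nonempty :=
        powersetCard_nonempty.2 ((Nat.le_succ k).trans (hc'.1.2 A hA))
      have hvc : v ∈ c.biUnion (powersetCard k) := mem_biUnion.2 ⟨A, hA, hv⟩
      exact mem_biUnion.2 ⟨v, hc.2 hvc, mem_filter.2 ⟨hc.1, hvc⟩⟩
    calc _ ≤ _ := sum_le_sum_of_subset_of_nonneg hsub fun _ _ _ => polyWeight_nonneg _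
      _ ≤ _ := sum_biUnion_le_of_nonneg fun _ _ => polyWeight_nonneg _
      _ ≤ ∑ v ∈ F, θ := sum_le_sum fun v hv => hθ v (hF hv)
      _ = _ := by rw [sum_const, nsmul_eq_mul]
  have hcard : (#(antichainsIn k F) : ℝ) ≤
      2 ^ #F * ∑ γ' ∈ 𝒜, polyWeight (powersetCard k) γ' := by
    have h1 : #(antichainsIn k F) ≤ ∑ γ' ∈ 𝒜, 2 ^ (#F - #(γ'.biUnion (powersetCard k))) := by
      rw [card_eq_sum_card_fiberwise hmaps]
      exact sum_le_sum hfib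
    calc (#(antichainsIn k F) : ℝ) ≤ ∑ γ' ∈ 𝒜, (2 : ℝ) ^ (#F - #(γ'.biUnion (powersetCard k))) := by
          exact_mod_cast h1
      _ = _ := by
          rw [mul_sum]
          refine sum_congr rfl fun γ' hγ' => ?_
          rw [polyWeight, pow_sub₀ _ (by norm_num) (card_le_card (mem_filter.1 hγ').2), one_div,
            inv_pow]
  calc _ ≤ _ := hcard
    _ ≤ 2 ^ #F * hardCore (Conflict (powersetCard k)) (polyWeight (powersetCard k)) P := by
        refine mul_le_mul_of_nonneg_left ?_ (by positivity)
        refine sum_polyWeight_le_hardCore _ _ fun γ hγ c hc => ?_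
        rw [h𝒜, mem_filter] at hγ
        rw [hP, mem_filter]
        exact ⟨mem_polymers_of_mem_comps hγ.1 hc,
          (biUnion_subset_biUnion_of_subset_left _ (mem_comps.1 hc).1).trans hγ.2⟩
    _ ≤ 2 ^ #F * Real.exp (#F * θ) := by
        refine mul_le_mul_of_nonneg_left ?_ (by positivity)
        exact (hardCore_le_exp conflict_symm polyWeight_nonneg P).trans (Real.exp_le_exp.2 hsum)
    _ = _ := by rw [mul_pow, ← Real.exp_nat_mul]

end Induction

section Parameters

lemma linear_le_two_pow {L : ℕ} (hL : 19 ≤ L) : 22256 + 16640 * L ≤ 2 ^ L := by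
  induction L, hL using Nat.le_induction with
  | base => norm_num
  | succ L _ ih => rw [pow_succ]; omega

lemma quartic_le_two_pow {q : ℕ} (hq : 64 ≤ q) : 16 * (48 * (q + 1)) ^ 4 ≤ 2 ^ q := by
  induction q, hq using Nat.le_induction with
  | base => norm_num
  | succ q hq ih =>
    rw [pow_succ 2]
    have h1 : (q + 1 + 1) ^ 4 ≤ 2 * (q + 1) ^ 4 := by
      obtain ⟨s, rfl⟩ := Nat.exists_eq_add_of_le hq
      ring_nf
      nlinarith [Nat.zero_le (s ^ 2), Nat.zero_le (s ^ 3), Nat.zero_le (s ^ 4), Nat.zero_le s]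
    rw [mul_pow] at ih ⊢
    calc 16 * (48 ^ 4 * (q + 1 + 1) ^ 4) ≤ 16 * (48 ^ 4 * (2 * (q + 1) ^ 4)) := by gcongr
      _ = (16 * (48 ^ 4 * (q + 1) ^ 4)) * 2 := by ring
      _ ≤ _ := by gcongr

/-- The parameters that make the container argument work at the levels between `n / 2` and `n`. -/
structure Params (n k p K : ℕ) : Prop where
  two_le : 2 ≤ n
  quartic : 16 * (n + 1) ^ 4 ≤ 2 ^ ((k + 1) / 24)
  sixteen_le : 16 ≤ p
  pow_le : p ^ 10 ≤ k + 1
  le_pow : k + 1 ≤ 2 * p ^ 10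
  seeds : 104 * K ≤ p
  walks : 64 * (n + 1) ^ 16 ≤ 2 ^ K

lemma exists_params : ∃ k₀ : ℕ, ∀ k ≥ k₀, ∀ n, k < n → n ≤ 2 * k → ∃ p K, Params n k p K := by
  refine ⟨(2 ^ 19) ^ 10, fun k hk n hkn hn => ?_⟩
  have hex : ∃ p, p ^ 10 ≤ k + 1 ∧ k + 1 < (p + 1) ^ 10 := by
    set p := Nat.findGreatest (fun p => p ^ 10 ≤ k + 1) (k + 1) with hp
    refine ⟨p, Nat.findGreatest_spec (P := fun p => p ^ 10 ≤ k + 1) (m := 0) (Nat.zero_le _)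
      (by simp), ?_⟩
    by_contra hcon
    push Not at hcon
    have h1 : p + 1 ≤ k + 1 := (Nat.le_self_pow (by norm_num) _).trans hcon
    have h2 : p + 1 ≤ p := Nat.le_findGreatest h1 hcon
    omega
  obtain ⟨p, hp1, hp2⟩ := hex
  have hp19 : 2 ^ 19 ≤ p := by
    have h1 : (2 ^ 19) ^ 10 < (p + 1) ^ 10 := by omega
    have := lt_of_pow_lt_pow_left₀ 10 (Nat.zero_le _) h1
    omega
  have hpp : (p + 1) ^ 10 ≤ 2 * p ^ 10 := by
    have h1 : 16 * (p + 1) ≤ 17 * p := by omega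
    have h2 : (16 * (p + 1)) ^ 10 ≤ (17 * p) ^ 10 := Nat.pow_le_pow_left h1 10
    rw [mul_pow, mul_pow] at h2
    have h3 : 17 ^ 10 * p ^ 10 ≤ 16 ^ 10 * (2 * p ^ 10) := by
      rw [← mul_assoc]
      exact Nat.mul_le_mul_right _ (by norm_num)
    exact Nat.le_of_mul_le_mul_left (h2.trans h3) (by positivity)
  set L := Nat.log 2 p with hL
  have hL1 : 2 ^ L ≤ p := Nat.pow_log_le_self 2 (by omega)
  have hL2 : p < 2 ^ (L + 1) := Nat.lt_pow_succ_log_self (by norm_num) p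
  have hL19 : 19 ≤ L := (Nat.le_log_iff_pow_le (by norm_num) (by omega)).2 hp19
  have hn1 : n + 1 ≤ 2 ^ (10 * L + 12) := by
    have h1 : p ^ 10 ≤ (2 ^ (L + 1)) ^ 10 := Nat.pow_le_pow_left hL2.le 10
    have h2 : 2 ^ (10 * L + 12) = 4 * (2 ^ (L + 1)) ^ 10 := by
      rw [← pow_mul, show (L + 1) * 10 = 10 * L + 10 by ring, pow_add _ _ 12, pow_add _ _ 10]
      norm_num
      ring
    omega
  refine ⟨p, 16 * (10 * L + 12) + 6, ?_, ?_, ?_, hp1, by omega, ?_, ?_⟩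
  · omega
  · set q := (k + 1) / 24 with hq
    have h2p : 2 ^ 11 ≤ k + 1 := by
      have : 2 ^ 11 ≤ (2 ^ 19) ^ 10 := by norm_num
      omega
    have hq64 : 64 ≤ q := by omega
    refine le_trans ?_ (quartic_le_two_pow hq64)
    have : n + 1 ≤ 48 * (q + 1) := by omega
    gcongr
  · omega
  · have := linear_le_two_pow hL19
    omega
  · rw [pow_add, mul_comm, pow_mul']
    refine Nat.mul_le_mul (Nat.pow_le_pow_left hn1 16) (by norm_num)

namespace Params

variable {n k p K : ℕ}

lemma exp_mul_half_pow_le (h : Params n k p K) (hkn : k < n) (hnk : n ≤ 2 * k) {t : ℕ}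
    (ht : (k + 1) ^ 3 ≤ 24 * t) :
    Real.exp (1 / (n : ℝ) ^ 2 * ((k + 1 : ℕ) * t)) * (1 / 2) ^ (t / (2 * p)) ≤
      (1 / 2) ^ (5 * n + 3) := by
  have hp := h.sixteen_le
  set s := t / (2 * p) with hs
  have hp2 : 2544 * p ≤ (k + 1) ^ 2 := by
    have h1 : (p ^ 10) ^ 2 ≤ (k + 1) ^ 2 := Nat.pow_le_pow_left h.pow_le 2
    have h2 : 16 ^ 19 ≤ p ^ 19 := Nat.pow_le_pow_left hp 19
    calc 2544 * p ≤ p ^ 19 * p := Nat.mul_le_mul_right _ (le_trans (by norm_num) h2)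
      _ = (p ^ 10) ^ 2 := by ring
      _ ≤ _ := h1
  have h8p : 8 * p ≤ k + 1 := by
    have h2 : 16 ^ 9 ≤ p ^ 9 := Nat.pow_le_pow_left hp 9
    calc 8 * p ≤ p ^ 9 * p := Nat.mul_le_mul_right _ (le_trans (by norm_num) h2)
      _ = p ^ 10 := by ring
      _ ≤ _ := h.pow_le
  have hs1 : 20 * n + 13 ≤ s := by
    rw [hs, Nat.le_div_iff_mul_le (by omega)]
    have h1 : (20 * n + 13) * (2 * p) ≤ 106 * p * (k + 1) := by
      have : 20 * n + 13 ≤ 53 * (k + 1) := by omega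
      calc _ ≤ (53 * (k + 1)) * (2 * p) := Nat.mul_le_mul_right _ this
        _ = _ := by ring
    have h2 : 24 * (106 * p * (k + 1)) ≤ 24 * t := by
      refine le_trans ?_ ht
      calc _ = 2544 * p * (k + 1) := by ring
        _ ≤ (k + 1) ^ 2 * (k + 1) := Nat.mul_le_mul_right _ hp2
        _ = _ := by ring
    omega
  have hs2 : t ≤ 2 * p * (s + 1) := by
    have := Nat.lt_mul_div_succ t (show 0 < 2 * p by omega)
    exact this.le
  have hexpo : 1 / (n : ℝ) ^ 2 * ((k + 1 : ℕ) * t) ≤ (s + 1) / 4 := by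
    have hn0 : (0 : ℝ) < n := by exact_mod_cast (by omega : 0 < n)
    rw [one_div, inv_mul_le_iff₀ (by positivity)]
    have h1 : ((4 * ((k + 1) * t) : ℕ) : ℝ) ≤ ((n ^ 2 * (s + 1) : ℕ) : ℝ) := by
      refine Nat.cast_le.2 ?_
      calc 4 * ((k + 1) * t) ≤ 4 * ((k + 1) * (2 * p * (s + 1))) := by gcongr
        _ = (k + 1) * (8 * p) * (s + 1) := by ring
        _ ≤ n * n * (s + 1) := by gcongr <;> omega
        _ = _ := by ring
    push_cast at h1 ⊢
    linarith
  have hhalf : (1 / 2 : ℝ) ≤ Real.exp (-(1 / 2)) := by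
    linarith [Real.add_one_le_exp (-(1 / 2) : ℝ)]
  have hone : Real.exp (-1) ≤ 1 / 2 := by
    rw [Real.exp_neg, one_div]
    exact inv_anti₀ (by norm_num) (by linarith [Real.add_one_le_exp (1 : ℝ)])
  calc _ ≤ Real.exp ((s + 1) / 4) * (Real.exp (-(1 / 2))) ^ s := by gcongr
    _ = Real.exp ((s + 1) / 4 + s * (-(1 / 2))) := by rw [← Real.exp_nat_mul, ← Real.exp_add]
    _ ≤ Real.exp ((5 * n + 3 : ℕ) * (-1)) := by
        rw [Real.exp_le_exp]
        have : (20 * n + 13 : ℝ) ≤ s := by exact_mod_cast hs1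
        push_cast
        linarith
    _ = (Real.exp (-1)) ^ (5 * n + 3) := by rw [← Real.exp_nat_mul]
    _ ≤ _ := by gcongr

lemma quartic_real (h : Params n k p K) :
    16 * ((n : ℝ) + 1) ^ 4 * (1 / 2) ^ ((k + 1) / 24) ≤ 1 := by
  have h1 : (16 : ℝ) * ((n : ℝ) + 1) ^ 4 ≤ 2 ^ ((k + 1) / 24) := by exact_mod_cast h.quartic
  calc _ ≤ (2 : ℝ) ^ ((k + 1) / 24) * (1 / 2) ^ ((k + 1) / 24) := by gcongr
    _ = 1 := by rw [← mul_pow]; norm_num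

lemma quartic_real' (h : Params n k p K) :
    16 * ((n : ℝ) + 1) ^ 4 * (1 / 2) ^ ((k + 1) / 4) ≤ 1 := by
  refine le_trans ?_ h.quartic_real
  refine mul_le_mul_of_nonneg_left ?_ (by positivity)
  exact pow_le_pow_of_le_one (by norm_num) (by norm_num) (by omega)

lemma two_mul_exp_le (h : Params n k p K) : 2 * Real.exp (1 / (n : ℝ) ^ 2) ≤ 4 := by
  have hn : (2 : ℝ) ≤ n := by exact_mod_cast h.two_le
  have h1 : 1 / (n : ℝ) ^ 2 ≤ 1 / 2 := by
    refine one_div_le_one_div_of_le (by norm_num) ?_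
    nlinarith
  have h2 := Real.add_one_le_exp (-(1 / (n : ℝ) ^ 2))
  have h3 : Real.exp (-(1 / (n : ℝ) ^ 2)) * Real.exp (1 / (n : ℝ) ^ 2) = 1 := by
    rw [← Real.exp_add]; simp
  nlinarith [Real.exp_pos (1 / (n : ℝ) ^ 2)]

lemma theta_le (h : Params n k p K) :
    (n : ℝ) * (2 * (4 * (1 / 2) ^ ((k + 1) / 4))) + (1 / 2) ^ (2 * n) ≤ 1 / (n : ℝ) ^ 2 := by
  have hn : (2 : ℝ) ≤ n := by exact_mod_cast h.two_le
  have h1 := h.quartic_real'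
  set y : ℝ := (1 / 2) ^ ((k + 1) / 4) with hy
  have hy0 : 0 ≤ y := by positivity
  rw [le_div_iff₀ (by positivity)]
  have h2 : (n : ℝ) * (2 * (4 * y)) * (n : ℝ) ^ 2 ≤ 1 / 2 := by
    have h3 : (n : ℝ) ^ 3 ≤ ((n : ℝ) + 1) ^ 4 := by
      calc (n : ℝ) ^ 3 ≤ ((n : ℝ) + 1) ^ 3 := by gcongr; linarith
        _ ≤ _ := pow_le_pow_right₀ (by linarith) (by norm_num)
    have h4 := mul_le_mul_of_nonneg_right h3 hy0
    nlinarith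
  have h5 : (1 / 2 : ℝ) ^ (2 * n) * (n : ℝ) ^ 2 ≤ 1 / 2 := by
    have h6 : 2 * n ^ 2 ≤ 2 ^ (2 * n) := by
      have : n + 1 ≤ 2 ^ n := Nat.lt_two_pow_self
      rw [mul_comm 2 n, pow_mul]
      have h7 := h.two_le
      calc 2 * n ^ 2 ≤ (n + 1) ^ 2 * 1 + n ^ 2 := by nlinarith
        _ ≤ (2 ^ n) ^ 2 := by
          obtain ⟨s, rfl⟩ := Nat.exists_eq_add_of_le h7
          have h8 : 2 ^ (2 + s) ≥ 2 * (2 + s) := by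
            rw [pow_add]
            have : s + 1 ≤ 2 ^ s := Nat.lt_two_pow_self
            omega
          nlinarith
    have h6' : (2 : ℝ) * (n : ℝ) ^ 2 ≤ 2 ^ (2 * n) := by exact_mod_cast h6
    have h9 : (1 / 2 : ℝ) ^ (2 * n) * 2 ^ (2 * n) = 1 := by rw [← mul_pow]; norm_num
    have h10 : (0 : ℝ) < (1 / 2) ^ (2 * n) := by positivity
    nlinarith
  linarith

end Params

end Parameters

section Levels

variable {n : ℕ}

lemma Params.sum_largePolymers_le {k p K : ℕ} (h : Params n k p K) (hkn : k < n)
    (hnk : n ≤ 2 * k)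
    (H : ∀ F ⊆ layer n (k + 1),
      (#(antichainsIn (k + 1) F) : ℝ) ≤ (2 * Real.exp (1 / (n : ℝ) ^ 2)) ^ #F) :
    ∑ c ∈ largePolymers n k, polyWeight (powersetCard k) c ≤ (1 / 2) ^ (2 * n) := by
  have h1 := sum_large_le (by positivity) hkn hnk h.sixteen_le h.pow_le h.le_pow h.seeds h.walks H
    (δ := (1 / 2) ^ (5 * n + 3)) (by positivity) fun t ht => h.exp_mul_half_pow_le hkn hnk ht
  refine h1.trans_eq ?_
  rw [show 5 * n + 3 = (3 * n + 3) + 2 * n by ring, pow_add _ (3 * n + 3), ← mul_assoc, ← mul_pow]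
  norm_num

lemma card_antichainsIn_le_of_params {k₀ : ℕ}
    (hk₀ : ∀ k ≥ k₀, ∀ n, k < n → n ≤ 2 * k → ∃ p K, Params n k p K) (d : ℕ) :
    ∀ k, k + d = n → k₀ ≤ k → n ≤ 2 * k → ∀ F ⊆ layer n k,
      (#(antichainsIn k F) : ℝ) ≤ (2 * Real.exp (1 / (n : ℝ) ^ 2)) ^ #F := by
  induction d with
  | zero =>
    intro k hk _ _ F hF
    refine card_antichainsIn_le (fun v _ => ?_) hF
    have : polymers n k = ∅ := by
      refine eq_empty_of_forall_notMem fun c hc => ?_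
      rw [mem_polymers, mem_antichainsFrom] at hc
      obtain ⟨A, hA⟩ := hc.2.1
      have h1 := hc.1.2 A hA
      have h2 := card_finset_fin_le A
      omega
    rw [this, filter_empty, sum_empty]
    positivity
  | succ d ih =>
    intro k hk hk0 hnk F hF
    have hkn : k < n := by omega
    obtain ⟨p, K, h⟩ := hk₀ k hk0 n hkn hnk
    have H := ih (k + 1) (by omega) (by omega) (by omega)
    refine card_antichainsIn_le (fun v hv => ?_) hF
    refine (sum_through_le h.two_mul_exp_le (by positivity) H ?_
      (h.sum_largePolymers_le hkn hnk H) hv).trans h.theta_le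
    refine le_trans ?_ h.quartic_real'
    push_cast
    have : (0 : ℝ) ≤ ((n : ℝ) + 1) ^ 4 * (1 / 2) ^ ((k + 1) / 4) := by positivity
    linarith

lemma sum_sdiff_large_le {k p K : ℕ} (h : Params n k p K)
    (H : ∀ F ⊆ layer n (k + 1),
      (#(antichainsIn (k + 1) F) : ℝ) ≤ (2 * Real.exp (1 / (n : ℝ) ^ 2)) ^ #F) :
    ∑ c ∈ {c ∈ polymers n k | 3 ≤ #(falling (k + 1) c)} \ largePolymers n k,
      polyWeight (powersetCard k) c ≤ (1 / 2) ^ (5 * k / 2) * 2 ^ n := by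
  set Q := {c ∈ polymers n k | 3 ≤ #(falling (k + 1) c)} \ largePolymers n k with hQ
  have hQsub : Q ⊆ polymers n k := sdiff_subset.trans (filter_subset _ _)
  set x : ℝ := 4 * (1 / 2) ^ ((k + 1) / 24) with hx
  have hx0 : 0 ≤ x := by positivity
  have hq := h.quartic_real
  have hn1 : (1 : ℝ) ≤ ((n : ℝ) + 1) ^ 4 := one_le_pow₀ (by linarith [n.cast_nonneg (α := ℝ)])
  have hx1 : 2 * x ≤ 1 := by
    have : 16 * 1 * (1 / 2 : ℝ) ^ ((k + 1) / 24) ≤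
        16 * ((n : ℝ) + 1) ^ 4 * (1 / 2) ^ ((k + 1) / 24) := by gcongr
    rw [hx]
    have h0 : (0 : ℝ) ≤ (1 / 2) ^ ((k + 1) / 24) := by positivity
    linarith
  refine (sum_polyWeight_le_sum_falling H hQsub).trans ?_
  calc _ ≤ ∑ D ∈ Q.image (falling (k + 1)), (1 / 2) ^ (5 * k / 2) * x ^ #D :=
        sum_le_sum fun D hD => by
          obtain ⟨c, hc, rfl⟩ := mem_image.1 hD
          have hc' := Finset.mem_sdiff.1 hc
          have h2 := div_four_mul_le (hQsub hc) hc'.2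
          have h3 := three_mul_le_shadow (falling_subset_layer (k + 1) c) (mem_filter.1 hc'.1).2
          have h4 : 5 * k / 2 + (k + 1) / 24 * #(falling (k + 1) c) ≤
              #(shadow (falling (k + 1) c)) := by
            have h5 := Nat.mul_le_mul_right (#(falling (k + 1) c)) (Nat.div_mul_le_self (k + 1) 24)
            have h6 : (k + 1) / 24 * 24 * #(falling (k + 1) c) =
              24 * ((k + 1) / 24 * #(falling (k + 1) c)) := by ring
            omega
          calc _ ≤ (4 : ℝ) ^ #(falling (k + 1) c) *
                (1 / 2) ^ (5 * k / 2 + (k + 1) / 24 * #(falling (k + 1) c)) := by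
                refine mul_le_mul (pow_le_pow_left₀ (by positivity) h.two_mul_exp_le _)
                  (pow_le_pow_of_le_one (by norm_num) (by norm_num) h4) (by positivity)
                  (by positivity)
            _ = _ := by rw [hx, mul_pow, pow_add, pow_mul]; ring
    _ = (1 / 2) ^ (5 * k / 2) * ∑ D ∈ Q.image (falling (k + 1)), x ^ #D := by rw [mul_sum]
    _ ≤ (1 / 2) ^ (5 * k / 2) * (2 ^ n * (2 * x)) := by
        gcongr
        refine sum_linked_univ_le (j := 2) hx0 ?_ _ fun D hD => ?_
        · refine le_trans (le_of_eq ?_) (hq.trans' (?_ : 8 * ((n : ℝ) + 1) ^ 4 *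
            (1 / 2) ^ ((k + 1) / 24) ≤ _))
          · rw [hx]; push_cast; ring
          · gcongr; norm_num
        · obtain ⟨c, hc, rfl⟩ := mem_image.1 hD
          refine (linked_falling_of_mem_polymers (hQsub hc)).mono fun A hA B hB hAB => ?_
          exact hdist_le_two_of_touch (falling_subset_layer _ _ hA) (falling_subset_layer _ _ hB)
            hAB
    _ ≤ (1 / 2) ^ (5 * k / 2) * (2 ^ n * 1) := by gcongr
    _ = _ := by ring

lemma exists_sum_three_le_le : ∃ k₀ : ℕ, ∀ k ≥ k₀,
    ∑ c ∈ polymers (2 * k) k with 3 ≤ #(falling (k + 1) c), polyWeight (powersetCard k) c ≤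
      2 * (1 / 2) ^ (k / 2) := by
  obtain ⟨k₀, hk₀⟩ := exists_params
  refine ⟨k₀ + 1, fun k hk => ?_⟩
  obtain ⟨p, K, h⟩ := hk₀ k (by omega) (2 * k) (by omega) le_rfl
  have H := card_antichainsIn_le_of_params hk₀ (n := 2 * k) (k - 1) (k + 1) (by omega) (by omega)
    (by omega)
  have h1 := h.sum_largePolymers_le (by omega) le_rfl H
  have h2 := sum_sdiff_large_le h H
  set Q := {c ∈ polymers (2 * k) k | 3 ≤ #(falling (k + 1) c)}
  have h3 : ∑ c ∈ Q, polyWeight (powersetCard k) c ≤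
      ∑ c ∈ Q \ largePolymers (2 * k) k, polyWeight (powersetCard k) c +
        ∑ c ∈ largePolymers (2 * k) k, polyWeight (powersetCard k) c := by
    rw [← sum_union sdiff_disjoint]
    refine sum_le_sum_of_subset_of_nonneg ?_ fun c _ _ => polyWeight_nonneg c
    rw [sdiff_union_self_eq_union]
    exact subset_union_left
  have h4 : (1 / 2 : ℝ) ^ (5 * k / 2) * 2 ^ (2 * k) = (1 / 2) ^ (k / 2) := by
    rw [show 5 * k / 2 = k / 2 + 2 * k by omega, pow_add, mul_assoc, ← mul_pow]
    norm_num
  have h5 : (1 / 2 : ℝ) ^ (2 * (2 * k)) ≤ (1 / 2) ^ (k / 2) :=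
    pow_le_pow_of_le_one (by norm_num) (by norm_num) (by omega)
  linarith

end Levels

section Middle

variable {n m : ℕ}

/-- The sets of size `m` comparable to `A`. -/
def middle (m : ℕ) (A : Finset (Fin n)) : Finset (Finset (Fin n)) :=
  {B ∈ layer n m | B ⊆ A ∨ A ⊆ B}

lemma mem_middle {A B : Finset (Fin n)} : B ∈ middle m A ↔ #B = m ∧ (B ⊆ A ∨ A ⊆ B) := by
  simp [middle, mem_powersetCard]

open Classical in
/-- The antichains that avoid the layer of size `m`. -/
noncomputable def offAntichains (n m : ℕ) : Finset (Finset (Finset (Fin n))) :=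
  {γ | IsAntichain (· ⊆ ·) (γ : Set (Finset (Fin n))) ∧ ∀ A ∈ γ, #A ≠ m}

lemma mem_offAntichains {γ : Finset (Finset (Fin n))} : γ ∈ offAntichains n m ↔
    IsAntichain (· ⊆ ·) (γ : Set (Finset (Fin n))) ∧ ∀ A ∈ γ, #A ≠ m := by
  simp [offAntichains]

lemma isAntichain_union_iff {γ T : Finset (Finset (Fin n))} (hγ : γ ∈ offAntichains n m)
    (hT : T ⊆ layer n m) :
    IsAntichain (· ⊆ ·) ((γ ∪ T : Finset (Finset (Fin n))) : Set (Finset (Fin n))) ↔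
      T ⊆ layer n m \ γ.biUnion (middle m) := by
  rw [mem_offAntichains] at hγ
  constructor
  · intro h B hB
    have hBm := (mem_powersetCard.1 (hT hB)).2
    rw [Finset.mem_sdiff]
    refine ⟨hT hB, fun hcon => ?_⟩
    obtain ⟨A, hA, hAB⟩ := mem_biUnion.1 hcon
    have hne : A ≠ B := fun e => hγ.2 A hA (e ▸ hBm)
    have hA' : A ∈ ((γ ∪ T : Finset (Finset (Fin n))) : Set (Finset (Fin n))) := by simp [hA]
    have hB' : B ∈ ((γ ∪ T : Finset (Finset (Fin n))) : Set (Finset (Fin n))) := by simp [hB]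
    rcases (mem_middle.1 hAB).2 with h1 | h1
    · exact h hB' hA' hne.symm h1
    · exact h hA' hB' hne h1
  · intro h A hA B hB hne hAB
    rw [mem_coe, mem_union] at hA hB
    have key : ∀ A ∈ γ, ∀ B ∈ T, ¬ (B ⊆ A ∨ A ⊆ B) := fun A hA B hB hcon =>
      (Finset.mem_sdiff.1 (h hB)).2
        (mem_biUnion.2 ⟨A, hA, mem_middle.2 ⟨(mem_powersetCard.1 (hT hB)).2, hcon⟩⟩)
    rcases hA with hA | hA <;> rcases hB with hB | hB
    · exact hγ.1 hA hB hne hAB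
    · exact key A hA B hB (Or.inr hAB)
    · exact key B hB A hA (Or.inl hAB)
    · have h1 := (mem_powersetCard.1 (hT hA)).2
      have h2 := (mem_powersetCard.1 (hT hB)).2
      exact hne (eq_of_subset_of_card_le hAB (by omega))

lemma card_antichains_eq (n m : ℕ) :
    (Nat.card {A : Finset (Finset (Fin n)) // IsAntichain (· ⊆ ·) (A : Set (Finset (Fin n)))} : ℝ) =
      2 ^ n.choose m * ∑ γ ∈ offAntichains n m, polyWeight (middle m) γ := by
  classical
  have h0 : Nat.card {A : Finset (Finset (Fin n)) //
      IsAntichain (· ⊆ ·) (A : Set (Finset (Fin n)))} =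
      #{A : Finset (Finset (Fin n)) | IsAntichain (· ⊆ ·) (A : Set (Finset (Fin n)))} := by
    rw [Nat.card_eq_fintype_card, Fintype.card_subtype]
  rw [h0, card_eq_sum_card_fiberwise (t := offAntichains n m)
    (f := fun γ => γ.filter fun A => #A ≠ m), mul_sum]
  · push_cast
    refine sum_congr rfl fun γ hγ => ?_
    have hsub : γ.biUnion (middle m) ⊆ layer n m :=
      biUnion_subset.2 fun A _ => filter_subset _ _
    have hγ' := mem_offAntichains.1 hγ
    have hlay : ∀ 𝒜 : Finset (Finset (Fin n)), (𝒜.filter fun A => #A = m) ⊆ layer n m :=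
      fun 𝒜 A hA => mem_powersetCard.2 ⟨subset_univ _, (mem_filter.1 hA).2⟩
    have hsplit : ∀ 𝒜 : Finset (Finset (Fin n)), 𝒜.filter (fun A => #A ≠ m) = γ →
        γ ∪ 𝒜.filter (fun A => #A = m) = 𝒜 := by
      rintro 𝒜 rfl
      ext A
      simp only [mem_union, mem_filter]
      tauto
    have hcard : #{𝒜 ∈ ({A : Finset (Finset (Fin n)) |
        IsAntichain (· ⊆ ·) (A : Set (Finset (Fin n)))} : Finset _) |
          𝒜.filter (fun A => #A ≠ m) = γ} = #(layer n m \ γ.biUnion (middle m)).powerset := by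
      refine card_nbij' (fun 𝒜 => 𝒜.filter fun A => #A = m) (fun T => γ ∪ T) ?_ ?_ ?_ ?_
      · intro 𝒜 h𝒜
        rw [mem_coe, mem_filter, mem_filter_univ] at h𝒜
        rw [mem_coe, mem_powerset, ← isAntichain_union_iff hγ (hlay 𝒜), hsplit 𝒜 h𝒜.2]
        exact h𝒜.1
      · intro T hT
        rw [mem_coe, mem_powerset] at hT
        have hTl := hT.trans sdiff_subset
        rw [mem_coe, mem_filter, mem_filter_univ]
        refine ⟨(isAntichain_union_iff hγ hTl).2 hT, ?_⟩
        rw [filter_union, filter_true_of_mem hγ'.2, filter_false_of_mem, union_empty]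
        exact fun A hA => not_not.2 (mem_powersetCard.1 (hTl hA)).2
      · intro 𝒜 h𝒜
        exact hsplit 𝒜 (mem_filter.1 h𝒜).2
      · intro T hT
        rw [mem_coe, mem_powerset] at hT
        have hTl := hT.trans sdiff_subset
        change (γ ∪ T).filter (fun A => #A = m) = T
        rw [filter_union, filter_false_of_mem hγ'.2, empty_union, filter_true_of_mem]
        exact fun A hA => (mem_powersetCard.1 (hTl hA)).2
    have hN : #(layer n m) = n.choose m := by simp
    have hle := card_le_card hsub
    rw [hcard, card_powerset, card_sdiff_of_subset hsub, ← hN, polyWeight]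
    push_cast
    rw [pow_sub₀ _ two_ne_zero hle, one_div, inv_pow]
  · intro 𝒜 h𝒜
    rw [mem_coe, mem_filter_univ] at h𝒜
    rw [mem_coe, mem_offAntichains]
    exact ⟨h𝒜.subset (by exact_mod_cast filter_subset _ _), fun A hA => (mem_filter.1 hA).2⟩

open Classical in
/-- The connected antichains that avoid the layer of size `m`. -/
noncomputable def offPolymers (n m : ℕ) : Finset (Finset (Finset (Fin n))) :=
  {c ∈ offAntichains n m | Linked (Touch (middle m)) c}

lemma mem_offPolymers {c : Finset (Finset (Fin n))} : c ∈ offPolymers n m ↔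
    c ∈ offAntichains n m ∧ Linked (Touch (middle m)) c := by
  simp [offPolymers]

/-- Comparable sets are comparable to a common set of size `m`. -/
lemma touch_middle_of_subset (hm : m ≤ n) {A B : Finset (Fin n)} (h : A ⊆ B) :
    Touch (middle m) A B := by
  unfold Touch
  rw [not_disjoint_iff]
  rcases le_total (#A) m with h1 | h1
  · rcases le_total m (#B) with h2 | h2
    · obtain ⟨C, hAC, hCB, hC⟩ := exists_subsuperset_card_eq h h1 h2
      exact ⟨C, mem_middle.2 ⟨hC, Or.inr hAC⟩, mem_middle.2 ⟨hC, Or.inl hCB⟩⟩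
    · obtain ⟨C, hBC, -, hC⟩ := exists_subsuperset_card_eq (subset_univ B) h2 (by simpa using hm)
      exact ⟨C, mem_middle.2 ⟨hC, Or.inr (h.trans hBC)⟩, mem_middle.2 ⟨hC, Or.inr hBC⟩⟩
  · obtain ⟨C, hCA, hC⟩ := exists_subset_card_eq h1
    exact ⟨C, mem_middle.2 ⟨hC, Or.inl hCA⟩, mem_middle.2 ⟨hC, Or.inl (hCA.trans h)⟩⟩

lemma sum_offAntichains_eq (hm : m ≤ n) : ∑ γ ∈ offAntichains n m, polyWeight (middle m) γ =
    hardCore (Conflict (middle m)) (polyWeight (middle m)) (offPolymers n m) := by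
  refine le_antisymm (sum_polyWeight_le_hardCore _ _ fun γ hγ c hc => ?_)
    (hardCore_le_sum_polyWeight _ _ (fun c hc => (mem_offPolymers.1 hc).2) fun Γ hΓ hpw => ?_)
  · rw [mem_comps] at hc
    rw [mem_offAntichains] at hγ
    rw [mem_offPolymers, mem_offAntichains]
    exact ⟨⟨hγ.1.subset (by exact_mod_cast hc.1), fun A hA => hγ.2 A (hc.1 hA)⟩, hc.2.1⟩
  · have hoff : ∀ c ∈ Γ, c ∈ offAntichains n m := fun c hc => (mem_offPolymers.1 (hΓ hc)).1
    rw [mem_offAntichains]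
    refine ⟨fun A hA B hB hne hAB => ?_, fun A hA => ?_⟩
    · rw [mem_coe, mem_biUnion] at hA hB
      obtain ⟨c, hc, hAc⟩ := hA
      obtain ⟨d, hd, hBd⟩ := hB
      rcases eq_or_ne c d with rfl | hcd
      · exact (mem_offAntichains.1 (hoff c hc)).1 hAc hBd hne hAB
      · have h1 := touch_middle_of_subset hm hAB
        refine hpw hc hd hcd ⟨hcd, fun hdis => h1 ?_⟩
        exact hdis.mono (subset_biUnion_of_mem (middle m) hAc)
          (subset_biUnion_of_mem (middle m) hBd)
    · obtain ⟨c, hc, hAc⟩ := mem_biUnion.1 hA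
      exact (mem_offAntichains.1 (hoff c hc)).2 A hAc

lemma middle_eq_powersetCard {A : Finset (Fin n)} (hA : m ≤ #A) :
    middle m A = powersetCard m A := by
  ext B
  rw [mem_middle, mem_powersetCard]
  constructor
  · rintro ⟨hB, h | h⟩
    · exact ⟨h, hB⟩
    · exact ⟨(eq_of_subset_of_card_le h (by omega)).symm.subset, hB⟩
  · exact fun h => ⟨h.2, Or.inl h.1⟩

lemma biUnion_middle_eq {c : Finset (Finset (Fin n))} (hc : ∀ A ∈ c, m ≤ #A) :
    c.biUnion (middle m) = c.biUnion (powersetCard m) :=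
  biUnion_congr rfl fun A hA => middle_eq_powersetCard (hc A hA)

lemma middle_compl (A : Finset (Fin (2 * m))) : middle m Aᶜ = (middle m A).image compl := by
  ext B
  simp only [mem_image, mem_middle]
  constructor
  · intro h
    refine ⟨Bᶜ, ⟨?_, ?_⟩, compl_compl B⟩
    · rw [card_compl, h.1, Fintype.card_fin]; omega
    · rcases h.2 with h' | h'
      · exact Or.inr (by rwa [← compl_subset_compl, compl_compl])
      · exact Or.inl (by rwa [← compl_subset_compl, compl_compl])
  · rintro ⟨C, ⟨hC, h⟩, rfl⟩
    refine ⟨?_, ?_⟩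
    · rw [card_compl, hC, Fintype.card_fin]; omega
    · rcases h with h' | h'
      · exact Or.inr (compl_subset_compl.2 h')
      · exact Or.inl (compl_subset_compl.2 h')

lemma touch_middle_compl {A B : Finset (Fin (2 * m))} :
    Touch (middle m) Aᶜ Bᶜ ↔ Touch (middle m) A B := by
  unfold Touch
  rw [middle_compl, middle_compl, disjoint_image compl_injective]

/-- The family of complements of the members of `c`. -/
def complFamily (c : Finset (Finset (Fin n))) : Finset (Finset (Fin n)) := c.image compl

lemma mem_complFamily {c : Finset (Finset (Fin n))} {A : Finset (Fin n)} :
    A ∈ complFamily c ↔ Aᶜ ∈ c := by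
  simp only [complFamily, mem_image]
  exact ⟨by rintro ⟨B, hB, rfl⟩; rwa [compl_compl], fun h => ⟨_, h, compl_compl A⟩⟩

lemma complFamily_complFamily (c : Finset (Finset (Fin n))) : complFamily (complFamily c) = c := by
  ext A
  rw [mem_complFamily, mem_complFamily, compl_compl]

lemma complFamily_injective : Function.Injective (complFamily (n := n)) :=
  Function.LeftInverse.injective complFamily_complFamily

lemma polyWeight_complFamily (c : Finset (Finset (Fin (2 * m)))) :
    polyWeight (middle m) (complFamily c) = polyWeight (middle m) c := by
  have : (complFamily c).biUnion (middle m) = (c.biUnion (middle m)).image compl := by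
    rw [complFamily, image_biUnion, biUnion_image]
    exact biUnion_congr rfl fun A _ => middle_compl A
  rw [polyWeight, this, card_image_of_injective _ compl_injective, polyWeight]

lemma complFamily_mem_offPolymers {c : Finset (Finset (Fin (2 * m)))}
    (hc : c ∈ offPolymers (2 * m) m) : complFamily c ∈ offPolymers (2 * m) m := by
  rw [mem_offPolymers, mem_offAntichains] at hc ⊢
  refine ⟨⟨fun A hA B hB hne hAB => ?_, fun A hA => ?_⟩, ?_, fun P hP hPne hPc => ?_⟩
  · rw [mem_coe, mem_complFamily] at hA hB
    exact hc.1.1 hB hA (fun h => hne (compl_injective h).symm) (compl_subset_compl.2 hAB)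
  · have h1 := hc.1.2 _ (mem_complFamily.1 hA)
    have h2 := card_finset_fin_le A
    rw [card_compl, Fintype.card_fin] at h1
    omega
  · exact hc.2.1.image _
  · obtain ⟨A, hA, B, hB, hAB⟩ := hc.2.2 (complFamily P)
      (fun A hA => by
        have := hP (mem_complFamily.1 hA)
        rwa [mem_complFamily, compl_compl] at this)
      (hPne.image _) (fun h => hPc (by rw [← h, complFamily_complFamily]))
    rw [Finset.mem_sdiff, mem_complFamily] at hB
    rw [mem_complFamily] at hA
    refine ⟨Aᶜ, hA, Bᶜ, ?_, touch_middle_compl.2 hAB⟩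
    rw [Finset.mem_sdiff, mem_complFamily, compl_compl]
    exact hB

lemma mem_offPolymers_of_mem_polymers {c : Finset (Finset (Fin n))} (hc : c ∈ polymers n m) :
    c ∈ offPolymers n m := by
  rw [mem_polymers, mem_antichainsFrom] at hc
  rw [mem_offPolymers, mem_offAntichains]
  refine ⟨⟨hc.1.1, fun A hA => ?_⟩, hc.2.mono fun A hA B hB hAB => ?_⟩
  · have := hc.1.2 A hA; omega
  · have h1 := hc.1.2 A hA
    have h2 := hc.1.2 B hB
    unfold Touch at hAB ⊢
    rwa [middle_eq_powersetCard (by omega), middle_eq_powersetCard (by omega)]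

lemma offPolymers_eq (m : ℕ) :
    offPolymers (2 * m) m = polymers (2 * m) m ∪ (polymers (2 * m) m).image complFamily := by
  have hup : ∀ c ∈ offPolymers (2 * m) m, (∃ A ∈ c, m < #A) → c ∈ polymers (2 * m) m := by
    intro c hc hex
    have hc' := hc
    rw [mem_offPolymers, mem_offAntichains] at hc'
    have hall : ∀ A ∈ c, m + 1 ≤ #A := by
      by_contra hcon
      push Not at hcon
      obtain ⟨B, hB, hBm⟩ := hcon
      obtain ⟨A, hA, hAm⟩ := hex
      obtain ⟨A, hA, B, hB, hAB⟩ := hc'.2.2 (c.filter fun A => m < #A) (filter_subset _ _)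
        ⟨A, mem_filter.2 ⟨hA, hAm⟩⟩ (fun h => by
          have := (mem_filter.1 (h.symm ▸ hB : B ∈ c.filter fun A => m < #A)).2
          omega)
      rw [Finset.mem_sdiff, mem_filter] at hB
      rw [mem_filter] at hA
      have hBm : #B < m := by
        have h1 := hc'.1.2 B hB.1
        have h2 : ¬ m < #B := fun h => hB.2 ⟨hB.1, h⟩
        omega
      obtain ⟨C, hCA, hCB⟩ := not_disjoint_iff.1 hAB
      rw [mem_middle] at hCA hCB
      have h1 : C ⊆ A := hCA.2.resolve_right fun h => by
        have := card_le_card h; omega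
      have h2 : B ⊆ C := hCB.2.resolve_left fun h => by
        have := card_le_card h; omega
      exact hc'.1.1 hB.1 hA.1 (fun e => by rw [e] at hBm; omega) (h2.trans h1)
    rw [mem_polymers, mem_antichainsFrom]
    refine ⟨⟨hc'.1.1, hall⟩, hc'.2.mono fun A hA B hB hAB => ?_⟩
    have h1 := hall A hA
    have h2 := hall B hB
    unfold Touch at hAB ⊢
    rwa [middle_eq_powersetCard (by omega), middle_eq_powersetCard (by omega)] at hAB
  ext c
  rw [mem_union, mem_image]
  constructor
  · intro hc
    have hc' := hc
    rw [mem_offPolymers, mem_offAntichains] at hc'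
    obtain ⟨A, hA⟩ := hc'.2.1
    rcases lt_or_gt_of_ne (hc'.1.2 A hA) with h | h
    · refine Or.inr ⟨complFamily c, hup _ (complFamily_mem_offPolymers hc)
        ⟨Aᶜ, by rwa [mem_complFamily, compl_compl], ?_⟩, complFamily_complFamily c⟩
      rw [card_compl, Fintype.card_fin]; omega
    · exact Or.inl (hup c hc ⟨A, hA, h⟩)
  · rintro (hc | ⟨d, hd, rfl⟩)
    · exact mem_offPolymers_of_mem_polymers hc
    · exact complFamily_mem_offPolymers (mem_offPolymers_of_mem_polymers hd)

lemma polyWeight_middle_of_mem_polymers {c : Finset (Finset (Fin n))} (hc : c ∈ polymers n m) :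
    polyWeight (middle m) c = polyWeight (powersetCard m) c := by
  rw [mem_polymers, mem_antichainsFrom] at hc
  rw [polyWeight, biUnion_middle_eq fun A hA => (Nat.le_succ m).trans (hc.1.2 A hA), polyWeight]

end Middle

section Neighbours

variable {m : ℕ}

/-- The two layers next to the middle layer. -/
def near (m : ℕ) : Finset (Finset (Fin (2 * m))) := layer (2 * m) (m + 1) ∪ layer (2 * m) (m - 1)

lemma mem_near {A : Finset (Fin (2 * m))} : A ∈ near m ↔ #A = m + 1 ∨ #A = m - 1 := by
  simp [near, mem_powersetCard]

lemma disjoint_layer_layer : Disjoint (layer (2 * m) (m + 1)) (layer (2 * m) (m - 1)) := by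
  rw [disjoint_left]
  intro A hA hA'
  have h1 := (mem_powersetCard.1 hA).2
  have h2 := (mem_powersetCard.1 hA').2
  omega

lemma card_near (hm : 1 ≤ m) : #(near m) = 2 * (2 * m).choose (m + 1) := by
  rw [near, card_union_of_disjoint disjoint_layer_layer, card_powersetCard, card_powersetCard,
    card_univ, Fintype.card_fin,
    Nat.choose_symm_of_eq_add (show 2 * m = (m - 1) + (m + 1) by omega)]
  ring

lemma compl_mem_near (hm : 1 ≤ m) {A : Finset (Fin (2 * m))} : Aᶜ ∈ near m ↔ A ∈ near m := by
  rw [mem_near, mem_near, card_compl, Fintype.card_fin]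
  have := card_finset_fin_le A
  omega

open Classical in
lemma card_touch_up {A : Finset (Fin (2 * m))} (hA : #A = m + 1) :
    #{B ∈ layer (2 * m) (m + 1) | A ≠ B ∧ Touch (middle m) A B} = (m + 1) * (m - 1) := by
  have hAc : #Aᶜ = m - 1 := by rw [card_compl, hA, Fintype.card_fin]; omega
  rw [← hAc, ← hA, ← card_product]
  symm
  refine card_bij (fun p _ => insert p.2 (A.erase p.1)) ?_ ?_ ?_
  · rintro ⟨x, y⟩ hxy
    rw [mem_product, mem_compl] at hxy
    have hy : y ∉ A.erase x := fun h => hxy.2 (mem_of_mem_erase h)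
    have hc : #(A.erase x) = m := by rw [card_erase_of_mem hxy.1, hA]; omega
    rw [mem_filter, mem_powersetCard]
    refine ⟨⟨subset_univ _, by rw [card_insert_of_notMem hy, hc]; omega⟩, fun h => hxy.2 ?_, ?_⟩
    · rw [h]; exact mem_insert_self _ _
    · exact not_disjoint_iff.2 ⟨A.erase x, mem_middle.2 ⟨hc, Or.inl (erase_subset _ _)⟩,
        mem_middle.2 ⟨hc, Or.inl (subset_insert _ _)⟩⟩
  · rintro ⟨x, y⟩ hxy ⟨x', y'⟩ hxy' h
    rw [mem_product, mem_compl] at hxy hxy'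
    simp only at h hxy hxy'
    have h1 : y ∈ insert y' (A.erase x') := h ▸ mem_insert_self _ _
    have hy : y = y' := (mem_insert.1 h1).resolve_right fun h => hxy.2 (mem_of_mem_erase h)
    have h2 : x ∉ insert y' (A.erase x') := by
      rw [← h, mem_insert, not_or]
      exact ⟨fun e => hxy.2 (e ▸ hxy.1), notMem_erase _ _⟩
    have hx : x = x' := by
      by_contra hne
      exact h2 (mem_insert_of_mem (mem_erase.2 ⟨hne, hxy.1⟩))
    rw [hx, hy]
  · intro B hB
    rw [mem_filter, mem_powersetCard, hA] at hB
    obtain ⟨⟨-, hBc⟩, hne, ht⟩ := hB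
    obtain ⟨C, hCA, hCB⟩ := not_disjoint_iff.1 ht
    rw [middle_eq_powersetCard (by omega), mem_powersetCard] at hCA hCB
    obtain ⟨x, hx⟩ : (A \ C).Nonempty := by
      rw [← card_pos, card_sdiff_of_subset hCA.1]; omega
    obtain ⟨y, hy⟩ : (B \ C).Nonempty := by
      rw [← card_pos, card_sdiff_of_subset hCB.1]; omega
    rw [Finset.mem_sdiff] at hx hy
    have e1 : C = A.erase x := eq_of_subset_of_card_le (subset_erase.2 ⟨hCA.1, hx.2⟩)
      (by rw [card_erase_of_mem hx.1]; omega)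
    have e2 : insert y C = B := eq_of_subset_of_card_le (insert_subset hy.1 hCB.1)
      (by rw [card_insert_of_notMem hy.2]; omega)
    have hyA : y ∉ A := fun h => hne (by
      rw [← e2]
      exact (eq_of_subset_of_card_le (insert_subset h hCA.1)
        (by rw [card_insert_of_notMem hy.2]; omega)).symm)
    exact ⟨(x, y), mem_product.2 ⟨hx.1, mem_compl.2 hyA⟩, by rw [← e2, e1]⟩

open Classical in
lemma card_touch_down (hm : 1 ≤ m) {A : Finset (Fin (2 * m))} (hA : #A = m + 1) :
    #{B ∈ layer (2 * m) (m - 1) | A ≠ B ∧ Touch (middle m) A B} = (m + 1).choose 2 := by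
  have : {B ∈ layer (2 * m) (m - 1) | A ≠ B ∧ Touch (middle m) A B} = powersetCard (m - 1) A := by
    ext B
    rw [mem_filter, mem_powersetCard, mem_powersetCard]
    constructor
    · rintro ⟨⟨-, hB⟩, -, ht⟩
      obtain ⟨C, hCA, hCB⟩ := not_disjoint_iff.1 ht
      rw [mem_middle] at hCA hCB
      have h1 : C ⊆ A := hCA.2.resolve_right fun h => by
        have := card_le_card h; omega
      have h2 : B ⊆ C := hCB.2.resolve_left fun h => by
        have := card_le_card h; omega
      exact ⟨h2.trans h1, hB⟩
    · rintro ⟨h, hB⟩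
      exact ⟨⟨subset_univ _, hB⟩, fun e => by rw [e] at hA; omega,
        touch_symm _ _ (touch_middle_of_subset (by omega) h)⟩
  rw [this, card_powersetCard, hA,
    Nat.choose_symm_of_eq_add (show m + 1 = (m - 1) + 2 by omega)]

open Classical in
lemma card_touch_near (hm : 1 ≤ m) {A : Finset (Fin (2 * m))} (hA : A ∈ near m) :
    #{B ∈ near m | A ≠ B ∧ Touch (middle m) A B} = (m + 1) * (m - 1) + (m + 1).choose 2 := by
  have hup : ∀ A : Finset (Fin (2 * m)), #A = m + 1 →
      #{B ∈ near m | A ≠ B ∧ Touch (middle m) A B} = (m + 1) * (m - 1) + (m + 1).choose 2 := by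
    intro A hA
    rw [near, filter_union, card_union_of_disjoint
      (disjoint_filter_filter disjoint_layer_layer), card_touch_up hA, card_touch_down hm hA]
  rcases mem_near.1 hA with h | h
  · exact hup A h
  · have h1 : #Aᶜ = m + 1 := by rw [card_compl, h, Fintype.card_fin]; omega
    rw [← hup Aᶜ h1]
    refine card_nbij' compl compl ?_ ?_ (fun B _ => compl_compl B) (fun B _ => compl_compl B)
    · intro B hB
      rw [mem_coe, mem_filter] at hB ⊢
      exact ⟨(compl_mem_near hm).2 hB.1, fun e => hB.2.1 (compl_injective e),
        touch_middle_compl.2 hB.2.2⟩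
    · intro B hB
      rw [mem_coe, mem_filter] at hB ⊢
      refine ⟨(compl_mem_near hm).2 hB.1, fun e => hB.2.1 (by rw [e, compl_compl]), ?_⟩
      rw [← touch_middle_compl, compl_compl]
      exact hB.2.2

end Neighbours

section SmallPolymers

variable {m : ℕ}

/-- The polymers with a single member. -/
def singles (m : ℕ) : Finset (Finset (Finset (Fin (2 * m)))) := (near m).image singleton

lemma mem_singles {c : Finset (Finset (Fin (2 * m)))} :
    c ∈ singles m ↔ ∃ A ∈ near m, {A} = c := by
  simp [singles]

lemma card_singles (hm : 1 ≤ m) : #(singles m) = 2 * (2 * m).choose (m + 1) := by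
  rw [singles, card_image_of_injective _ singleton_injective, card_near hm]

/-- The upper polymers with two members. -/
noncomputable def upperPairs (m : ℕ) : Finset (Finset (Finset (Fin (2 * m)))) :=
  {c ∈ polymers (2 * m) m | c ⊆ layer (2 * m) (m + 1) ∧ #c = 2}

/-- The polymers with two members. -/
noncomputable def pairs (m : ℕ) : Finset (Finset (Finset (Fin (2 * m)))) :=
  upperPairs m ∪ (upperPairs m).image complFamily

lemma linked_singleton {V : Type*} [DecidableEq V] (R : V → V → Prop) (a : V) :
    Linked R {a} := by
  refine ⟨singleton_nonempty a, fun P hP hne hPa => ?_⟩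
  rcases subset_singleton_iff.1 hP with h | h
  · exact absurd h hne.ne_empty
  · exact absurd h hPa

lemma card_middle_of_mem_near (hm : 1 ≤ m) {A : Finset (Fin (2 * m))} (hA : A ∈ near m) :
    #(middle m A) = m + 1 := by
  have hup : ∀ A : Finset (Fin (2 * m)), #A = m + 1 → #(middle m A) = m + 1 := by
    intro A hA
    rw [middle_eq_powersetCard (by omega), card_powersetCard, hA, Nat.choose_succ_self_right]
  rcases mem_near.1 hA with h | h
  · exact hup A h
  · rw [← card_image_of_injective _ compl_injective, ← middle_compl]
    exact hup _ (by rw [card_compl, h, Fintype.card_fin]; omega)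

lemma polyWeight_of_mem_singles (hm : 1 ≤ m) {c : Finset (Finset (Fin (2 * m)))}
    (hc : c ∈ singles m) : polyWeight (middle m) c = (1 / 2) ^ (m + 1) := by
  obtain ⟨A, hA, rfl⟩ := mem_singles.1 hc
  rw [polyWeight, singleton_biUnion, card_middle_of_mem_near hm hA]

lemma singles_subset_offPolymers (hm : 1 ≤ m) : singles m ⊆ offPolymers (2 * m) m := by
  intro c hc
  obtain ⟨A, hA, rfl⟩ := mem_singles.1 hc
  rw [mem_offPolymers, mem_offAntichains]
  refine ⟨⟨by simp, fun B hB => ?_⟩, linked_singleton _ _⟩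
  rw [mem_singleton.1 hB]
  rcases mem_near.1 hA with h | h <;> omega

lemma pairs_subset_offPolymers (m : ℕ) : pairs m ⊆ offPolymers (2 * m) m := by
  rw [offPolymers_eq]
  exact union_subset_union (filter_subset _ _) (image_subset_image (filter_subset _ _))

lemma mem_singles_or_mem_upperPairs (hm : 1 ≤ m) {c : Finset (Finset (Fin (2 * m)))}
    (hc : c ∈ polymers (2 * m) m) (h2 : #(falling (m + 1) c) < 3) :
    c ∈ singles m ∨ c ∈ upperPairs m := by
  have hc' := hc
  rw [mem_polymers, mem_antichainsFrom] at hc'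
  have hcard : ∀ A ∈ c, #A = m + 1 := by
    intro A hA
    have h3 := hc'.1.2 A hA
    by_contra hne
    have h4 : powersetCard (m + 1) A ⊆ falling (m + 1) c := fun B hB =>
      mem_falling.2 ⟨⟨A, hA, (mem_powersetCard.1 hB).1⟩, (mem_powersetCard.1 hB).2⟩
    have h5 := card_le_card h4
    have h6 : (m + 2).choose (m + 1) ≤ (#A).choose (m + 1) := Nat.choose_le_choose _ (by omega)
    rw [card_powersetCard] at h5
    rw [Nat.choose_succ_self_right] at h6
    omega
  have hsub : c ⊆ falling (m + 1) c := fun A hA =>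
    mem_falling.2 ⟨⟨A, hA, Subset.rfl⟩, hcard A hA⟩
  have h3 := card_le_card hsub
  have h4 := hc'.2.1.card_pos
  rcases (show #c = 1 ∨ #c = 2 by omega) with h | h
  · obtain ⟨A, rfl⟩ := card_eq_one.1 h
    exact Or.inl (mem_singles.2 ⟨A, mem_near.2 (Or.inl (hcard A (mem_singleton_self A))), rfl⟩)
  · exact Or.inr (mem_filter.2 ⟨hc, fun A hA => mem_powersetCard.2 ⟨subset_univ _, hcard A hA⟩, h⟩)

lemma offPolymers_subset (hm : 1 ≤ m) : offPolymers (2 * m) m ⊆ (singles m ∪ pairs m) ∪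
    ({c ∈ polymers (2 * m) m | 3 ≤ #(falling (m + 1) c)} ∪
      ({c ∈ polymers (2 * m) m | 3 ≤ #(falling (m + 1) c)}).image complFamily) := by
  intro c hc
  rw [offPolymers_eq, mem_union, mem_image] at hc
  simp only [mem_union, pairs]
  rcases hc with hc | ⟨d, hd, rfl⟩
  · by_cases h : 3 ≤ #(falling (m + 1) c)
    · exact Or.inr (Or.inl (mem_filter.2 ⟨hc, h⟩))
    · rcases mem_singles_or_mem_upperPairs hm hc (by omega) with h1 | h1
      · exact Or.inl (Or.inl h1)
      · exact Or.inl (Or.inr (Or.inl h1))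
  · by_cases h : 3 ≤ #(falling (m + 1) d)
    · exact Or.inr (Or.inr (mem_image_of_mem _ (mem_filter.2 ⟨hd, h⟩)))
    · rcases mem_singles_or_mem_upperPairs hm hd (by omega) with h1 | h1
      · obtain ⟨A, hA, rfl⟩ := mem_singles.1 h1
        exact Or.inl (Or.inl (mem_singles.2 ⟨Aᶜ, (compl_mem_near hm).2 hA, by simp [complFamily]⟩))
      · exact Or.inl (Or.inr (Or.inr (mem_image_of_mem _ h1)))

lemma sum_image_complFamily (Q : Finset (Finset (Finset (Fin (2 * m))))) :
    ∑ c ∈ Q.image complFamily, polyWeight (middle m) c = ∑ c ∈ Q, polyWeight (middle m) c := by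
  rw [sum_image fun _ _ _ _ h => complFamily_injective h]
  exact sum_congr rfl fun c _ => polyWeight_complFamily c

/-- Up to the polymers with a large support, only the small polymers matter. -/
lemma hardCore_offPolymers_le (hm : 1 ≤ m) :
    hardCore (Conflict (middle m)) (polyWeight (middle m)) (offPolymers (2 * m) m) ≤
      hardCore (Conflict (middle m)) (polyWeight (middle m)) (singles m) *
        Real.exp (∑ c ∈ pairs m, polyWeight (middle m) c +
          2 * ∑ c ∈ polymers (2 * m) m with 3 ≤ #(falling (m + 1) c),
            polyWeight (powersetCard m) c) := by
  set B := {c ∈ polymers (2 * m) m | 3 ≤ #(falling (m + 1) c)} with hB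
  have hw : ∀ c, 0 ≤ polyWeight (middle (n := 2 * m) m) c := polyWeight_nonneg
  have h1 := hardCore_mono (R := Conflict (middle (n := 2 * m) m)) hw (offPolymers_subset hm)
  have h2 := hardCore_union_le (R := Conflict (middle (n := 2 * m) m)) conflict_symm hw (singles m ∪ pairs m) (B ∪ B.image complFamily)
  have h3 := hardCore_union_le (R := Conflict (middle (n := 2 * m) m)) conflict_symm hw (singles m) (pairs m)
  have h4 : ∑ c ∈ B, polyWeight (middle m) c = ∑ c ∈ B, polyWeight (powersetCard m) c :=
    sum_congr rfl fun c hc => polyWeight_middle_of_mem_polymers (mem_filter.1 hc).1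
  have h5 : ∑ c ∈ B ∪ B.image complFamily, polyWeight (middle m) c ≤
      2 * ∑ c ∈ B, polyWeight (powersetCard m) c := by
    have := sum_union_inter (s₁ := B) (s₂ := B.image complFamily) (f := polyWeight (middle m))
    rw [sum_image_complFamily, h4] at this
    have h6 : 0 ≤ ∑ c ∈ B ∩ B.image complFamily, polyWeight (middle m) c :=
      sum_nonneg fun c _ => hw c
    linarith
  rw [Real.exp_add, ← mul_assoc]
  refine h1.trans (h2.trans ?_)
  exact mul_le_mul h3 (Real.exp_le_exp.2 h5) (Real.exp_pos _).le
    (mul_nonneg (zero_le_one.trans (one_le_hardCore hw _)) (Real.exp_pos _).le)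

end SmallPolymers

section Estimates

variable {m : ℕ}

lemma conflict_singleton {A B : Finset (Fin (2 * m))} :
    Conflict (middle m) {A} {B} ↔ A ≠ B ∧ Touch (middle m) A B := by
  rw [Conflict, singleton_biUnion, singleton_biUnion, Touch, ne_eq, singleton_inj]

open Classical in
lemma card_conflict_singles (hm : 1 ≤ m) {c : Finset (Finset (Fin (2 * m)))}
    (hc : c ∈ singles m) :
    #{d ∈ singles m | Conflict (middle m) c d} = (m + 1) * (m - 1) + (m + 1).choose 2 := by
  obtain ⟨A, hA, rfl⟩ := mem_singles.1 hc
  rw [← card_touch_near hm hA, singles, filter_image,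
    card_image_of_injective _ singleton_injective]
  congr 1
  exact filter_congr fun B _ => conflict_singleton

lemma conflicts_singles (hm : 1 ≤ m) : conflicts (Conflict (middle m)) (singles m) =
    2 * (2 * m).choose (m + 1) * ((m + 1) * (m - 1) + (m + 1).choose 2) := by
  rw [conflicts, sum_congr rfl fun c hc => card_conflict_singles hm hc, sum_const, smul_eq_mul,
    card_singles hm]

lemma hardCore_congr {ι : Type*} [DecidableEq ι] {R : ι → ι → Prop} {w w' : ι → ℝ} {P : Finset ι}
    (h : ∀ a ∈ P, w a = w' a) : hardCore R w P = hardCore R w' P := by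
  classical
  unfold hardCore
  refine sum_congr rfl fun Γ hΓ => prod_congr rfl fun a ha => h a ?_
  exact mem_powerset.1 (mem_filter.1 hΓ).1 ha

lemma pair_mem_upperPairs {A B : Finset (Fin (2 * m))} (hA : #A = m + 1) (hB : #B = m + 1)
    (hne : A ≠ B) (ht : Touch (middle m) A B) : {A, B} ∈ upperPairs m := by
  have hcard : ∀ X ∈ ({A, B} : Finset (Finset (Fin (2 * m)))), #X = m + 1 := by
    intro X hX
    rw [mem_insert, mem_singleton] at hX
    rcases hX with rfl | rfl <;> assumption
  have ht' : Touch (powersetCard m) A B := by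
    unfold Touch at ht ⊢
    rwa [middle_eq_powersetCard (by omega), middle_eq_powersetCard (by omega)] at ht
  rw [upperPairs, mem_filter, mem_polymers, mem_antichainsFrom]
  refine ⟨⟨⟨fun X hX Y hY hXY hsub => ?_, fun X hX => (hcard X hX).ge⟩, ⟨A, by simp⟩,
    fun P hP hPne hPc => ?_⟩, fun X hX => mem_powersetCard.2 ⟨subset_univ _, hcard X hX⟩,
    card_pair hne⟩
  · have h1 := hcard X hX
    have h2 := hcard Y hY
    exact hXY (eq_of_subset_of_card_le hsub (by omega))
  · obtain ⟨X, hX⟩ := hPne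
    have hXc := hP hX
    rw [mem_insert, mem_singleton] at hXc
    rcases hXc with rfl | rfl
    · refine ⟨X, hX, B, Finset.mem_sdiff.2 ⟨by simp, fun hBP => hPc ?_⟩, ht'⟩
      exact hP.antisymm (insert_subset hX (singleton_subset_iff.2 hBP))
    · refine ⟨X, hX, A, Finset.mem_sdiff.2 ⟨by simp, fun hAP => hPc ?_⟩, touch_symm _ _ ht'⟩
      exact hP.antisymm (insert_subset hAP (singleton_subset_iff.2 hX))

lemma exists_of_mem_upperPairs {c : Finset (Finset (Fin (2 * m)))} (hc : c ∈ upperPairs m) :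
    ∃ A B : Finset (Fin (2 * m)), #A = m + 1 ∧ #B = m + 1 ∧ A ≠ B ∧ Touch (middle m) A B ∧
      c = {A, B} := by
  rw [upperPairs, mem_filter, mem_polymers] at hc
  obtain ⟨⟨-, hlink⟩, hsub, h2⟩ := hc
  obtain ⟨A, B, hne, rfl⟩ := card_eq_two.1 h2
  have hA := (mem_powersetCard.1 (hsub (mem_insert_self A _))).2
  have hB := (mem_powersetCard.1 (hsub (mem_insert_of_mem (mem_singleton_self B)))).2
  refine ⟨A, B, hA, hB, hne, ?_, rfl⟩
  obtain ⟨X, hX, Y, hY, ht⟩ := hlink.2 {A} (by simp) (by simp) (fun h => by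
    have := congrArg card h
    rw [card_pair hne, card_singleton] at this
    omega)
  rw [mem_singleton] at hX
  rw [Finset.mem_sdiff, mem_insert, mem_singleton, mem_singleton] at hY
  have hYB : Y = B := hY.1.resolve_left hY.2
  rw [hX, hYB] at ht
  unfold Touch at ht ⊢
  rwa [middle_eq_powersetCard (by omega), middle_eq_powersetCard (by omega)]

lemma polyWeight_of_mem_upperPairs {c : Finset (Finset (Fin (2 * m)))} (hc : c ∈ upperPairs m) :
    polyWeight (middle m) c = (1 / 2) ^ (2 * m + 1) := by
  obtain ⟨A, B, hA, hB, hne, ht, rfl⟩ := exists_of_mem_upperPairs hc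
  unfold Touch at ht
  rw [middle_eq_powersetCard (by omega), middle_eq_powersetCard (by omega)] at ht
  obtain ⟨C, hCA, hCB⟩ := not_disjoint_iff.1 ht
  rw [mem_powersetCard] at hCA hCB
  have hinter : #(A ∩ B) = m := by
    have h1 := card_le_card (subset_inter hCA.1 hCB.1)
    have h2 : #(A ∩ B) ≠ m + 1 := fun h => hne (by
      have e1 := eq_of_subset_of_card_le (inter_subset_left (s₁ := A) (s₂ := B)) (by omega)
      have e2 := eq_of_subset_of_card_le (inter_subset_right (s₁ := A) (s₂ := B)) (by omega)
      exact e1.symm.trans e2)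
    have h3 := card_le_card (inter_subset_left (s₁ := A) (s₂ := B))
    omega
  have hpi : powersetCard m A ∩ powersetCard m B = powersetCard m (A ∩ B) := by
    ext X
    simp only [mem_inter, mem_powersetCard, subset_inter_iff]
    tauto
  have h4 := card_union_add_card_inter (powersetCard m A) (powersetCard m B)
  rw [hpi, card_powersetCard, card_powersetCard, card_powersetCard, hinter, hA, hB,
    Nat.choose_succ_self_right, Nat.choose_self] at h4
  rw [polyWeight, biUnion_insert, singleton_biUnion, middle_eq_powersetCard (by omega),
    middle_eq_powersetCard (by omega)]
  congr 1
  omega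

lemma card_upperPairs (m : ℕ) :
    2 * #(upperPairs m) = (2 * m).choose (m + 1) * ((m + 1) * (m - 1)) := by
  classical
  have h1 : ∑ A ∈ layer (2 * m) (m + 1), #{c ∈ upperPairs m | A ∈ c} =
      ∑ c ∈ upperPairs m, #{A ∈ layer (2 * m) (m + 1) | A ∈ c} :=
    sum_card_bipartiteAbove_eq_sum_card_bipartiteBelow _
  have h2 : ∀ c ∈ upperPairs m, #{A ∈ layer (2 * m) (m + 1) | A ∈ c} = 2 := by
    intro c hc
    have hc' := (mem_filter.1 hc).2
    rw [filter_mem_eq_inter, inter_eq_right.2 hc'.1, hc'.2]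
  have h3 : ∀ A ∈ layer (2 * m) (m + 1), #{c ∈ upperPairs m | A ∈ c} = (m + 1) * (m - 1) := by
    intro A hA
    have hA' := (mem_powersetCard.1 hA).2
    rw [← card_touch_up hA']
    symm
    refine card_bij (fun B _ => {A, B}) ?_ ?_ ?_
    · intro B hB
      rw [mem_filter, mem_powersetCard] at hB
      exact mem_filter.2 ⟨pair_mem_upperPairs hA' hB.1.2 hB.2.1 hB.2.2, mem_insert_self _ _⟩
    · intro B hB B' hB' h
      have h4 : B ∈ ({A, B'} : Finset (Finset (Fin (2 * m)))) := h ▸ by simp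
      rw [mem_insert, mem_singleton] at h4
      exact h4.resolve_left fun e => (mem_filter.1 hB).2.1 e.symm
    · intro c hc
      rw [mem_filter] at hc
      obtain ⟨X, Y, hX, hY, hne, ht, rfl⟩ := exists_of_mem_upperPairs hc.1
      rw [mem_insert, mem_singleton] at hc
      rcases hc.2 with rfl | rfl
      · exact ⟨Y, mem_filter.2 ⟨mem_powersetCard.2 ⟨subset_univ _, hY⟩, hne, ht⟩, rfl⟩
      · exact ⟨X, mem_filter.2 ⟨mem_powersetCard.2 ⟨subset_univ _, hX⟩, hne.symm,
          touch_symm _ _ ht⟩, pair_comm _ _⟩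
  rw [sum_congr rfl h2, sum_congr rfl h3, sum_const, sum_const, card_powersetCard, card_univ,
    Fintype.card_fin, smul_eq_mul, smul_eq_mul] at h1
  rw [h1, mul_comm]

lemma sum_pairs (m : ℕ) : ∑ c ∈ pairs m, polyWeight (middle m) c =
    ((2 * m).choose (m + 1) * ((m + 1) * (m - 1)) : ℕ) * (1 / 2) ^ (2 * m + 1) := by
  have hdis : Disjoint (upperPairs m) ((upperPairs m).image complFamily) := by
    rw [disjoint_left]
    intro c hc hc'
    obtain ⟨d, hd, rfl⟩ := mem_image.1 hc'
    obtain ⟨A, B, hA, -, -, -, rfl⟩ := exists_of_mem_upperPairs hd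
    have h1 := (mem_filter.1 hc).2.1
      (show Aᶜ ∈ complFamily {A, B} by rw [mem_complFamily, compl_compl]; simp)
    have h2 := (mem_powersetCard.1 h1).2
    rw [card_compl, Fintype.card_fin] at h2
    omega
  rw [pairs, sum_union hdis, sum_image_complFamily,
    sum_congr rfl fun c hc => polyWeight_of_mem_upperPairs hc, sum_const, nsmul_eq_mul,
    ← card_upperPairs]
  push_cast
  ring

lemma hdist_middle (hm : 1 ≤ m) {A C : Finset (Fin (2 * m))} (hA : A ∈ near m)
    (hC : C ∈ middle m A) : hdist A C = 1 := by
  rw [mem_middle] at hC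
  rw [mem_near] at hA
  rcases hC.2 with h | h
  · have := card_le_card h
    rw [hdist_of_subset h]
    omega
  · have := card_le_card h
    rw [hdist_symm, hdist_of_subset h]
    omega

lemma hdist_le_two_of_touch_middle (hm : 1 ≤ m) {A B : Finset (Fin (2 * m))} (hA : A ∈ near m)
    (hB : B ∈ near m) (h : Touch (middle m) A B) : hdist A B ≤ 2 := by
  obtain ⟨C, hCA, hCB⟩ := not_disjoint_iff.1 h
  have h1 := hdist_triangle A C B
  rw [hdist_middle hm hA hCA, hdist_symm C B, hdist_middle hm hB hCB] at h1
  exact h1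

lemma exists_pair_of_mem (hm : 1 ≤ m) {c : Finset (Finset (Fin (2 * m)))}
    (hc : c ∈ singles m ∪ pairs m) : ∃ A ∈ near m, ∃ B ∈ near m, hdist A B ≤ 2 ∧ c = {A, B} := by
  have hup : ∀ c ∈ upperPairs m, ∃ A ∈ near m, ∃ B ∈ near m, Touch (middle m) A B ∧ c = {A, B} := by
    intro c hc
    obtain ⟨A, B, hA, hB, -, ht, rfl⟩ := exists_of_mem_upperPairs hc
    exact ⟨A, mem_near.2 (Or.inl hA), B, mem_near.2 (Or.inl hB), ht, rfl⟩
  rw [mem_union, pairs, mem_union, mem_image] at hc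
  rcases hc with hc | hc | ⟨d, hd, rfl⟩
  · obtain ⟨A, hA, rfl⟩ := mem_singles.1 hc
    exact ⟨A, hA, A, hA, by simp [hdist], by simp⟩
  · obtain ⟨A, hA, B, hB, ht, rfl⟩ := hup c hc
    exact ⟨A, hA, B, hB, hdist_le_two_of_touch_middle hm hA hB ht, rfl⟩
  · obtain ⟨A, hA, B, hB, ht, rfl⟩ := hup d hd
    exact ⟨Aᶜ, (compl_mem_near hm).2 hA, Bᶜ, (compl_mem_near hm).2 hB,
      hdist_le_two_of_touch_middle hm ((compl_mem_near hm).2 hA) ((compl_mem_near hm).2 hB)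
        (touch_middle_compl.2 ht), by simp [complFamily, image_insert]⟩

lemma polyWeight_le_of_mem (hm : 1 ≤ m) {c : Finset (Finset (Fin (2 * m)))}
    (hc : c ∈ singles m ∪ pairs m) : polyWeight (middle m) c ≤ (1 / 2) ^ (m + 1) := by
  obtain ⟨A, hA, B, -, -, rfl⟩ := exists_pair_of_mem hm hc
  refine pow_le_pow_of_le_one (by norm_num) (by norm_num) ?_
  rw [← card_middle_of_mem_near hm hA]
  exact card_le_card (subset_biUnion_of_mem (middle m) (mem_insert_self A _))

open Classical in
lemma sum_conflict_le (hm : 1 ≤ m) {b : Finset (Finset (Fin (2 * m)))}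
    (hb : b ∈ singles m ∪ pairs m) :
    ∑ c ∈ singles m ∪ pairs m with Conflict (middle m) b c, polyWeight (middle m) c ≤
      (2 * m + 1) ^ 12 * (1 / 2) ^ (m + 1) := by
  obtain ⟨X, hX, Y, hY, hXY, rfl⟩ := exists_pair_of_mem hm hb
  have hsub : {c ∈ singles m ∪ pairs m | Conflict (middle m) {X, Y} c} ⊆
      (hball 6 X ×ˢ hball 6 X).image fun p => {p.1, p.2} := by
    intro c hc
    rw [mem_filter] at hc
    obtain ⟨A, hA, B, hB, hAB, rfl⟩ := exists_pair_of_mem hm hc.1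
    obtain ⟨v, hv, hv'⟩ := not_disjoint_iff.1 hc.2.2
    simp only [biUnion_insert, singleton_biUnion, mem_union] at hv hv'
    have h1 : hdist X v ≤ 3 := by
      rcases hv with h | h
      · rw [hdist_middle hm hX h]; omega
      · have := hdist_triangle X Y v
        rw [hdist_middle hm hY h] at this
        omega
    have key : ∀ A ∈ near m, ∀ B ∈ near m, hdist A B ≤ 2 → v ∈ middle m A →
        hdist X A ≤ 6 ∧ hdist X B ≤ 6 := by
      intro A hA B hB hAB h
      have h2 := hdist_triangle X v A
      rw [hdist_symm v A, hdist_middle hm hA h] at h2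
      have h3 := hdist_triangle X A B
      omega
    refine mem_image.2 ⟨(A, B), mem_product.2 ?_, rfl⟩
    rw [mem_hball, mem_hball]
    rcases hv' with h | h
    · exact key A hA B hB hAB h
    · exact (key B hB A hA (by rwa [hdist_symm]) h).symm
  have hcard : #{c ∈ singles m ∪ pairs m | Conflict (middle m) {X, Y} c} ≤ (2 * m + 1) ^ 12 := by
    refine (card_le_card hsub).trans (card_image_le.trans ?_)
    rw [card_product]
    have := card_hball_le 6 X
    calc _ ≤ (2 * m + 1) ^ 6 * (2 * m + 1) ^ 6 := Nat.mul_le_mul this this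
      _ = _ := by ring
  calc _ ≤ ∑ c ∈ singles m ∪ pairs m with Conflict (middle m) {X, Y} c, (1 / 2 : ℝ) ^ (m + 1) :=
        sum_le_sum fun c hc => polyWeight_le_of_mem hm (mem_filter.1 hc).1
    _ = #{c ∈ singles m ∪ pairs m | Conflict (middle m) {X, Y} c} * (1 / 2 : ℝ) ^ (m + 1) := by
        rw [sum_const, nsmul_eq_mul]
    _ ≤ _ := by
        gcongr
        exact_mod_cast hcard

lemma disjoint_singles_pairs (m : ℕ) : Disjoint (singles m) (pairs m) := by
  rw [disjoint_left]
  intro c hc hc'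
  obtain ⟨A, -, rfl⟩ := mem_singles.1 hc
  have h2 : #({A} : Finset (Finset (Fin (2 * m)))) = 2 := by
    rw [pairs, mem_union, mem_image] at hc'
    rcases hc' with h | ⟨d, hd, h⟩
    · exact (mem_filter.1 h).2.2
    · rw [← h, complFamily, card_image_of_injective _ compl_injective]
      exact (mem_filter.1 hd).2.2
  simp at h2

lemma hardCore_offPolymers_ge (hm : 1 ≤ m)
    (hε : (2 * m + 1) ^ 12 * (1 / 2) ^ (m + 1) ≤ (1 : ℝ)) :
    hardCore (Conflict (middle m)) (polyWeight (middle m)) (singles m) *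
        Real.exp ((1 - 2 * ((2 * m + 1) ^ 12 * (1 / 2) ^ (m + 1))) *
          ∑ c ∈ pairs m, polyWeight (middle m) c) ≤
      hardCore (Conflict (middle m)) (polyWeight (middle m)) (offPolymers (2 * m) m) := by
  have hw : ∀ c, 0 ≤ polyWeight (middle (n := 2 * m) m) c := polyWeight_nonneg
  refine (hardCore_union_ge_exp conflict_symm hw (by positivity) hε _ _
    (disjoint_singles_pairs m) (fun b hb => ?_) fun b hb => ?_).trans
      (hardCore_mono hw (union_subset (singles_subset_offPolymers hm) (pairs_subset_offPolymers m)))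
  · refine (polyWeight_le_of_mem hm (mem_union_right _ hb)).trans ?_
    refine le_mul_of_one_le_left (by positivity) (one_le_pow₀ ?_)
    linarith [m.cast_nonneg (α := ℝ)]
  · exact sum_conflict_le hm (mem_union_right _ hb)

end Estimates

section Asymptotics

lemma centralBinom_sq_mul_le (m : ℕ) : m.centralBinom ^ 2 * (2 * m + 1) ≤ 16 ^ m := by
  induction m with
  | zero => simp
  | succ m ih =>
    have h := Nat.succ_mul_centralBinom_succ m
    have h1 : (m + 1) ^ 2 * ((m + 1).centralBinom ^ 2 * (2 * (m + 1) + 1)) =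
        (2 * (2 * m + 1) * m.centralBinom) ^ 2 * (2 * m + 3) := by
      rw [← h]; ring
    refine Nat.le_of_mul_le_mul_left (c := (m + 1) ^ 2) ?_ (by positivity)
    rw [h1]
    calc _ = (m.centralBinom ^ 2 * (2 * m + 1)) * (4 * ((2 * m + 1) * (2 * m + 3))) := by ring
      _ ≤ 16 ^ m * (4 * (4 * (m + 1) ^ 2)) := by
          refine Nat.mul_le_mul ih (Nat.mul_le_mul_left 4 ?_)
          nlinarith
      _ = _ := by rw [pow_succ 16]; ring

lemma choose_mul_le (m : ℕ) :
    ((2 * m).choose (m + 1) * ((1 / 2 : ℝ) ^ m) ^ 2) ^ 2 ≤ 1 / (2 * m + 1) := by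
  have h1 : ((2 * m).choose (m + 1)) ≤ m.centralBinom := Nat.choose_le_centralBinom _ _
  have h2 : (((2 * m).choose (m + 1) : ℝ)) ^ 2 * (2 * m + 1) ≤ 16 ^ m := by
    have := (Nat.mul_le_mul_right (2 * m + 1) (Nat.pow_le_pow_left h1 2)).trans
      (centralBinom_sq_mul_le m)
    exact_mod_cast this
  rw [le_div_iff₀ (by positivity)]
  have h3 : (((1 / 2 : ℝ) ^ m) ^ 2) ^ 2 = 1 / 16 ^ m := by
    rw [← pow_mul, ← pow_mul, mul_comm m, pow_mul, ← one_div_pow]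
    norm_num
  rw [mul_pow, h3]
  calc _ = (((2 * m).choose (m + 1) : ℝ)) ^ 2 * (2 * m + 1) * (1 / 16 ^ m) := by ring
    _ ≤ 16 ^ m * (1 / 16 ^ m) := by gcongr
    _ = 1 := by field_simp

lemma tendsto_choose_mul :
    Tendsto (fun m : ℕ => (2 * m).choose (m + 1) * ((1 / 2 : ℝ) ^ m) ^ 2) atTop (nhds 0) := by
  have h1 : Tendsto (fun m : ℕ => 1 / (2 * (m : ℝ) + 1)) atTop (nhds 0) := by
    refine squeeze_zero (fun m => by positivity) (fun m => ?_)
      tendsto_one_div_add_atTop_nhds_zero_nat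
    exact one_div_le_one_div_of_le (by positivity) (by linarith [m.cast_nonneg (α := ℝ)])
  have h2 := h1.sqrt
  rw [Real.sqrt_zero] at h2
  exact squeeze_zero (fun m => by positivity) (fun m => Real.le_sqrt_of_sq_le (choose_mul_le m)) h2

lemma tendsto_pow_mul_half_pow :
    Tendsto (fun m : ℕ => (2 * (m : ℝ) + 1) ^ 14 * (1 / 2) ^ m) atTop (nhds 0) := by
  have h := (tendsto_pow_const_mul_const_pow_of_abs_lt_one 14
    (r := (1 / 2 : ℝ)) (by rw [abs_of_pos] <;> norm_num)).const_mul (3 ^ 14)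
  rw [mul_zero] at h
  refine squeeze_zero' (Eventually.of_forall fun m => by positivity) ?_ h
  filter_upwards [eventually_ge_atTop 1] with m hm
  have hm' : (1 : ℝ) ≤ m := by exact_mod_cast hm
  rw [← mul_assoc, ← mul_pow]
  gcongr
  linarith

lemma tendsto_half_pow_div_two :
    Tendsto (fun m : ℕ => (1 / 2 : ℝ) ^ (m / 2)) atTop (nhds 0) :=
  (tendsto_pow_atTop_nhds_zero_of_lt_one (by norm_num) (by norm_num)).comp
    (Nat.tendsto_div_const_atTop two_ne_zero)

/-- The exponent in the asymptotic formula. -/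
noncomputable def mainExponent (m : ℕ) : ℝ :=
  (2 * m).choose (m + 1) * ((1 / 2) ^ m + ((2 * m : ℝ) ^ 2 - 2 * (2 * m) - 16) / 32 * ((1 / 2) ^ m) ^ 2)

lemma cast_degree {m : ℕ} (hm : 1 ≤ m) :
    (((m + 1) * (m - 1) + (m + 1).choose 2 : ℕ) : ℝ) =
      (m + 1) * (m - 1) + (m + 1) * m / 2 := by
  rw [Nat.cast_add, Nat.cast_choose_two]
  push_cast [Nat.cast_sub hm]
  ring

lemma cast_conflicts_singles {m : ℕ} (hm : 1 ≤ m) :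
    (conflicts (Conflict (middle m)) (singles m) : ℝ) =
      2 * (2 * m).choose (m + 1) * ((m + 1) * (m - 1) + (m + 1) * m / 2) := by
  rw [conflicts_singles hm, Nat.cast_mul, cast_degree hm]
  push_cast
  ring

lemma cast_sum_pairs {m : ℕ} (hm : 1 ≤ m) : ∑ c ∈ pairs m, polyWeight (middle m) c =
    (2 * m).choose (m + 1) * ((m + 1) * (m - 1)) * (1 / 2) ^ (2 * m + 1) := by
  rw [sum_pairs]
  push_cast [Nat.cast_sub hm]
  ring

lemma half_pow_succ (m : ℕ) : (1 / 2 : ℝ) ^ (m + 1) = (1 / 2) ^ m / 2 := by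
  rw [pow_succ]; ring

lemma half_pow_two_mul_succ (m : ℕ) : (1 / 2 : ℝ) ^ (2 * m + 1) = ((1 / 2) ^ m) ^ 2 / 2 := by
  rw [half_pow_succ, ← pow_mul, mul_comm]

lemma hardCore_singles_eq {m : ℕ} (hm : 1 ≤ m) :
    hardCore (Conflict (middle m)) (polyWeight (middle m)) (singles m) =
      hardCore (Conflict (middle m)) (fun _ => (1 / 2) ^ (m + 1)) (singles m) :=
  hardCore_congr fun _ hc => polyWeight_of_mem_singles hm hc

lemma half_pow_mul_degree_le {m : ℕ} (hm : 1 ≤ m)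
    (hu : (2 * (m : ℝ) + 1) ^ 14 * (1 / 2) ^ m ≤ 1) :
    (1 / 2 : ℝ) ^ (m + 1) * ((m + 1) * (m - 1) + (m + 1) * m / 2) ≤ 1 := by
  have hm' : (1 : ℝ) ≤ m := by exact_mod_cast hm
  refine le_trans ?_ hu
  rw [mul_comm]
  refine mul_le_mul ?_ (pow_le_pow_of_le_one (by norm_num) (by norm_num) (Nat.le_succ m))
    (by positivity) (by positivity)
  calc _ ≤ (2 * (m : ℝ) + 1) ^ 2 := by nlinarith
    _ ≤ _ := pow_le_pow_right₀ (by linarith) (by norm_num)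

open Classical in
lemma cast_card_conflict_le {m : ℕ} (hm : 1 ≤ m) : ∀ b ∈ singles m,
    (#{c ∈ singles m | Conflict (middle m) b c} : ℝ) ≤ (m + 1) * (m - 1) + (m + 1) * m / 2 :=
  fun b hb => by rw [card_conflict_singles hm hb, cast_degree hm]

lemma hardCore_le_exp_mainExponent {m : ℕ} (hm : 1 ≤ m)
    (hu : (2 * (m : ℝ) + 1) ^ 14 * (1 / 2) ^ m ≤ 1)
    (hS : ∑ c ∈ polymers (2 * m) m with 3 ≤ #(falling (m + 1) c), polyWeight (powersetCard m) c ≤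
      2 * (1 / 2) ^ (m / 2))
    (hC : (2 * m).choose (m + 1) * ((1 / 2 : ℝ) ^ m) ^ 2 ≤ 1) :
    hardCore (Conflict (middle m)) (polyWeight (middle m)) (offPolymers (2 * m) m) ≤
      Real.exp (mainExponent m + ((2 * m).choose (m + 1) * ((1 / 2 : ℝ) ^ m) ^ 2 / 4 +
        (2 * (m : ℝ) + 1) ^ 14 * (1 / 2) ^ m + 4 * (1 / 2) ^ (m / 2))) := by
  have hm' : (1 : ℝ) ≤ m := by exact_mod_cast hm
  refine (hardCore_offPolymers_le hm).trans ?_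
  rw [hardCore_singles_eq hm]
  refine (mul_le_mul_of_nonneg_right (hardCore_le_exp_of_const conflict_symm conflict_irrefl
    (by positivity) (half_pow_mul_degree_le hm hu) _ (cast_card_conflict_le hm))
    (Real.exp_pos _).le).trans ?_
  rw [← Real.exp_add, Real.exp_le_exp, cast_conflicts_singles hm, card_singles hm, cast_sum_pairs hm,
    mainExponent]
  rw [half_pow_succ, half_pow_two_mul_succ]
  push_cast
  set C := (((2 * m).choose (m + 1) : ℕ) : ℝ)
  set q : ℝ := (1 / 2) ^ m with hq
  have hq0 : 0 ≤ q := by positivity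
  have h2 : C * q ^ 2 * (q * ((m + 1) * (m - 1) + (m + 1) * m / 2) ^ 2 / 2) ≤
      1 * ((2 * m + 1) ^ 14 * q) := by
    refine mul_le_mul hC ?_ (by positivity) zero_le_one
    have h3 : ((m + 1) * (m - 1) + (m + 1) * m / 2 : ℝ) ^ 2 ≤ (2 * m + 1) ^ 14 := by
      calc _ ≤ ((2 * (m : ℝ) + 1) ^ 2) ^ 2 := by
            refine pow_le_pow_left₀ (by nlinarith) (by nlinarith) 2
        _ = (2 * (m : ℝ) + 1) ^ 4 := by ring
        _ ≤ _ := pow_le_pow_right₀ (by linarith) (by norm_num)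
    have h4 := mul_le_mul_of_nonneg_right h3 hq0
    have h5 : 0 ≤ ((m + 1) * (m - 1) + (m + 1) * m / 2 : ℝ) ^ 2 * q := by positivity
    linarith
  linear_combination 2 * hS + h2

lemma exp_mainExponent_le_hardCore {m : ℕ} (hm : 1 ≤ m)
    (hu : (2 * (m : ℝ) + 1) ^ 14 * (1 / 2) ^ m ≤ 1)
    (hC : (2 * m).choose (m + 1) * ((1 / 2 : ℝ) ^ m) ^ 2 ≤ 1) :
    Real.exp (mainExponent m - ((2 * m).choose (m + 1) * ((1 / 2 : ℝ) ^ m) ^ 2 / 4 +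
        (2 * (m : ℝ) + 1) ^ 14 * (1 / 2) ^ m)) ≤
      hardCore (Conflict (middle m)) (polyWeight (middle m)) (offPolymers (2 * m) m) := by
  have hm' : (1 : ℝ) ≤ m := by exact_mod_cast hm
  have hε : (2 * m + 1) ^ 12 * (1 / 2) ^ (m + 1) ≤ (1 : ℝ) := by
    refine le_trans ?_ hu
    refine mul_le_mul (pow_le_pow_right₀ (by linarith) (by norm_num))
      (pow_le_pow_of_le_one (by norm_num) (by norm_num) (Nat.le_succ m))
      (by positivity) (by positivity)
  refine le_trans ?_ (hardCore_offPolymers_ge hm hε)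
  rw [hardCore_singles_eq hm]
  refine le_trans ?_ (mul_le_mul_of_nonneg_right (hardCore_ge_exp_of_const conflict_symm
    conflict_irrefl (by positivity) (half_pow_mul_degree_le hm hu) _ (cast_card_conflict_le hm))
    (Real.exp_pos _).le)
  rw [← Real.exp_add, Real.exp_le_exp, cast_conflicts_singles hm, card_singles hm, cast_sum_pairs hm,
    mainExponent]
  rw [half_pow_succ, half_pow_two_mul_succ]
  push_cast
  set C := (((2 * m).choose (m + 1) : ℕ) : ℝ)
  set q : ℝ := (1 / 2) ^ m with hq
  have hq0 : 0 ≤ q := by positivity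
  have h2 : C * q ^ 2 * (q * ((2 * m + 1) ^ 12 * ((m + 1) * (m - 1))) / 2) ≤
      1 * ((2 * m + 1) ^ 14 * q) := by
    have h0 : (0 : ℝ) ≤ (m + 1) * (m - 1) := by nlinarith
    refine mul_le_mul hC ?_ (by positivity) zero_le_one
    have h3 : ((2 * m + 1) ^ 12 * ((m + 1) * (m - 1)) : ℝ) ≤ (2 * m + 1) ^ 14 := by
      rw [show 14 = 12 + 2 from rfl, pow_add (2 * (m : ℝ) + 1)]
      gcongr
      nlinarith
    have h4 := mul_le_mul_of_nonneg_right h3 hq0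
    have h5 : 0 ≤ ((2 * m + 1) ^ 12 * ((m + 1) * (m - 1)) : ℝ) * q := by positivity
    linarith
  linear_combination h2

lemma tendsto_hardCore_div :
    Tendsto (fun m : ℕ =>
      hardCore (Conflict (middle m)) (polyWeight (middle m)) (offPolymers (2 * m) m) /
        Real.exp (mainExponent m)) atTop (nhds 1) := by
  obtain ⟨k₀, hk₀⟩ := exists_sum_three_le_le
  have hlow := (Real.continuous_exp.tendsto _).comp
    ((tendsto_choose_mul.div_const 4).add tendsto_pow_mul_half_pow).neg
  have hupp := (Real.continuous_exp.tendsto _).comp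
    (((tendsto_choose_mul.div_const 4).add tendsto_pow_mul_half_pow).add
      (tendsto_half_pow_div_two.const_mul 4))
  simp only [zero_div, add_zero, neg_zero, mul_zero, Real.exp_zero] at hlow hupp
  have hu := tendsto_pow_mul_half_pow.eventually_le_const zero_lt_one
  have hC := tendsto_choose_mul.eventually_le_const zero_lt_one
  refine tendsto_of_tendsto_of_tendsto_of_le_of_le' hlow hupp ?_ ?_
  · filter_upwards [hu, hC, eventually_ge_atTop 1] with m hu hC hm
    rw [le_div_iff₀ (Real.exp_pos _), Function.comp_apply, ← Real.exp_add]
    refine le_trans (le_of_eq ?_) (exp_mainExponent_le_hardCore hm hu hC)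
    congr 1
    ring
  · filter_upwards [hu, hC, eventually_ge_atTop 1, eventually_ge_atTop k₀] with m hu hC hm hk
    rw [div_le_iff₀ (Real.exp_pos _), Function.comp_apply, ← Real.exp_add]
    refine (hardCore_le_exp_mainExponent hm hu (hk₀ m hk) hC).trans (le_of_eq ?_)
    congr 1
    ring

end Asymptotics

end Dedekind

/-- Korshunov's asymptotic solution of Dedekind's problem, even case (`n = 2k`). -/
theorem stmt2 :
    Tendsto (fun k : ℕ =>
      (alphaBool (2 * k) : ℝ) /
        ((2 : ℝ) ^ (Nat.choose (2 * k) k) *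
          Real.exp ((Nat.choose (2 * k) (k + 1) : ℝ) *
            ((2 : ℝ) ^ (-(k : ℝ)) +
              (((2 * k : ℝ) ^ 2 - 2 * (2 * k : ℝ) - 16) / 32) * (2 : ℝ) ^ (-(2 * k : ℝ))))))
      atTop (nhds 1) := by
  refine Dedekind.tendsto_hardCore_div.congr fun k => ?_
  have h1 : (2 : ℝ) ^ (-(k : ℝ)) = (1 / 2) ^ k := by
    rw [Real.rpow_neg zero_le_two, Real.rpow_natCast, one_div, inv_pow]
  have h2 : (2 : ℝ) ^ (-(2 * k : ℝ)) = ((1 / 2) ^ k) ^ 2 := by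
    rw [← h1, ← Real.rpow_natCast, ← Real.rpow_mul zero_le_two]
    congr 1
    push_cast
    ring
  rw [alphaBool, Dedekind.card_antichains_eq (2 * k) k,
    Dedekind.sum_offAntichains_eq (by omega), h1, h2, mul_div_mul_left _ _ (by positivity),
    Dedekind.mainExponent]
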